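/- Let X = {f = 0} ⊂ ℙ³(ℂ) be a surface of degree 6 whose only singularities are exactly 10 ordinary triple points P₁, …, P₁₀. Then the only homogeneous polynomial of degree 2 in ℂ[x₀,x₁,x₂,x₃] vanishing at all ten points P₁, …, P₁₀ is the zero polynomial; that is, the ten triple points do not lie on a quadric surface. -/

import Mathlib

open MvPolynomial

noncomputable section

/-- Iterated partial derivative of `f` along a list of variable indices. -/
def pderivList {n : ℕ} (l : List (Fin n)) (f : MvPolynomial (Fin n) ℂ) :
    MvPolynomial (Fin n) ℂ :=
  l.foldl (fun g i => MvPolynomial.pderiv i g) f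

/-- All partial derivatives of `f` of order `< m` vanish at `p`
(`P` has multiplicity `≥ m` on `{f = 0}`). -/
def MultAtLeast {n : ℕ} (f : MvPolynomial (Fin n) ℂ) (p : Fin n → ℂ) (m : ℕ) : Prop :=
  ∀ l : List (Fin n), l.length < m → MvPolynomial.eval p (pderivList l f) = 0

/-- `p` is (a representative of) a singular point of `{f = 0}`. -/
def SingularAt (f : MvPolynomial (Fin 4) ℂ) (p : Fin 4 → ℂ) : Prop :=
  MultAtLeast f p 2

/-- The partial derivatives of `c` have no common zero in `ℂⁿ ∖ {0}`. -/
def NowhereSingular {n : ℕ} (c : MvPolynomial (Fin n) ℂ) : Prop :=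
  ∀ p : Fin n → ℂ, p ≠ 0 → ∃ i, MvPolynomial.eval p (MvPolynomial.pderiv i c) ≠ 0

/-- Linear change of coordinates: `substMatrix B f` is the polynomial `x ↦ f (B.mulVec x)`. -/
def substMatrix {n : ℕ} (B : Matrix (Fin n) (Fin n) ℂ) (f : MvPolynomial (Fin n) ℂ) :
    MvPolynomial (Fin n) ℂ :=
  MvPolynomial.aeval (fun i => ∑ j, MvPolynomial.C (B i j) * MvPolynomial.X j) f

/-- `p` is (a representative of) an ordinary triple point of the degree-`d` surface `{f = 0}`:
all partials of order `≤ 2` vanish at `p`, some third-order partial does not, and after a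
linear change of coordinates taking `(0,0,0,1)` to `p`, writing `f` as
`∑ⱼ x₃^(d-j) fⱼ(x₀,x₁,x₂)` with `fⱼ` homogeneous of degree `j`, the cubic `f₃` is nonsingular. -/
def OrdinaryTriplePointAt (d : ℕ) (f : MvPolynomial (Fin 4) ℂ) (p : Fin 4 → ℂ) : Prop :=
  MultAtLeast f p 3 ∧
  (∃ l : List (Fin 4), l.length = 3 ∧ MvPolynomial.eval p (pderivList l f) ≠ 0) ∧
  ∃ B : Matrix (Fin 4) (Fin 4) ℂ, IsUnit B.det ∧ B.mulVec ![0, 0, 0, 1] = p ∧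
    ∃ g : ℕ → MvPolynomial (Fin 3) ℂ,
      (∀ j, (g j).IsHomogeneous j) ∧
      substMatrix B f =
        ∑ j ∈ Finset.range (d + 1),
          (MvPolynomial.X 3) ^ (d - j) * MvPolynomial.rename Fin.castSucc (g j) ∧
      NowhereSingular (g 3)

/-- The set of singular points of `{f = 0}` in `ℙ³(ℂ)`. -/
def SingSet (f : MvPolynomial (Fin 4) ℂ) : Set (Projectivization ℂ (Fin 4 → ℂ)) :=
  {P | SingularAt f P.rep}

/-- `{f = 0}` has `ν` ordinary triple points as its only singularities. -/
def OnlyTriplePoints (d ν : ℕ) (f : MvPolynomial (Fin 4) ℂ) : Prop :=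
  (SingSet f).Finite ∧ (SingSet f).ncard = ν ∧
  ∀ P ∈ SingSet f, OrdinaryTriplePointAt d f P.rep

/-- The derivative of polynomials in the constant direction `v`. -/
def dirDeriv {n : ℕ} (v : Fin n → ℂ) :
    Derivation ℂ (MvPolynomial (Fin n) ℂ) (MvPolynomial (Fin n) ℂ) :=
  ∑ i, v i • pderiv i

lemma dirDeriv_apply {n : ℕ} (v : Fin n → ℂ) (g : MvPolynomial (Fin n) ℂ) :
    dirDeriv v g = ∑ i, v i • pderiv i g := by
  have h := congrFun (map_sum (Derivation.coeFnAddMonoidHom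
    (R := ℂ) (A := MvPolynomial (Fin n) ℂ) (M := MvPolynomial (Fin n) ℂ))
    (fun i => v i • pderiv i) Finset.univ) g
  refine h.trans ?_
  rw [Finset.sum_apply]
  rfl

lemma eval_dirDeriv {n : ℕ} (v x : Fin n → ℂ) (g : MvPolynomial (Fin n) ℂ) :
    eval x (dirDeriv v g) = ∑ i, v i * eval x (pderiv i g) := by
  simp [dirDeriv_apply, smul_eval]

lemma derivation_aeval {σ A : Type*} [Fintype σ] [CommRing A] [Algebra ℂ A]
    (D : Derivation ℂ A A) (φ : σ → A) (g : MvPolynomial σ ℂ) :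
    D (aeval φ g) = ∑ k, aeval φ (pderiv k g) * D (φ k) := by
  classical
  induction g using MvPolynomial.induction_on with
  | C a => simp
  | add p q hp hq => simp [hp, hq, add_mul, Finset.sum_add_distrib]
  | mul_X p i hp =>
    simp only [map_mul, aeval_X, Derivation.leibniz, hp, pderiv_X, smul_eq_mul, map_add, add_mul,
      Finset.sum_add_distrib, Finset.mul_sum]
    congr 1
    · rw [Finset.sum_eq_single i]
      · simp
      · intro b _ hb; simp [hb]
      · simp
    · exact Finset.sum_congr rfl fun k _ => by ring

lemma derivative_aeval {n : ℕ} (γ : Fin n → Polynomial ℂ) (g : MvPolynomial (Fin n) ℂ) :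
    Polynomial.derivative (aeval γ g) =
      ∑ k, aeval γ (pderiv k g) * Polynomial.derivative (γ k) := by
  have := derivation_aeval (Polynomial.derivative' (R := ℂ)) γ g
  simpa using this

lemma eval_smul_of_isHomogeneous {n d : ℕ} {g : MvPolynomial (Fin n) ℂ} (hg : g.IsHomogeneous d)
    (c : ℂ) (x : Fin n → ℂ) : eval (c • x) g = c ^ d * eval x g := by
  rw [eval_eq', eval_eq', Finset.mul_sum]
  refine Finset.sum_congr rfl fun m hm => ?_
  have := hg (mem_support_iff.1 hm)
  rw [Finsupp.weight_apply, Finsupp.sum_fintype _ _ (by simp)] at this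
  simp only [Pi.smul_apply, smul_eq_mul, mul_pow, Finset.prod_mul_distrib, Finset.prod_pow_eq_pow_sum]
  rw [show ∑ i, m i = d by simpa using this]
  ring

lemma multAtLeast_succ {n : ℕ} {g : MvPolynomial (Fin n) ℂ} {x : Fin n → ℂ} {m : ℕ} :
    MultAtLeast g x (m + 1) ↔ eval x g = 0 ∧ ∀ i, MultAtLeast (pderiv i g) x m := by
  constructor
  · intro h
    refine ⟨h [] (by simp), fun i l hl => h (i :: l) (by simpa using hl)⟩
  · rintro ⟨h0, h⟩ l hl
    cases l with
    | nil => exact h0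
    | cons i l => exact h i l (by simpa using hl)

lemma multAtLeast_zero {n : ℕ} {g : MvPolynomial (Fin n) ℂ} {x : Fin n → ℂ} :
    MultAtLeast g x 0 := fun l hl => by simp at hl

lemma multAtLeast_one {n : ℕ} {g : MvPolynomial (Fin n) ℂ} {x : Fin n → ℂ} :
    MultAtLeast g x 1 ↔ eval x g = 0 := by
  rw [multAtLeast_succ]; simp [multAtLeast_zero]

lemma MultAtLeast.mono {n : ℕ} {g : MvPolynomial (Fin n) ℂ} {x : Fin n → ℂ} {m k : ℕ}
    (h : MultAtLeast g x m) (hk : k ≤ m) : MultAtLeast g x k :=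
  fun l hl => h l (hl.trans_le hk)

lemma pderivList_sum_smul {n : ℕ} {ι : Type*} (s : Finset ι) (c : ι → ℂ)
    (g : ι → MvPolynomial (Fin n) ℂ) (l : List (Fin n)) :
    pderivList l (∑ i ∈ s, c i • g i) = ∑ i ∈ s, c i • pderivList l (g i) := by
  induction l generalizing g with
  | nil => rfl
  | cons a l ih =>
    change pderivList l (pderiv a _) = ∑ i ∈ s, c i • pderivList l (pderiv a (g i))
    rw [← ih]; simp

lemma MultAtLeast.dirDeriv {n : ℕ} {g : MvPolynomial (Fin n) ℂ} {x : Fin n → ℂ} {m : ℕ}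
    (h : MultAtLeast g x (m + 1)) (v : Fin n → ℂ) : MultAtLeast (dirDeriv v g) x m := by
  intro l hl
  rw [dirDeriv_apply, pderivList_sum_smul]
  simp only [map_sum, smul_eval]
  exact Finset.sum_eq_zero fun i _ => by rw [(multAtLeast_succ.1 h).2 i l hl, mul_zero]

/-- A curve through a point of multiplicity `m` meets the hypersurface there with order `≥ m`. -/
lemma MultAtLeast.dvd_aeval {n : ℕ} {g : MvPolynomial (Fin n) ℂ} {γ : Fin n → Polynomial ℂ}
    {s : ℂ} {m : ℕ} (h : MultAtLeast g (fun k => (γ k).eval s) m) :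
    (Polynomial.X - Polynomial.C s) ^ m ∣ aeval γ g := by
  have hev : ∀ g : MvPolynomial (Fin n) ℂ,
      (aeval γ g).eval s = eval (fun k => (γ k).eval s) g := by
    intro g
    have := (MvPolynomial.comp_aeval_apply γ (Polynomial.aeval s) g)
    simp only [Polynomial.coe_aeval_eq_eval] at this
    rw [this]; rfl
  induction m generalizing g with
  | zero => simp
  | succ m ih =>
    rw [multAtLeast_succ] at h
    have hd : (Polynomial.X - Polynomial.C s) ^ m ∣ Polynomial.derivative (aeval γ g) := by
      rw [derivative_aeval]
      exact Finset.dvd_sum fun k _ => (ih (h.2 k)).mul_right _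
    have hr : (aeval γ g).IsRoot s := by rw [Polynomial.IsRoot, hev, h.1]
    by_cases h0 : aeval γ g = 0
    · simp [h0]
    have hd0 : Polynomial.derivative (aeval γ g) ≠ 0 := by
      intro h1
      have := Polynomial.derivative_eq_zero.1 h1
      obtain ⟨c, hc⟩ := Polynomial.natDegree_eq_zero.1 this
      rw [← hc] at hr h0
      simp at hr
      simp [hr] at h0
    rw [← Polynomial.le_rootMultiplicity_iff h0]
    rw [← Polynomial.le_rootMultiplicity_iff hd0,
      Polynomial.derivative_rootMultiplicity_of_root hr] at hd
    have := (Polynomial.rootMultiplicity_pos h0).2 hr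
    omega

lemma eval_aeval_curve {n : ℕ} (γ : Fin n → Polynomial ℂ) (s : ℂ) (g : MvPolynomial (Fin n) ℂ) :
    (aeval γ g).eval s = eval (fun k => (γ k).eval s) g := by
  have := (MvPolynomial.comp_aeval_apply γ (Polynomial.aeval s) g)
  simp only [Polynomial.coe_aeval_eq_eval] at this
  rw [this]; rfl

lemma prod_natDegree_coeff {ι : Type*} (s : Finset ι) (p : ι → Polynomial ℂ) (d : ι → ℕ)
    (h : ∀ i ∈ s, (p i).natDegree ≤ d i) :
    (∏ i ∈ s, p i).natDegree ≤ ∑ i ∈ s, d i ∧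
      (∏ i ∈ s, p i).coeff (∑ i ∈ s, d i) = ∏ i ∈ s, (p i).coeff (d i) := by
  classical
  induction s using Finset.induction_on with
  | empty => simp
  | insert a s ha ih =>
    have ih' := ih fun i hi => h i (Finset.mem_insert_of_mem hi)
    have h1 := h a (Finset.mem_insert_self _ _)
    rw [Finset.prod_insert ha, Finset.sum_insert ha, Finset.prod_insert ha]
    exact ⟨Polynomial.natDegree_mul_le_of_le h1 ih'.1, by
      rw [Polynomial.coeff_mul_add_eq_of_natDegree_le h1 ih'.1, ih'.2]⟩

lemma natDegree_coeff_aeval {n d e : ℕ} {g : MvPolynomial (Fin n) ℂ} (hg : g.IsHomogeneous d)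
    {γ : Fin n → Polynomial ℂ} (hγ : ∀ k, (γ k).natDegree ≤ e) :
    (aeval γ g).natDegree ≤ d * e ∧
      (aeval γ g).coeff (d * e) = eval (fun k => (γ k).coeff e) g := by
  have key : ∀ m ∈ g.support, (∏ i, γ i ^ m i).natDegree ≤ d * e ∧
      (∏ i, γ i ^ m i).coeff (d * e) = ∏ i, (γ i).coeff e ^ m i := by
    intro m hm
    have := hg (mem_support_iff.1 hm)
    rw [Finsupp.weight_apply, Finsupp.sum_fintype _ _ (by simp)] at this
    have hd : d * e = ∑ i, m i * e := by rw [← Finset.sum_mul, ← this]; simp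
    have h2 := prod_natDegree_coeff Finset.univ (fun i => γ i ^ m i) (fun i => m i * e)
      fun i _ => Polynomial.natDegree_pow_le_of_le _ (hγ i)
    rw [hd]
    refine ⟨h2.1, h2.2.trans (Finset.prod_congr rfl fun i _ => ?_)⟩
    exact Polynomial.coeff_pow_of_natDegree_le (hγ i)
  rw [aeval_def, eval₂_eq', eval_eq']
  constructor
  · refine Polynomial.natDegree_sum_le_of_forall_le _ _ fun m hm => ?_
    exact (Polynomial.natDegree_C_mul_le _ _).trans (key m hm).1
  · rw [Polynomial.finsetSum_coeff]
    refine Finset.sum_congr rfl fun m hm => ?_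
    rw [← (key m hm).2]
    exact Polynomial.coeff_C_mul _

/-- Symmetry of mixed directional derivatives. -/
lemma pderiv_comm' {n : ℕ} (i j : Fin n) (g : MvPolynomial (Fin n) ℂ) :
    pderiv i (pderiv j g) = pderiv j (pderiv i g) := by
  classical
  have : ⁅(pderiv i : Derivation ℂ (MvPolynomial (Fin n) ℂ) (MvPolynomial (Fin n) ℂ)),
      (pderiv j : Derivation ℂ (MvPolynomial (Fin n) ℂ) (MvPolynomial (Fin n) ℂ))⁆ = 0 := by
    apply MvPolynomial.derivation_ext
    intro k
    simp [Derivation.commutator_apply, pderiv_X, Pi.single_apply, apply_ite]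
  have h := congrArg (fun D => D g) this
  simpa [Derivation.commutator_apply, sub_eq_zero] using h

lemma dirDeriv_comm {n : ℕ} (v w : Fin n → ℂ) (g : MvPolynomial (Fin n) ℂ) :
    dirDeriv v (dirDeriv w g) = dirDeriv w (dirDeriv v g) := by
  simp only [dirDeriv_apply, map_sum, Derivation.map_smul, Finset.smul_sum]
  rw [Finset.sum_comm]
  refine Finset.sum_congr rfl fun i _ => Finset.sum_congr rfl fun j _ => ?_
  rw [smul_comm, pderiv_comm']

lemma MvPolynomial.IsHomogeneous.dirDeriv {n d : ℕ} {g : MvPolynomial (Fin n) ℂ} (hg : g.IsHomogeneous d)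
    (v : Fin n → ℂ) : (dirDeriv v g).IsHomogeneous (d - 1) := by
  rw [dirDeriv_apply]
  refine IsHomogeneous.sum _ _ _ fun i _ => ?_
  rw [smul_eq_C_mul]
  exact (hg.pderiv).C_mul _

lemma euler_eval {n d : ℕ} {g : MvPolynomial (Fin n) ℂ} (hg : g.IsHomogeneous d)
    (x : Fin n → ℂ) : eval x (dirDeriv x g) = d * eval x g := by
  have := congrArg (eval x) hg.sum_X_mul_pderiv
  simpa [eval_dirDeriv] using this

lemma dirDeriv_add {n : ℕ} (v w : Fin n → ℂ) (g : MvPolynomial (Fin n) ℂ) :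
    dirDeriv (v + w) g = dirDeriv v g + dirDeriv w g := by
  simp [dirDeriv_apply, add_smul, Finset.sum_add_distrib]

lemma dirDeriv_smul {n : ℕ} (c : ℂ) (v : Fin n → ℂ) (g : MvPolynomial (Fin n) ℂ) :
    dirDeriv (c • v) g = c • dirDeriv v g := by
  simp [dirDeriv_apply, mul_smul, Finset.smul_sum]

/-- The parametrised line `t ↦ x + t y`. -/
def lineCurve {n : ℕ} (x y : Fin n → ℂ) : Fin n → Polynomial ℂ :=
  fun k => Polynomial.C (x k) + Polynomial.C (y k) * Polynomial.X

lemma eval_lineCurve {n : ℕ} (x y : Fin n → ℂ) (t : ℂ) :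
    (fun k => (lineCurve x y k).eval t) = x + t • y := by
  ext k; simp [lineCurve, mul_comm t]

lemma derivative_aeval_lineCurve {n : ℕ} (x y : Fin n → ℂ) (g : MvPolynomial (Fin n) ℂ) :
    Polynomial.derivative (aeval (lineCurve x y) g) = aeval (lineCurve x y) (dirDeriv y g) := by
  rw [derivative_aeval, dirDeriv_apply, map_sum]
  refine Finset.sum_congr rfl fun k _ => ?_
  rw [map_smul, Polynomial.smul_eq_C_mul, mul_comm]
  simp [lineCurve]

lemma MultAtLeast.dvd_line {n : ℕ} {g : MvPolynomial (Fin n) ℂ} {x : Fin n → ℂ} {m : ℕ}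
    (h : MultAtLeast g x m) (y : Fin n → ℂ) : Polynomial.X ^ m ∣ aeval (lineCurve x y) g := by
  have h2 : MultAtLeast g (fun k => (lineCurve x y k).eval 0) m := by
    rw [eval_lineCurve]; simpa using h
  simpa using h2.dvd_aeval

lemma isHomogeneous_pderivList {n d : ℕ} {g : MvPolynomial (Fin n) ℂ} (hg : g.IsHomogeneous d)
    (l : List (Fin n)) : (pderivList l g).IsHomogeneous (d - l.length) := by
  induction l generalizing g d with
  | nil => exact hg
  | cons a l ih =>
    have := ih (hg.pderiv (i := a))
    rw [Nat.sub_sub, add_comm] at this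
    exact this

lemma MultAtLeast.smul {n d m : ℕ} {g : MvPolynomial (Fin n) ℂ} (hg : g.IsHomogeneous d)
    {x : Fin n → ℂ} (h : MultAtLeast g x m) (c : ℂ) : MultAtLeast g (c • x) m := by
  intro l hl
  rw [eval_smul_of_isHomogeneous (isHomogeneous_pderivList hg l), h l hl, mul_zero]

/-- The transversality condition at a triple point: the cubic tangent cone is nonsingular. -/
def ConeSmooth (f : MvPolynomial (Fin 4) ℂ) (x : Fin 4 → ℂ) : Prop :=
  ∀ y : Fin 4 → ℂ, (∀ c : ℂ, y ≠ c • x) →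
    ∃ w, eval x (dirDeriv y (dirDeriv y (dirDeriv w f))) ≠ 0

lemma aeval_C_mul_X_of_isHomogeneous {n d : ℕ} {G : MvPolynomial (Fin n) ℂ}
    (hG : G.IsHomogeneous d) (y : Fin n → ℂ) :
    aeval (fun i => Polynomial.C (y i) * Polynomial.X) G =
      Polynomial.X ^ d * Polynomial.C (eval y G) := by
  rw [aeval_def, eval₂_eq', eval_eq', map_sum, Finset.mul_sum]
  refine Finset.sum_congr rfl fun m hm => ?_
  have := hG (mem_support_iff.1 hm)
  rw [Finsupp.weight_apply, Finsupp.sum_fintype _ _ (by simp)] at this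
  simp only [mul_pow, Finset.prod_mul_distrib, Finset.prod_pow_eq_pow_sum]
  rw [show ∑ i, m i = d by simpa using this]
  simp only [map_mul, map_prod, map_pow, Polynomial.algebraMap_eq]
  ring

lemma aeval_line_cone {k d : ℕ} {G : MvPolynomial (Fin 3) ℂ} (hG : G.IsHomogeneous d)
    (y : Fin 4 → ℂ) :
    aeval (lineCurve ![0, 0, 0, 1] y)
      ((X 3 : MvPolynomial (Fin 4) ℂ) ^ k * rename Fin.castSucc G) =
      (1 + Polynomial.C (y 3) * Polynomial.X) ^ k *
        (Polynomial.X ^ d * Polynomial.C (eval (fun i => y (Fin.castSucc i)) G)) := by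
  have e1 : lineCurve ![0, 0, 0, 1] y 3 = 1 + Polynomial.C (y 3) * Polynomial.X := by
    simp [lineCurve]
  have e2 : lineCurve ![0, 0, 0, 1] y ∘ Fin.castSucc =
      fun i : Fin 3 => Polynomial.C (y (Fin.castSucc i)) * Polynomial.X := by
    ext1 i
    fin_cases i <;> simp [lineCurve]
  rw [← aeval_C_mul_X_of_isHomogeneous hG, map_mul, map_pow, aeval_X, aeval_rename, e1, e2]

lemma aeval_substMatrix {n : ℕ} (B : Matrix (Fin n) (Fin n) ℂ) (g : MvPolynomial (Fin n) ℂ)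
    (x y : Fin n → ℂ) :
    aeval (lineCurve x y) (substMatrix B g) =
      aeval (lineCurve (B.mulVec x) (B.mulVec y)) g := by
  rw [substMatrix, comp_aeval_apply]
  congr 1
  ext1 i
  simp only [map_sum, map_mul, aeval_X, algHom_C, lineCurve, Matrix.mulVec, dotProduct,
    Polynomial.algebraMap_eq, mul_add, Finset.sum_add_distrib, Finset.sum_mul, mul_assoc]

lemma pderiv_substMatrix {n : ℕ} (B : Matrix (Fin n) (Fin n) ℂ) (g : MvPolynomial (Fin n) ℂ)
    (c : Fin n) :
    pderiv c (substMatrix B g) = substMatrix B (dirDeriv (fun i => B i c) g) := by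
  rw [substMatrix, derivation_aeval, substMatrix, dirDeriv_apply, map_sum]
  refine Finset.sum_congr rfl fun k _ => ?_
  have : pderiv c (∑ j, C (B k j) * X j : MvPolynomial (Fin n) ℂ) = C (B k c) := by
    rw [map_sum, Finset.sum_eq_single c]
    · simp
    · intro b _ hb; simp [pderiv_X_of_ne hb]
    · simp
  rw [this, map_smul, smul_eq_C_mul, mul_comm]

lemma OrdinaryTriplePointAt.coneSmooth {f : MvPolynomial (Fin 4) ℂ} {p : Fin 4 → ℂ}
    (h : OrdinaryTriplePointAt 6 f p) : ConeSmooth f p := by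
  obtain ⟨hm, -, B, hB, hBp, g, hg, hF, hns⟩ := h
  have low : ∀ j, j < 3 → g j = 0 := by
    intro j hj
    refine (hg j).funext (isHomogeneous_zero _ _ _) fun z => ?_
    have h1 := hm.dvd_line (B.mulVec ![z 0, z 1, z 2, 0])
    rw [← hBp, ← aeval_substMatrix, hF, map_sum] at h1
    simp only [aeval_line_cone (hg _)] at h1
    have h2 := Polynomial.X_pow_dvd_iff.1 h1 j hj
    have h3 : (fun i : Fin 3 => (![z 0, z 1, z 2, 0] : Fin 4 → ℂ) (Fin.castSucc i)) = z := by
      ext i; fin_cases i <;> rfl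
    rw [h3] at h2
    simp only [Matrix.cons_val, map_zero, zero_mul, add_zero, one_pow, one_mul,
      Polynomial.finsetSum_coeff, Polynomial.coeff_mul_C, Polynomial.coeff_X_pow, ite_mul] at h2
    rw [Finset.sum_eq_single j] at h2
    · simpa using h2
    · intro b _ hb; simp [hb.symm]
    · intro h; exact absurd (Finset.mem_range.2 (by omega)) h
  intro y hy
  set z : Fin 4 → ℂ := B⁻¹.mulVec y with hz
  have hBz : B.mulVec z = y := by
    rw [hz, Matrix.mulVec_mulVec, Matrix.mul_nonsing_inv _ hB, Matrix.one_mulVec]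
  have hz0 : (fun i : Fin 3 => z (Fin.castSucc i)) ≠ 0 := by
    intro h0
    apply hy (z 3)
    rw [← hBz, ← hBp, ← Matrix.mulVec_smul]
    congr 1
    ext i
    have := fun i => congrFun h0 i
    fin_cases i
    · simpa using this 0
    · simpa using this 1
    · simpa using this 2
    · simp
  obtain ⟨c, hc⟩ := hns _ hz0
  refine ⟨fun i => B i (Fin.castSucc c), ?_⟩
  set w : Fin 4 → ℂ := fun i => B i (Fin.castSucc c)
  have key : aeval (lineCurve p y) (dirDeriv w f) = Polynomial.X ^ 2 *
      ((1 + Polynomial.C (z 3) * Polynomial.X) ^ 3 *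
          Polynomial.C (eval (fun i => z (Fin.castSucc i)) (pderiv c (g 3)))
        + Polynomial.X * ∑ j ∈ Finset.range 3, (1 + Polynomial.C (z 3) * Polynomial.X) ^ (2 - j) *
          (Polynomial.X ^ j * Polynomial.C
            (eval (fun i => z (Fin.castSucc i)) (pderiv c (g (j + 4)))))) := by
    rw [← hBp, ← hBz, ← aeval_substMatrix, ← pderiv_substMatrix, hF]
    have e : ∀ j, pderiv (Fin.castSucc c) ((X 3 : MvPolynomial (Fin 4) ℂ) ^ (6 - j) *
        rename Fin.castSucc (g j)) = (X 3 : MvPolynomial (Fin 4) ℂ) ^ (6 - j) *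
        rename Fin.castSucc (pderiv c (g j)) := by
      intro j
      rw [pderiv_mul, pderiv_rename (Fin.castSucc_injective _), pderiv_pow, pderiv_X_of_ne]
      · simp
      · intro h; exact (Fin.castSucc_lt_last c).ne h.symm
    rw [map_sum, map_sum]
    simp only [e, aeval_line_cone ((hg _).pderiv)]
    simp only [Finset.sum_range_succ, Finset.sum_range_zero, low 0 (by norm_num),
      low 1 (by norm_num), low 2 (by norm_num), map_zero]
    ring
  have h2 := congrArg (fun q => (Polynomial.derivative (Polynomial.derivative q)).eval 0) key
  simp only [derivative_aeval_lineCurve, eval_aeval_curve, eval_lineCurve] at h2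
  rw [zero_smul, add_zero] at h2
  rw [h2]
  simpa [Polynomial.derivative_mul] using hc

/-- A sextic form whose singular points are represented by the ten vectors `p i`, all of which
are triple points with nonsingular tangent cone. -/
structure TenPoints (f : MvPolynomial (Fin 4) ℂ) (p : Fin 10 → Fin 4 → ℂ) : Prop where
  hom : f.IsHomogeneous 6
  ne_zero : ∀ i, p i ≠ 0
  ne_smul : ∀ i j, i ≠ j → ∀ c : ℂ, p i ≠ c • p j
  mult : ∀ i, MultAtLeast f (p i) 3
  cone : ∀ i, ConeSmooth f (p i)
  sing : ∀ x, x ≠ 0 → (∀ v, eval x (dirDeriv v f) = 0) → ∃ i, ∃ c : ℂ, x = c • p i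

lemma dirDeriv_single {n : ℕ} (i : Fin n) (g : MvPolynomial (Fin n) ℂ) :
    dirDeriv (Pi.single i 1) g = pderiv i g := by
  classical
  rw [dirDeriv_apply, Finset.sum_eq_single i]
  · simp
  · intro b _ hb; simp [hb]
  · simp

lemma singularAt_of_dirDeriv {f : MvPolynomial (Fin 4) ℂ} {d : ℕ} (hd : d ≠ 0)
    (hf : f.IsHomogeneous d) {x : Fin 4 → ℂ}
    (h : ∀ v, eval x (dirDeriv v f) = 0) : SingularAt f x := by
  rw [SingularAt, multAtLeast_succ]
  refine ⟨?_, fun i => ?_⟩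
  · have := euler_eval hf x
    rw [h x] at this
    simpa [hd] using this.symm
  · rw [multAtLeast_one, ← dirDeriv_single, h]

lemma exists_tenPoints {f : MvPolynomial (Fin 4) ℂ} (hhom : f.IsHomogeneous 6)
    (hX : OnlyTriplePoints 6 10 f) :
    ∃ p : Fin 10 → Fin 4 → ℂ, TenPoints f p ∧ ∀ i, ∃ P ∈ SingSet f, P.rep = p i := by
  obtain ⟨hfin, hcard, htri⟩ := hX
  have := hfin.to_subtype
  have e : SingSet f ≃ Fin 10 := Nat.equivFinOfCardPos (by rw [Nat.card_coe_set_eq, hcard]; norm_num)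
    |>.trans (finCongr (by rw [Nat.card_coe_set_eq, hcard]))
  refine ⟨fun i => (e.symm i).1.rep, ⟨hhom, fun i => Projectivization.rep_nonzero _, ?_,
    fun i => (htri _ (e.symm i).2).1, fun i => OrdinaryTriplePointAt.coneSmooth (htri _ (e.symm i).2), ?_⟩,
    fun i => ⟨_, (e.symm i).2, rfl⟩⟩
  · intro i j hij c hc
    apply hij
    apply e.symm.injective
    apply Subtype.ext
    have hc0 : c ≠ 0 := by
      rintro rfl
      exact Projectivization.rep_nonzero (e.symm i).1 (by simpa using hc)
    rw [← Projectivization.mk_rep (e.symm i).1, ← Projectivization.mk_rep (e.symm j).1,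
      Projectivization.mk_eq_mk_iff']
    exact ⟨c, hc.symm⟩
  · intro x hx hs
    obtain ⟨a, ha⟩ := Projectivization.exists_smul_eq_mk_rep ℂ x hx
    have hP : Projectivization.mk ℂ x hx ∈ SingSet f := by
      change SingularAt f _
      rw [← ha]
      exact (singularAt_of_dirDeriv (by norm_num) hhom hs).smul hhom _
    refine ⟨e ⟨_, hP⟩, ((a⁻¹ : ℂˣ) : ℂ), ?_⟩
    simp only [Equiv.symm_apply_apply]
    rw [← ha]
    simp [Units.smul_def, smul_smul]

namespace TenPoints
variable {f : MvPolynomial (Fin 4) ℂ} {p : Fin 10 → Fin 4 → ℂ}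

lemma multAt (h : TenPoints f p) {x : Fin 4 → ℂ} (hx : x ≠ 0)
    (hs : ∀ v, eval x (dirDeriv v f) = 0) : MultAtLeast f x 3 := by
  obtain ⟨i, c, rfl⟩ := h.sing x hx hs
  exact (h.mult i).smul h.hom c

lemma coneAt (h : TenPoints f p) {x : Fin 4 → ℂ} (hx : x ≠ 0)
    (hs : ∀ v, eval x (dirDeriv v f) = 0) : ConeSmooth f x := by
  obtain ⟨i, c, rfl⟩ := h.sing x hx hs
  have hc : c ≠ 0 := by rintro rfl; simp at hx
  intro y hy
  obtain ⟨w, hw⟩ := h.cone i y fun e he => hy (e * c⁻¹) (by rw [smul_smul]; simp [hc, he])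
  refine ⟨w, ?_⟩
  rw [eval_smul_of_isHomogeneous (IsHomogeneous.dirDeriv (IsHomogeneous.dirDeriv
    (IsHomogeneous.dirDeriv h.hom w) y) y)]
  exact mul_ne_zero (pow_ne_zero _ hc) hw

lemma sing_point (h : TenPoints f p) (i : Fin 10) (v : Fin 4 → ℂ) :
    eval (p i) (dirDeriv v f) = 0 :=
  multAtLeast_one.1 (((h.mult i).mono (show 2 ≤ 3 by norm_num)).dirDeriv v)

end TenPoints

/-- The value of a parametrised curve at a parameter. -/
def curveAt {n : ℕ} (γ : Fin n → Polynomial ℂ) (s : ℂ) : Fin n → ℂ := fun k => (γ k).eval s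

/-- The vector of coefficients of degree `e` of a parametrised curve. -/
def curveTop {n : ℕ} (γ : Fin n → Polynomial ℂ) (e : ℕ) : Fin n → ℂ := fun k => (γ k).coeff e

/-- The velocity of a parametrised curve at a parameter. -/
def curveVel {n : ℕ} (γ : Fin n → Polynomial ℂ) (s : ℂ) : Fin n → ℂ :=
  fun k => (Polynomial.derivative (γ k)).eval s

lemma eval_aeval_curveAt {n : ℕ} (γ : Fin n → Polynomial ℂ) (s : ℂ) (g : MvPolynomial (Fin n) ℂ) :
    (aeval γ g).eval s = eval (curveAt γ s) g := eval_aeval_curve γ s g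

lemma aeval_curve_eq_zero_of_mult {n d e m : ℕ} {g : MvPolynomial (Fin n) ℂ}
    (hg : g.IsHomogeneous d) {γ : Fin n → Polynomial ℂ} (hγ : ∀ k, (γ k).natDegree ≤ e)
    (S : Finset ℂ) (hS : ∀ s ∈ S, MultAtLeast g (curveAt γ s) m) (hlt : d * e < m * S.card) :
    aeval γ g = 0 := by
  by_contra h0
  have hdvd : ∏ s ∈ S, (Polynomial.X - Polynomial.C s) ^ m ∣ aeval γ g := by
    refine Finset.prod_dvd_of_coprime ?_ fun s hs => MultAtLeast.dvd_aeval (hS s hs)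
    intro s _ t _ hst
    exact IsCoprime.pow (Polynomial.isCoprime_X_sub_C_of_isUnit_sub
      (isUnit_iff_ne_zero.2 (sub_ne_zero.2 hst)))
  have h1 := Polynomial.natDegree_le_of_dvd hdvd h0
  rw [Finset.prod_pow, Polynomial.natDegree_pow, Polynomial.natDegree_finsetProd_X_sub_C_eq_card]
    at h1
  have h2 := (natDegree_coeff_aeval hg hγ).1
  omega

lemma derivative_derivative_aeval {n : ℕ} (γ : Fin n → Polynomial ℂ)
    (g : MvPolynomial (Fin n) ℂ) (s : ℂ) :
    (Polynomial.derivative (Polynomial.derivative (aeval γ g))).eval s =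
      eval (curveAt γ s) (dirDeriv (curveVel γ s) (dirDeriv (curveVel γ s) g)) +
      eval (curveAt γ s) (dirDeriv (curveVel (fun k => Polynomial.derivative (γ k)) s) g) := by
  rw [derivative_aeval, map_sum, Polynomial.eval_finsetSum]
  simp only [Polynomial.derivative_mul, Polynomial.eval_add, Polynomial.eval_mul,
    Finset.sum_add_distrib]
  congr 1
  · rw [dirDeriv_comm, eval_dirDeriv]
    simp only [derivative_aeval, Polynomial.eval_finsetSum, Polynomial.eval_mul,
      eval_aeval_curveAt, Finset.sum_mul]
    rw [Finset.sum_comm]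
    simp only [dirDeriv_apply, map_sum, Derivation.map_smul, smul_eval, Finset.mul_sum]
    refine Finset.sum_congr rfl fun i _ => Finset.sum_congr rfl fun j _ => ?_
    rw [pderiv_comm']
    simp only [curveVel]
    ring
  · rw [eval_dirDeriv]
    refine Finset.sum_congr rfl fun i _ => ?_
    rw [eval_aeval_curveAt, mul_comm]
    rfl

/-- Decomposition of a gradient along a hyperplane `a = 0` and a transversal vector `w`. -/
lemma dirDeriv_decomp {n : ℕ} (a v w : Fin n → ℂ) (hw : a ⬝ᵥ w ≠ 0) (g : MvPolynomial (Fin n) ℂ) :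
    ∃ u, a ⬝ᵥ u = 0 ∧ dirDeriv v g = dirDeriv u g + ((a ⬝ᵥ v) / (a ⬝ᵥ w)) • dirDeriv w g := by
  refine ⟨v - ((a ⬝ᵥ v) / (a ⬝ᵥ w)) • w, ?_, ?_⟩
  · rw [dotProduct_sub, dotProduct_smul, smul_eq_mul, div_mul_cancel₀ _ hw, sub_self]
  · rw [← dirDeriv_smul, ← dirDeriv_add, sub_add_cancel]

lemma exists_dotProduct_ne_zero {n : ℕ} {a : Fin n → ℂ} (ha : a ≠ 0) : ∃ w, a ⬝ᵥ w ≠ 0 := by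
  by_contra! h
  exact ha (dotProduct_eq_zero a h)

namespace TenPoints
variable {f : MvPolynomial (Fin 4) ℂ} {p : Fin 10 → Fin 4 → ℂ}

/-- If the tangent plane of the surface is constant along a rational curve of degree `e`,
then the curve carries exactly `5e/2` singular points. -/
lemma card_sing_of_const_tangent (h : TenPoints f p) {a : Fin 4 → ℂ} (ha : a ≠ 0) {e : ℕ}
    {γ : Fin 4 → Polynomial ℂ} (hγ : ∀ k, (γ k).natDegree ≤ e) (h0 : ∀ s, curveAt γ s ≠ 0)
    (himm : ∀ s, ∀ c : ℂ, curveVel γ s ≠ c • curveAt γ s)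
    (htop : ¬ ∀ v, eval (curveTop γ e) (dirDeriv v f) = 0)
    (hker : ∀ v, a ⬝ᵥ v = 0 → aeval γ (dirDeriv v f) = 0) :
    ∃ S : Finset ℂ, 2 * S.card = 5 * e ∧ ∀ s ∈ S, ∀ v, eval (curveAt γ s) (dirDeriv v f) = 0 := by
  obtain ⟨w, hw⟩ := exists_dotProduct_ne_zero ha
  set ψ := aeval γ (dirDeriv w f) with hψ
  have hall : ∀ v, aeval γ (dirDeriv v f) = ((a ⬝ᵥ v) / (a ⬝ᵥ w)) • ψ := by
    intro v
    obtain ⟨u, hu, huv⟩ := dirDeriv_decomp a v w hw f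
    rw [huv, map_add, hker u hu, zero_add, map_smul]
  have hd := fun v => natDegree_coeff_aeval (h.hom.dirDeriv v) hγ
  have hcoef : ψ.coeff (5 * e) ≠ 0 := by
    intro hc
    apply htop
    intro v
    have := (hd v).2
    rw [hall v] at this
    change eval (fun k => (γ k).coeff e) _ = 0
    rw [← this, Polynomial.coeff_smul, hc, smul_zero]
  have hψ0 : ψ ≠ 0 := by rintro h1; simp [h1] at hcoef
  have hdeg : ψ.natDegree = 5 * e :=
    le_antisymm (hd w).1 (Polynomial.le_natDegree_of_ne_zero hcoef)
  have hsing : ∀ s ∈ ψ.roots.toFinset, ∀ v, eval (curveAt γ s) (dirDeriv v f) = 0 := by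
    intro s hs v
    rw [Multiset.mem_toFinset, Polynomial.mem_roots hψ0] at hs
    rw [← eval_aeval_curveAt, hall, Polynomial.eval_smul, hs, smul_zero]
  have hmul : ∀ s ∈ ψ.roots.toFinset, ψ.roots.count s = 2 := by
    intro s hs
    have hm := h.multAt (h0 s) (hsing s hs)
    rw [Polynomial.count_roots]
    apply le_antisymm
    · by_contra! hlt
      obtain ⟨u, hu⟩ := h.coneAt (h0 s) (hsing s hs) _ (himm s)
      have h2 := derivative_derivative_aeval γ (dirDeriv u f) s
      rw [show eval (curveAt γ s) (dirDeriv (curveVel (fun k => Polynomial.derivative (γ k)) s)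
        (dirDeriv u f)) = 0 from multAtLeast_one.1 ((hm.dirDeriv u).dirDeriv _), add_zero] at h2
      apply hu
      rw [← h2, hall u]
      obtain ⟨r, hr⟩ := (Polynomial.le_rootMultiplicity_iff hψ0).1 hlt
      rw [hr]
      simp [Polynomial.derivative_mul, Polynomial.derivative_X_sub_C_pow]
    · rw [Polynomial.le_rootMultiplicity_iff hψ0]
      exact MultAtLeast.dvd_aeval (hm.dirDeriv w)
  refine ⟨ψ.roots.toFinset, ?_, hsing⟩
  have h1 := (IsAlgClosed.splits ψ).natDegree_eq_card_roots
  rw [← Multiset.toFinset_sum_count_eq, Finset.sum_congr rfl hmul, Finset.sum_const, hdeg] at h1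
  rw [h1, smul_eq_mul, mul_comm]

lemma finite_sing_params (h : TenPoints f p) {ι : Type*} (φ : ι → Fin 4 → ℂ) (h0 : ∀ i, φ i ≠ 0)
    (hinj : ∀ i j, ∀ c : ℂ, φ i = c • φ j → i = j) :
    {i | ∀ v, eval (φ i) (dirDeriv v f) = 0}.Finite := by
  have hch : ∀ i : {i | ∀ v, eval (φ i) (dirDeriv v f) = 0}, ∃ k, ∃ c : ℂ, φ i = c • p k :=
    fun i => h.sing _ (h0 i) i.2
  choose k c hk using hch
  have : Function.Injective k := by
    intro i j hij
    have hcj : c j ≠ 0 := by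
      intro hc
      apply h0 j
      rw [hk j, hc, zero_smul]
    apply Subtype.ext
    apply hinj _ _ (c i * (c j)⁻¹)
    rw [hk j, hk i, hij, smul_smul, mul_assoc, inv_mul_cancel₀ hcj, mul_one]
  have := Finite.of_injective k this
  exact Set.toFinite _

lemma line_ne (h : TenPoints f p) {D E : Fin 4 → ℂ} (hDE : LinearIndependent ℂ ![D, E]) :
    ∃ s : ℂ, ¬ ∀ v, eval (D + s • E) (dirDeriv v f) = 0 := by
  rw [LinearIndependent.pair_iff] at hDE
  by_contra! hall
  have := h.finite_sing_params (fun s : ℂ => D + s • E) (fun s hs => by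
      have := hDE 1 s (by simpa using hs)
      simp at this)
    (fun i j c hc => by
      have h1 := hDE (1 - c) (i - c * j) (by
        have : D + i • E = c • (D + j • E) := hc
        rw [← sub_eq_zero] at this
        rw [← this]; module)
      have : c = 1 := by linear_combination -h1.1
      have h2 := h1.2
      rw [this] at h2
      linear_combination h2)
  exact Set.infinite_univ (this.subset fun s _ => hall s)

/-- The tangent plane cannot be constant along a line. -/
lemma false_of_line (h : TenPoints f p) {a D E : Fin 4 → ℂ} (ha : a ≠ 0)
    (hDE : LinearIndependent ℂ ![D, E])
    (hker : ∀ v, a ⬝ᵥ v = 0 → ∀ α β : ℂ, eval (α • D + β • E) (dirDeriv v f) = 0) : False := by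
  obtain ⟨s₀, hs₀⟩ := h.line_ne hDE
  rw [LinearIndependent.pair_iff] at hDE
  have hat : ∀ s, curveAt (lineCurve E (D + s₀ • E)) s = E + s • (D + s₀ • E) :=
    fun s => eval_lineCurve _ _ _
  have hvel : ∀ s, curveVel (lineCurve E (D + s₀ • E)) s = D + s₀ • E := by
    intro s; ext k; simp [curveVel, lineCurve]
  have htop : curveTop (lineCurve E (D + s₀ • E)) 1 = D + s₀ • E := by
    ext k
    simp only [curveTop, lineCurve, Polynomial.coeff_add, Polynomial.coeff_C_mul,
      Polynomial.coeff_X_one]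
    simp
  obtain ⟨S, hS, -⟩ := h.card_sing_of_const_tangent ha (e := 1) (γ := lineCurve E (D + s₀ • E))
    (fun k => by
      rw [lineCurve, add_comm]
      exact Polynomial.natDegree_linear_le)
    (fun s hs => by
      rw [hat] at hs
      have h1 := hDE s (1 + s * s₀) (by rw [← hs]; module)
      have h2 := h1.2
      rw [h1.1] at h2
      simp at h2)
    (fun s c hc => by
      rw [hat, hvel] at hc
      have h1 := hDE (1 - c * s) (s₀ - c * (1 + s * s₀)) (by
        rw [← sub_eq_zero] at hc
        rw [← hc]; module)
      have : c = 0 := by linear_combination s₀ * h1.1 - h1.2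
      have h2 := h1.1
      rw [this] at h2
      simp at h2)
    (by rw [htop]; exact hs₀)
    (fun v hv => by
      apply Polynomial.funext
      intro s
      rw [eval_aeval_curveAt, hat, Polynomial.eval_zero]
      have := hker v hv s (1 + s * s₀)
      rw [← this]
      congr 2
      module)
  omega

/-- No three singular points are collinear. -/
lemma not_collinear (h : TenPoints f p) {i j k : Fin 10} (hij : i ≠ j) (hik : i ≠ k) (hjk : j ≠ k)
    (α β : ℂ) : p i ≠ α • p j + β • p k := by
  intro hp
  have hα : α ≠ 0 := by
    rintro rfl; exact h.ne_smul i k hik β (by simpa using hp)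
  have hβ : β ≠ 0 := by
    rintro rfl; exact h.ne_smul i j hij α (by simpa using hp)
  have hind : ∀ s t : ℂ, s • p j + t • p k = 0 → s = 0 ∧ t = 0 := by
    intro s t hst
    have ht : t = 0 := by
      by_contra ht
      apply h.ne_smul k j hjk.symm (-(t⁻¹ * s))
      have : t⁻¹ • (s • p j + t • p k) = 0 := by rw [hst, smul_zero]
      rw [smul_add, smul_smul, smul_smul, inv_mul_cancel₀ ht, one_smul] at this
      rw [neg_smul]
      exact eq_neg_of_add_eq_zero_right this
    refine ⟨?_, ht⟩
    rw [ht, zero_smul, add_zero, smul_eq_zero] at hst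
    exact hst.resolve_right (h.ne_zero j)
  set κ := -β / (2 * α) with hκ
  set E := κ • p k - p j with hE
  have hat : ∀ s, curveAt (lineCurve (p j) E) s = p j + s • E :=
    fun s => eval_lineCurve _ _ _
  have hz : ∀ w, aeval (lineCurve (p j) E) (dirDeriv w f) = 0 := by
    intro w
    refine aeval_curve_eq_zero_of_mult (m := 2) (e := 1) (h.hom.dirDeriv w) (fun k => by
      rw [lineCurve, add_comm]
      exact Polynomial.natDegree_linear_le) {0, 1, 2} ?_ ?_
    · intro s hs
      simp only [Finset.mem_insert, Finset.mem_singleton] at hs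
      refine MultAtLeast.dirDeriv ?_ w
      rw [hat]
      rcases hs with rfl | rfl | rfl
      · simpa using h.mult j
      · have : p j + (1 : ℂ) • E = κ • p k := by rw [hE]; module
        rw [this]
        exact (h.mult k).smul h.hom κ
      · have : p j + (2 : ℂ) • E = (-α⁻¹) • p i := by
          rw [hE, hp, hκ]
          match_scalars
          · field_simp; norm_num
          · field_simp
        rw [this]
        exact (h.mult i).smul h.hom _
    · have : ({0, 1, 2} : Finset ℂ).card = 3 := by
        rw [Finset.card_eq_three]
        exact ⟨0, 1, 2, by norm_num, by norm_num, by norm_num, rfl⟩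
      rw [this]; norm_num
  have hDE : LinearIndependent ℂ ![p j, E] := by
    rw [LinearIndependent.pair_iff]
    intro s t hst
    have h1 := hind (s - t) (t * κ) (by rw [← hst, hE]; module)
    have hκ0 : κ ≠ 0 := div_ne_zero (neg_ne_zero.2 hβ) (mul_ne_zero two_ne_zero hα)
    have ht : t = 0 := (mul_eq_zero.1 h1.2).resolve_right hκ0
    exact ⟨by linear_combination h1.1 + ht, ht⟩
  obtain ⟨s, hs⟩ := h.line_ne hDE
  apply hs
  intro v
  rw [← hat, ← eval_aeval_curveAt, hz, Polynomial.eval_zero]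

end TenPoints

/-- Parametrisation of the conic `αxy + βyz + γzx = 0`, with prescribed avoidance at infinity. -/
lemma exists_conic_param {α β δ : ℂ} (hα : α ≠ 0) (hβ : β ≠ 0) (hδ : δ ≠ 0)
    (F : Set (Fin 3 → ℂ)) (hF : F.Finite) (hF0 : ∀ x ∈ F, x ≠ 0) :
    ∃ γ : Fin 3 → Polynomial ℂ, (∀ k, (γ k).natDegree ≤ 2) ∧ (∀ s, curveAt γ s ≠ 0) ∧
      (∀ s t, ∀ c : ℂ, curveAt γ s = c • curveAt γ t → s = t) ∧
      (∀ s, ∀ c : ℂ, curveVel γ s ≠ c • curveAt γ s) ∧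
      curveTop γ 2 ≠ 0 ∧ (∀ x ∈ F, ∀ c : ℂ, x ≠ c • curveTop γ 2) ∧
      (∀ s, α * (curveAt γ s 0 * curveAt γ s 1) + β * (curveAt γ s 1 * curveAt γ s 2) +
        δ * (curveAt γ s 2 * curveAt γ s 0) = 0) ∧
      ∀ x : Fin 3 → ℂ, x ≠ 0 → α * (x 0 * x 1) + β * (x 1 * x 2) + δ * (x 2 * x 0) = 0 →
        (∃ s, ∃ c : ℂ, x = c • curveAt γ s) ∨ ∃ c : ℂ, x = c • curveTop γ 2 := by
  let φ : ℂ → ℂ → Fin 3 → ℂ := fun a b => ![-(β * (b * (a + b))), -(δ * (a * (a + b))), α * (a * b)]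
  have hver : ∀ a b a' b' c : ℂ, φ a b = c • φ a' b' →
      a ^ 2 = c * a' ^ 2 ∧ a * b = c * (a' * b') ∧ b ^ 2 = c * b' ^ 2 := by
    intro a b a' b' c hc
    have e0 := congrFun hc 0
    have e1 := congrFun hc 1
    have e2 := congrFun hc 2
    simp only [φ, Matrix.cons_val, Pi.smul_apply, smul_eq_mul] at e0 e1 e2
    have f0 : b * (a + b) = c * (b' * (a' + b')) := mul_left_cancel₀ hβ (by linear_combination -e0)
    have f1 : a * (a + b) = c * (a' * (a' + b')) := mul_left_cancel₀ hδ (by linear_combination -e1)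
    have f2 : a * b = c * (a' * b') := mul_left_cancel₀ hα (by linear_combination e2)
    exact ⟨by linear_combination f1 - f2, f2, by linear_combination f0 - f2⟩
  have hdet : ∀ a b a' b' c : ℂ, φ a b = c • φ a' b' → a * b' = a' * b := by
    intro a b a' b' c hc
    obtain ⟨h1, h2, h3⟩ := hver _ _ _ _ _ hc
    have : (a * b' - a' * b) ^ 2 = 0 := by
      linear_combination b' ^ 2 * h1 - 2 * a' * b' * h2 + a' ^ 2 * h3
    exact sub_eq_zero.1 (pow_eq_zero_iff two_ne_zero |>.1 this)
  have hbad : (⋃ x ∈ F, {κ : ℂ | ∃ c : ℂ, x = c • φ 1 κ}).Finite := by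
    refine hF.biUnion fun x hx => Set.Subsingleton.finite ?_
    rintro κ ⟨c, hc⟩ κ' ⟨c', hc'⟩
    have hc0 : c ≠ 0 := by rintro rfl; exact hF0 x hx (by simpa using hc)
    have : φ 1 κ = (c⁻¹ * c') • φ 1 κ' := by
      rw [mul_smul, ← hc', hc, smul_smul, inv_mul_cancel₀ hc0, one_smul]
    have := hdet _ _ _ _ _ this
    linear_combination -this
  obtain ⟨κ, hκ⟩ := hbad.exists_notMem
  simp only [Set.mem_iUnion, Set.mem_ofPred_eq, not_exists] at hκ
  let γ : Fin 3 → Polynomial ℂ := ![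
    Polynomial.C (-β * κ * (1 + κ)) * Polynomial.X ^ 2 + Polynomial.C (-β * (1 + 2 * κ)) *
      Polynomial.X + Polynomial.C (-β),
    Polynomial.C (-δ * (1 + κ)) * Polynomial.X ^ 2 + Polynomial.C (-δ) * Polynomial.X +
      Polynomial.C 0,
    Polynomial.C (α * κ) * Polynomial.X ^ 2 + Polynomial.C α * Polynomial.X + Polynomial.C 0]
  have hat : ∀ s, curveAt γ s = φ s (κ * s + 1) := by
    intro s
    ext k
    fin_cases k <;> simp [curveAt, γ, φ] <;> ring
  have hq : ∀ a b c : ℂ, (Polynomial.C a * Polynomial.X ^ 2 + Polynomial.C b * Polynomial.X +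
      Polynomial.C c).coeff 2 = a := by
    intro a b c
    rw [Polynomial.coeff_add, Polynomial.coeff_add, Polynomial.coeff_C_mul,
      Polynomial.coeff_C_mul, Polynomial.coeff_X, Polynomial.coeff_C]
    simp
  have hq' : ∀ a b c s : ℂ, (Polynomial.derivative (Polynomial.C a * Polynomial.X ^ 2 +
      Polynomial.C b * Polynomial.X + Polynomial.C c)).eval s = a * (2 * s) + b := by
    intro a b c s
    simp only [Polynomial.derivative_add, Polynomial.derivative_C_mul, Polynomial.derivative_X_sq,
      Polynomial.derivative_X, Polynomial.derivative_C]
    simp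
  have htop : curveTop γ 2 = φ 1 κ := by
    ext k
    fin_cases k
    · exact (hq _ _ _).trans (by simp [φ]; ring)
    · exact (hq _ _ _).trans (by simp [φ])
    · exact (hq _ _ _).trans (by simp [φ])
  have hvel : ∀ s, curveVel γ s = ![-β * κ * (1 + κ) * (2 * s) - β * (1 + 2 * κ),
      -δ * (1 + κ) * (2 * s) - δ, α * κ * (2 * s) + α] := by
    intro s
    ext k
    fin_cases k
    · exact (hq' _ _ _ _).trans (by simp; ring)
    · exact (hq' _ _ _ _).trans (by simp; ring)
    · exact (hq' _ _ _ _).trans (by simp)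
  have hne : ∀ s, curveAt γ s ≠ 0 := by
    intro s hs
    rw [hat] at hs
    obtain ⟨h1, h2, h3⟩ := hver s (κ * s + 1) 0 0 0 (by simpa using hs)
    have : s = 0 := by simpa using h1
    rw [this] at h3
    simp at h3
  refine ⟨γ, ?_, hne, ?_, ?_, ?_, ?_, ?_, ?_⟩
  · intro k
    fin_cases k <;> exact Polynomial.natDegree_quadratic_le
  · intro s t c hc
    rw [hat, hat] at hc
    have := hdet _ _ _ _ _ hc
    linear_combination this
  · intro s c hc
    rw [hat, hvel] at hc
    have e0 := congrFun hc 0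
    have e1 := congrFun hc 1
    have e2 := congrFun hc 2
    simp only [φ, Matrix.cons_val, Pi.smul_apply, smul_eq_mul] at e0 e1 e2
    have f1 : (1 + κ) * (2 * s) + 1 = c * (s * (s + (κ * s + 1))) :=
      mul_left_cancel₀ hδ (by linear_combination -e1)
    have f2 : κ * (2 * s) + 1 = c * (s * (κ * s + 1)) :=
      mul_left_cancel₀ hα (by linear_combination e2)
    have f3 : 2 * s = c * s ^ 2 := by linear_combination f1 - f2
    by_cases hs : s = 0
    · rw [hs] at f2; simp at f2
    · have f4 : c * s = 2 := mul_right_cancel₀ hs (by linear_combination -f3)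
      have : (1 : ℂ) = 0 := by linear_combination -f2 - (κ * s + 1) * f4
      exact one_ne_zero this
  · intro h0
    rw [htop] at h0
    obtain ⟨h1, -⟩ := hver 1 κ 0 0 0 (by simpa using h0)
    simp at h1
  · intro x hx c hc
    rw [htop] at hc
    exact hκ x hx c hc
  · intro s
    rw [hat]
    simp only [φ, Matrix.cons_val]
    ring
  · intro x hx hE
    have hab : ∃ a b c : ℂ, x = c • φ a b := by
      set y0 := x 0 / β with hy0
      set y1 := x 1 / δ with hy1
      set y2 := x 2 / α with hy2
      have g0 : x 0 = β * y0 := by rw [hy0]; field_simp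
      have g1 : x 1 = δ * y1 := by rw [hy1]; field_simp
      have g2 : x 2 = α * y2 := by rw [hy2]; field_simp
      have hE' : y0 * y1 + y1 * y2 + y2 * y0 = 0 := by
        rw [g0, g1, g2] at hE
        refine mul_left_cancel₀ (mul_ne_zero (mul_ne_zero hα hβ) hδ) ?_
        linear_combination hE
      by_cases hs : y0 + y1 = 0
      · have h1 : y1 = -y0 := by linear_combination hs
        have h2 : y0 = 0 := by
          rw [h1] at hE'
          have : y0 ^ 2 = 0 := by linear_combination -hE'
          simpa using this
        refine ⟨1, -1, -y2, ?_⟩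
        ext k
        fin_cases k
        · simp [φ, g0, h2]
        · simp [φ, g1, h1, h2]
        · simp [φ, g2, mul_comm]
      · refine ⟨y1, y0, -(y0 + y1)⁻¹, ?_⟩
        ext k
        fin_cases k
        · simp only [φ, g0, Pi.smul_apply, smul_eq_mul, Fin.zero_eta, Matrix.cons_val]
          field_simp
          ring
        · simp only [φ, g1, Pi.smul_apply, smul_eq_mul, Fin.mk_one, Matrix.cons_val]
          field_simp
          ring
        · simp only [φ, g2, Pi.smul_apply, smul_eq_mul, Fin.reduceFinMk, Matrix.cons_val]
          field_simp
          linear_combination hE'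
    obtain ⟨a, b, c, rfl⟩ := hab
    by_cases hb : b - κ * a = 0
    · right
      have hb' : b = κ * a := by linear_combination hb
      refine ⟨c * a ^ 2, ?_⟩
      rw [htop, hb']
      ext k
      fin_cases k <;> simp [φ] <;> ring
    · left
      refine ⟨a / (b - κ * a), c * (b - κ * a) ^ 2, ?_⟩
      have h1 : κ * (a / (b - κ * a)) + 1 = (b - κ * a)⁻¹ * b := by field_simp; ring
      have h2 : ∀ u, φ (u * a) (u * b) = u ^ 2 • φ a b := by
        intro u
        ext k
        fin_cases k <;> simp [φ] <;> ring
      rw [hat, h1, div_eq_inv_mul, h2, smul_smul, mul_assoc, ← mul_pow, mul_inv_cancel₀ hb,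
        one_pow, mul_one]

lemma mem_of_forall_zeroLocus {n : ℕ} {I : Ideal (MvPolynomial (Fin n) ℂ)} (hI : I.IsPrime)
    {G : MvPolynomial (Fin n) ℂ} (h : ∀ x, (∀ g ∈ I, eval x g = 0) → eval x G = 0) : G ∈ I := by
  rw [← hI.radical, ← vanishingIdeal_zeroLocus_eq_radical (K := ℂ)]
  exact fun x hx => h x hx

lemma Prime.dvd_of_forall_eval {n : ℕ} {g G : MvPolynomial (Fin n) ℂ} (hg : Prime g)
    (h : ∀ x, eval x g = 0 → eval x G = 0) : g ∣ G := by
  rw [← Ideal.mem_span_singleton]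
  refine mem_of_forall_zeroLocus ((Ideal.span_singleton_prime hg.ne_zero).2 hg) fun x hx => ?_
  exact h x (hx g (Ideal.mem_span_singleton_self g))

lemma homogeneousComponent_mul_left {n d e : ℕ} {E : MvPolynomial (Fin n) ℂ}
    (hE : E.IsHomogeneous e) (G : MvPolynomial (Fin n) ℂ) :
    homogeneousComponent (e + d) (E * G) = E * homogeneousComponent d G := by
  have h1 : E * G = ∑ i ∈ Finset.range (G.totalDegree + 1), E * homogeneousComponent i G := by
    rw [← Finset.mul_sum, sum_homogeneousComponent]
  rw [h1, map_sum]
  have h2 : ∀ i, homogeneousComponent (e + d) (E * homogeneousComponent i G) =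
      if i = d then E * homogeneousComponent i G else 0 := by
    intro i
    rw [homogeneousComponent_of_mem (hE.mul (homogeneousComponent_isHomogeneous i G))]
    simp only [add_right_inj, eq_comm]
  simp only [h2]
  rw [Finset.sum_ite_eq']
  split_ifs with h
  · rfl
  · rw [homogeneousComponent_eq_zero _ _ (by simpa using h), mul_zero]

/-- Homogeneous quotients of homogeneous polynomials. -/
lemma exists_homogeneous_quotient {n d e : ℕ} {E G : MvPolynomial (Fin n) ℂ}
    (hE : E.IsHomogeneous e) (hG : G.IsHomogeneous (e + d)) (h : E ∣ G) :
    ∃ G', G'.IsHomogeneous d ∧ G = E * G' := by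
  obtain ⟨G', rfl⟩ := h
  refine ⟨homogeneousComponent d G', homogeneousComponent_isHomogeneous _ _, ?_⟩
  rw [← homogeneousComponent_mul_left hE, homogeneousComponent_eq_self hG]

/-- The conic `αxy + βyz + δzx`. -/
def conic (α β δ : ℂ) : MvPolynomial (Fin 3) ℂ :=
  C α * (X 0 * X 1) + C β * (X 1 * X 2) + C δ * (X 2 * X 0)

lemma eval_conic (α β δ : ℂ) (x : Fin 3 → ℂ) :
    eval x (conic α β δ) = α * (x 0 * x 1) + β * (x 1 * x 2) + δ * (x 2 * x 0) := by
  simp [conic]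

lemma isHomogeneous_conic (α β δ : ℂ) : (conic α β δ).IsHomogeneous 2 :=
  ((((isHomogeneous_X ℂ _).mul (isHomogeneous_X ℂ _)).C_mul _).add
    (((isHomogeneous_X ℂ _).mul (isHomogeneous_X ℂ _)).C_mul _)).add
    (((isHomogeneous_X ℂ _).mul (isHomogeneous_X ℂ _)).C_mul _)

lemma prime_conic {α β δ : ℂ} (hα : α ≠ 0) (hβ : β ≠ 0) (hδ : δ ≠ 0) :
    Prime (conic α β δ) := by
  rw [← UniqueFactorizationMonoid.irreducible_iff_prime]
  have hc : conic α β δ = (C α * X 0 + C β * X 2) * X 1 + C δ * (X 2 * X 0) := by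
    rw [conic]; ring
  have hndvd : ∀ i : Fin 3, i = 0 ∨ i = 2 →
      ¬ (X i : MvPolynomial (Fin 3) ℂ) ∣ C α * X 0 + C β * X 2 := by
    rintro i hi ⟨q, hq⟩
    rcases hi with rfl | rfl
    · have := congrArg (eval ![0, 0, 1]) hq
      simp [hβ] at this
    · have := congrArg (eval ![1, 0, 0]) hq
      simp [hα] at this
  rw [hc]
  refine irreducible_mul_X_add _ _ _ ?_ ?_ ?_ ?_
  · intro h
    have := congrArg (eval ![1, 0, 0]) h
    simp [hα] at this
  · intro h
    have := vars_add_subset _ _ h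
    rw [Finset.mem_union] at this
    rcases this with h | h
    · have := vars_mul _ _ h; simp at this
    · have := vars_mul _ _ h; simp at this
  · intro h
    have := vars_mul _ _ h
    rw [Finset.mem_union] at this
    rcases this with h | h
    · simp at h
    · have := vars_mul _ _ h; simp at this
  · refine IsRelPrime.mul_right ?_ (IsRelPrime.mul_right ?_ ?_)
    · exact ((isUnit_iff_ne_zero.2 hδ).map C).isRelPrime_right
    · exact (((X_prime (i := (2 : Fin 3))).irreducible.isRelPrime_iff_not_dvd).2 (hndvd 2 (Or.inr rfl))).symm
    · exact (((X_prime (i := (0 : Fin 3))).irreducible.isRelPrime_iff_not_dvd).2 (hndvd 0 (Or.inl rfl))).symm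

/-- Bézout for a conic and a plane curve, in multiplicity form. -/
lemma conic_dvd_of_mult {α β δ : ℂ} (hα : α ≠ 0) (hβ : β ≠ 0) (hδ : δ ≠ 0)
    {ι : Type*} (T : Finset ι) (y : ι → Fin 3 → ℂ) (hy0 : ∀ i ∈ T, y i ≠ 0)
    (hy : ∀ i ∈ T, ∀ j ∈ T, i ≠ j → ∀ c : ℂ, y i ≠ c • y j)
    (hyE : ∀ i ∈ T, eval (y i) (conic α β δ) = 0)
    {G : MvPolynomial (Fin 3) ℂ} {d m : ℕ} (hG : G.IsHomogeneous d)
    (hm : ∀ i ∈ T, MultAtLeast G (y i) m) (hlt : d * 2 < m * T.card) : conic α β δ ∣ G := by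
  classical
  obtain ⟨γ, hdeg, hne, hinj, -, -, htop, -, hcov⟩ := exists_conic_param hα hβ hδ
    (y '' (T : Set ι)) (T.finite_toSet.image y) (by rintro x ⟨i, hi, rfl⟩; exact hy0 i hi)
  have hs : ∀ i : T, ∃ s : ℂ, ∃ c : ℂ, y i = c • curveAt γ s := by
    intro i
    refine (hcov (y i) (hy0 i i.2) (by rw [← eval_conic]; exact hyE i i.2)).resolve_right ?_
    rintro ⟨c, hc⟩
    exact htop _ ⟨i, i.2, rfl⟩ c hc
  choose s c hsc using hs
  have hc0 : ∀ i, c i ≠ 0 := fun i h0 => hy0 i i.2 (by rw [hsc, h0, zero_smul])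
  have hback : ∀ i, curveAt γ (s i) = (c i)⁻¹ • y i := fun i => by
    rw [hsc, smul_smul, inv_mul_cancel₀ (hc0 i), one_smul]
  have hsinj : Function.Injective s := by
    intro i j hij
    by_contra hne
    refine hy i i.2 j j.2 (fun h => hne (Subtype.ext h)) (c i * (c j)⁻¹) ?_
    rw [hsc i, hij, hback, smul_smul]
  have hz : aeval γ G = 0 := by
    refine aeval_curve_eq_zero_of_mult (m := m) hG hdeg (Finset.univ.image s) ?_ ?_
    · intro t ht
      obtain ⟨i, -, rfl⟩ := Finset.mem_image.1 ht
      rw [hback]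
      exact (hm i i.2).smul hG _
    · rw [Finset.card_image_of_injective _ hsinj]
      simpa using hlt
  refine (prime_conic hα hβ hδ).dvd_of_forall_eval fun x hx => ?_
  by_cases hx0 : x = 0
  · rw [hx0, ← zero_smul ℂ (curveAt γ 0), eval_smul_of_isHomogeneous hG, ← eval_aeval_curveAt, hz,
      Polynomial.eval_zero, mul_zero]
  rcases hcov x hx0 (by rw [← eval_conic]; exact hx) with ⟨t, e, rfl⟩ | ⟨e, rfl⟩
  · rw [eval_smul_of_isHomogeneous hG, ← eval_aeval_curveAt, hz, Polynomial.eval_zero, mul_zero]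
  · rw [eval_smul_of_isHomogeneous hG]
    have := (natDegree_coeff_aeval hG hdeg).2
    rw [hz, Polynomial.coeff_zero] at this
    change e ^ d * eval (fun k => (γ k).coeff 2) G = 0
    rw [← this, mul_zero]

lemma MultAtLeast.of_mul {n m : ℕ} (hm : m ≤ 2) {E G : MvPolynomial (Fin n) ℂ} {x : Fin n → ℂ}
    (h : MultAtLeast (E * G) x (m + 1)) (hE : eval x E = 0) {k : Fin n}
    (hk : eval x (pderiv k E) ≠ 0) : MultAtLeast G x m := by
  have h1 : 1 ≤ m → eval x G = 0 := by
    intro h1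
    have := multAtLeast_one.1 ((multAtLeast_succ.1 (h.mono (show 1 + 1 ≤ m + 1 by omega))).2 k)
    rw [pderiv_mul, map_add, map_mul, map_mul, hE, zero_mul, add_zero] at this
    exact (mul_eq_zero.1 this).resolve_left hk
  interval_cases m
  · exact multAtLeast_zero
  · exact multAtLeast_one.2 (h1 le_rfl)
  · have h0 := h1 (by norm_num)
    have hsym : ∀ i j, eval x (pderiv i E) * eval x (pderiv j G) +
        eval x (pderiv j E) * eval x (pderiv i G) = 0 := by
      intro i j
      have := multAtLeast_one.1 ((multAtLeast_succ.1 ((multAtLeast_succ.1 h).2 i)).2 j)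
      simp only [pderiv_mul, map_add, map_mul, hE, h0] at this
      linear_combination this
    have hkk : eval x (pderiv k G) = 0 := by
      have := hsym k k
      have h2 : eval x (pderiv k E) * eval x (pderiv k G) = 0 := by linear_combination this / 2
      exact (mul_eq_zero.1 h2).resolve_left hk
    rw [multAtLeast_succ]
    refine ⟨h0, fun j => multAtLeast_one.2 ?_⟩
    have := hsym k j
    rw [hkk, mul_zero, add_zero] at this
    exact (mul_eq_zero.1 this).resolve_left hk

lemma exists_pderiv_conic_ne_zero {α β δ : ℂ} (hα : α ≠ 0) (hβ : β ≠ 0) (hδ : δ ≠ 0)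
    {x : Fin 3 → ℂ} (hx : x ≠ 0) : ∃ k, eval x (pderiv k (conic α β δ)) ≠ 0 := by
  by_contra! h
  have h0 := h 0
  have h1 := h 1
  have h2 := h 2
  simp [conic, pderiv_X] at h0 h1 h2
  apply hx
  have e0 : 2 * (α * δ) * x 0 = 0 := by linear_combination -β * h0 + δ * h1 + α * h2
  have e1 : 2 * (α * β) * x 1 = 0 := by linear_combination β * h0 - δ * h1 + α * h2
  have e2 : 2 * (β * δ) * x 2 = 0 := by linear_combination β * h0 + δ * h1 - α * h2
  simp [hα, hβ, hδ] at e0 e1 e2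
  ext k
  fin_cases k
  · exact e0
  · exact e1
  · exact e2

/-- Restriction of a form to the plane spanned by `U 0, U 1, U 2`. -/
def planeMap (U : Fin 3 → Fin 4 → ℂ) : MvPolynomial (Fin 4) ℂ →ₐ[ℂ] MvPolynomial (Fin 3) ℂ :=
  aeval fun i => ∑ k, C (U k i) * X k

/-- The point of the plane spanned by `U` with coordinates `y`. -/
def planePt (U : Fin 3 → Fin 4 → ℂ) (y : Fin 3 → ℂ) : Fin 4 → ℂ := ∑ k, y k • U k

lemma eval_planeMap (U : Fin 3 → Fin 4 → ℂ) (y : Fin 3 → ℂ) (g : MvPolynomial (Fin 4) ℂ) :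
    eval y (planeMap U g) = eval (planePt U y) g := by
  have := comp_aeval_apply (fun i => ∑ k, C (U k i) * X k) (aeval y : MvPolynomial (Fin 3) ℂ →ₐ[ℂ] ℂ) g
  change aeval y (planeMap U g) = aeval (planePt U y) g
  refine this.trans ?_
  congr 2
  ext i
  simp [planePt, mul_comm]

lemma isHomogeneous_planeMap {U : Fin 3 → Fin 4 → ℂ} {g : MvPolynomial (Fin 4) ℂ} {d : ℕ}
    (hg : g.IsHomogeneous d) : (planeMap U g).IsHomogeneous d := by
  have := hg.aeval (fun i => ∑ k, C (U k i) * X k) (n := 1) fun i =>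
    IsHomogeneous.sum _ _ _ fun k _ => (isHomogeneous_X ℂ k).C_mul _
  rw [one_mul] at this
  exact this

lemma pderiv_planeMap (U : Fin 3 → Fin 4 → ℂ) (k : Fin 3) (g : MvPolynomial (Fin 4) ℂ) :
    pderiv k (planeMap U g) = planeMap U (dirDeriv (U k) g) := by
  rw [planeMap, derivation_aeval, dirDeriv_apply, map_sum]
  refine Finset.sum_congr rfl fun i _ => ?_
  have : pderiv k (∑ j, C (U j i) * X j : MvPolynomial (Fin 3) ℂ) = C (U k i) := by
    rw [map_sum, Finset.sum_eq_single k]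
    · simp
    · intro b _ hb; simp [pderiv_X_of_ne hb]
    · simp
  rw [this, map_smul, smul_eq_C_mul, mul_comm]

lemma MultAtLeast.planeMap {U : Fin 3 → Fin 4 → ℂ} {y : Fin 3 → ℂ} {m : ℕ}
    {g : MvPolynomial (Fin 4) ℂ} (h : MultAtLeast g (planePt U y) m) :
    MultAtLeast (planeMap U g) y m := by
  induction m generalizing g with
  | zero => exact multAtLeast_zero
  | succ m ih =>
    rw [multAtLeast_succ]
    refine ⟨by rw [eval_planeMap]; exact (multAtLeast_succ.1 h).1, fun k => ?_⟩
    rw [pderiv_planeMap]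
    exact ih (h.dirDeriv _)

/-- `U` is a basis of the plane `a = 0`. -/
structure IsPlaneBasis (a : Fin 4 → ℂ) (U : Fin 3 → Fin 4 → ℂ) : Prop where
  ne_zero : a ≠ 0
  indep : LinearIndependent ℂ U
  mem : ∀ v, a ⬝ᵥ v = 0 ↔ ∃ y, v = planePt U y

lemma planePt_injective {U : Fin 3 → Fin 4 → ℂ} (hU : LinearIndependent ℂ U) :
    Function.Injective (planePt U) := by
  intro y z hyz
  rw [Fintype.linearIndependent_iff] at hU
  ext k
  have := hU (fun k => y k - z k) (by
    simp only [sub_smul, Finset.sum_sub_distrib]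
    exact sub_eq_zero.2 hyz) k
  exact sub_eq_zero.1 this

lemma planePt_smul (U : Fin 3 → Fin 4 → ℂ) (c : ℂ) (y : Fin 3 → ℂ) :
    planePt U (c • y) = c • planePt U y := by
  simp [planePt, Finset.smul_sum, smul_smul]

lemma planePt_zero (U : Fin 3 → Fin 4 → ℂ) : planePt U 0 = 0 := by simp [planePt]

lemma isPlaneBasis_of_linearIndependent {a : Fin 4 → ℂ} (ha : a ≠ 0) {U : Fin 3 → Fin 4 → ℂ}
    (hU : LinearIndependent ℂ U) (haU : ∀ k, a ⬝ᵥ U k = 0) : IsPlaneBasis a U := by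
  refine ⟨ha, hU, fun v => ⟨fun hv => ?_, ?_⟩⟩
  · have hle : Submodule.span ℂ (Set.range U) ≤ LinearMap.ker (dotProductBilin ℂ ℂ a) := by
      rw [Submodule.span_le]
      rintro _ ⟨k, rfl⟩
      exact haU k
    obtain ⟨w, hw⟩ := exists_dotProduct_ne_zero ha
    have hlt : LinearMap.ker (dotProductBilin ℂ ℂ a) < ⊤ := by
      rw [lt_top_iff_ne_top]
      intro htop
      exact hw (by simpa using (htop ▸ Submodule.mem_top : w ∈ LinearMap.ker (dotProductBilin ℂ ℂ a)))
    have h1 := Submodule.finrank_lt hlt.ne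
    have h2 := finrank_span_eq_card hU
    have h3 : Module.finrank ℂ (Fin 4 → ℂ) = 4 := by simp
    have heq := Submodule.eq_of_le_of_finrank_le hle (by rw [h2, Fintype.card_fin]; omega)
    have hv' : v ∈ Submodule.span ℂ (Set.range U) := by rw [heq]; exact hv
    obtain ⟨c, hc⟩ := (Submodule.mem_span_range_iff_exists_fun ℂ).1 hv'
    exact ⟨c, hc.symm⟩
  · rintro ⟨y, rfl⟩
    simp [planePt, dotProduct_sum, dotProduct_smul, haU]

namespace TenPoints
variable {f : MvPolynomial (Fin 4) ℂ} {p : Fin 10 → Fin 4 → ℂ}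

lemma planeMap_ne_zero (h : TenPoints f p) {a : Fin 4 → ℂ} {U : Fin 3 → Fin 4 → ℂ}
    (hU : IsPlaneBasis a U) : planeMap U f ≠ 0 := by
  intro h0
  have hind : LinearIndependent ℂ ![U 0, U 1] := by
    have h1 := hU.indep.comp ![0, 1] (by decide)
    convert h1 using 1
    ext i j
    fin_cases i <;> rfl
  refine h.false_of_line hU.ne_zero hind fun v hv s t => ?_
  obtain ⟨y, rfl⟩ := (hU.mem v).1 hv
  have hp : s • U 0 + t • U 1 = planePt U ![s, t, 0] := by
    simp [planePt, Fin.sum_univ_three]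
  have hk : ∀ k, eval (planePt U ![s, t, 0]) (dirDeriv (U k) f) = 0 := by
    intro k
    rw [← eval_planeMap, ← pderiv_planeMap, h0, map_zero, map_zero]
  have hy : dirDeriv (planePt U y) f = y 0 • dirDeriv (U 0) f + y 1 • dirDeriv (U 1) f +
      y 2 • dirDeriv (U 2) f := by
    rw [planePt, Fin.sum_univ_three, dirDeriv_add, dirDeriv_add, dirDeriv_smul, dirDeriv_smul,
      dirDeriv_smul]
  rw [hp, hy]
  simp [hk, smul_eval]

/-- A plane with a conic through (at least) five singular points is tangent to the sextic along
that conic, and contains at most five singular points. -/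
lemma conic_plane (h : TenPoints f p) {a : Fin 4 → ℂ} {U : Fin 3 → Fin 4 → ℂ}
    (hU : IsPlaneBasis a U) {α β δ : ℂ} (hα : α ≠ 0) (hβ : β ≠ 0) (hδ : δ ≠ 0)
    (T : Finset (Fin 10)) (hT : 5 ≤ T.card)
    (hTU : ∀ i ∈ T, ∃ y, p i = planePt U y ∧ eval y (conic α β δ) = 0) :
    (∃ c : ℂ, c ≠ 0 ∧ planeMap U f = C c * conic α β δ ^ 3) ∧
      ∀ T' : Finset (Fin 10), (∀ i ∈ T', a ⬝ᵥ p i = 0) → T'.card ≤ 5 := by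
  have hpt : ∀ i, ∃ y, (∃ y, p i = planePt U y) → p i = planePt U y := by
    intro i
    by_cases hi : ∃ y, p i = planePt U y
    · obtain ⟨y, hy⟩ := hi
      exact ⟨y, fun _ => hy⟩
    · exact ⟨0, fun h => absurd h hi⟩
  choose y hy using hpt
  have hTy : ∀ i ∈ T, p i = planePt U (y i) ∧ eval (y i) (conic α β δ) = 0 := by
    intro i hi
    obtain ⟨z, hz, hz'⟩ := hTU i hi
    have h1 := hy i ⟨z, hz⟩
    refine ⟨h1, ?_⟩
    rw [← planePt_injective hU.indep (hz.symm.trans h1)]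
    exact hz'
  have hne0 : ∀ i, p i = planePt U (y i) → y i ≠ 0 := by
    intro i hi h0
    apply h.ne_zero i
    rw [hi, h0, planePt_zero]
  have hnes : ∀ i j, p i = planePt U (y i) → p j = planePt U (y j) → i ≠ j →
      ∀ c : ℂ, y i ≠ c • y j := by
    intro i j hi hj hij c hc
    apply h.ne_smul i j hij c
    rw [hi, hj, hc, planePt_smul]
  have hdvd : ∀ T' : Finset (Fin 10), (∀ i ∈ T', p i = planePt U (y i) ∧
      eval (y i) (conic α β δ) = 0) → ∀ {G : MvPolynomial (Fin 3) ℂ} {d m : ℕ}, G.IsHomogeneous d →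
      (∀ i ∈ T', MultAtLeast G (y i) m) → d * 2 < m * T'.card → conic α β δ ∣ G :=
    fun T' hT' G d m hG hm hlt => conic_dvd_of_mult hα hβ hδ T' y
      (fun i hi => hne0 i (hT' i hi).1)
      (fun i hi j hj hij => hnes i j (hT' i hi).1 (hT' j hj).1 hij) (fun i hi => (hT' i hi).2)
      hG hm hlt
  have hm3 : ∀ i ∈ T, MultAtLeast (planeMap U f) (y i) 3 := fun i hi => by
    apply MultAtLeast.planeMap
    rw [← (hTy i hi).1]
    exact h.mult i
  have hE := isHomogeneous_conic α β δ
  obtain ⟨G₁, hG₁, e₁⟩ := exists_homogeneous_quotient hE (d := 4)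
    (isHomogeneous_planeMap (U := U) h.hom) (hdvd T hTy (isHomogeneous_planeMap h.hom) hm3 (by omega))
  have hm2 : ∀ i ∈ T, MultAtLeast G₁ (y i) 2 := fun i hi => by
    obtain ⟨k, hk⟩ := exists_pderiv_conic_ne_zero hα hβ hδ (hne0 i (hTy i hi).1)
    exact MultAtLeast.of_mul le_rfl (e₁ ▸ hm3 i hi) (hTy i hi).2 hk
  obtain ⟨G₂, hG₂, e₂⟩ := exists_homogeneous_quotient hE (d := 2) hG₁
    (hdvd T hTy hG₁ hm2 (by omega))
  have hm1 : ∀ i ∈ T, MultAtLeast G₂ (y i) 1 := fun i hi => by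
    obtain ⟨k, hk⟩ := exists_pderiv_conic_ne_zero hα hβ hδ (hne0 i (hTy i hi).1)
    exact MultAtLeast.of_mul (by norm_num) (e₂ ▸ hm2 i hi) (hTy i hi).2 hk
  obtain ⟨G₃, hG₃, e₃⟩ := exists_homogeneous_quotient hE (d := 0) hG₂
    (hdvd T hTy hG₂ hm1 (by omega))
  have hG₃C : G₃ = C (coeff 0 G₃) :=
    (totalDegree_eq_zero_iff_eq_C).1 ((totalDegree_zero_iff_isHomogeneous (Fin 3)).2 hG₃)
  have hfin : planeMap U f = C (coeff 0 G₃) * conic α β δ ^ 3 := by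
    rw [e₁, e₂, e₃, ← hG₃C]; ring
  refine ⟨⟨coeff 0 G₃, ?_, hfin⟩, ?_⟩
  · intro hc
    apply h.planeMap_ne_zero hU
    rw [hfin, hc, C_0, zero_mul]
  · intro T' hT'
    by_contra! hcard
    have hc : coeff 0 G₃ ≠ 0 := by
      intro hc
      apply h.planeMap_ne_zero hU
      rw [hfin, hc, C_0, zero_mul]
    have hTy' : ∀ i ∈ T', p i = planePt U (y i) ∧ eval (y i) (conic α β δ) = 0 := by
      intro i hi
      have h1 := hy i ((hU.mem _).1 (hT' i hi))
      refine ⟨h1, ?_⟩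
      have h2 : eval (y i) (planeMap U f) = 0 := by
        rw [eval_planeMap, ← h1]
        exact multAtLeast_one.1 ((h.mult i).mono (by norm_num))
      rw [hfin, map_mul, eval_C, map_pow] at h2
      exact pow_eq_zero_iff (by norm_num) |>.1 ((mul_eq_zero.1 h2).resolve_left hc)
    have hw : ∀ w, conic α β δ ∣ planeMap U (dirDeriv w f) := fun w =>
      hdvd T' hTy' (isHomogeneous_planeMap (h.hom.dirDeriv w)) (m := 2) (fun i hi => by
        apply MultAtLeast.planeMap
        rw [← (hTy' i hi).1]
        exact (h.mult i).dirDeriv w) (by omega)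
    obtain ⟨γ, -, hne, hinj, -, -, -, hon, -⟩ := exists_conic_param hα hβ hδ ∅ Set.finite_empty
      (by simp)
    have := h.finite_sing_params (fun s => planePt U (curveAt γ s))
      (fun s hs => hne s (planePt_injective hU.indep (hs.trans (planePt_zero U).symm)))
      (fun s t c hst => hinj s t c (planePt_injective hU.indep (by rw [planePt_smul]; exact hst)))
    refine Set.infinite_univ (this.subset fun s _ => ?_)
    intro v
    obtain ⟨r, hr⟩ := hw v
    rw [← eval_planeMap, hr, map_mul, eval_conic, hon, zero_mul]

end TenPoints

/-- The linear form with coefficients `a`. -/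
def lin {n : ℕ} (a : Fin n → ℂ) : MvPolynomial (Fin n) ℂ := ∑ i, C (a i) * X i

lemma eval_lin {n : ℕ} (a x : Fin n → ℂ) : eval x (lin a) = a ⬝ᵥ x := by
  simp [lin, dotProduct]

lemma isHomogeneous_lin {n : ℕ} (a : Fin n → ℂ) : (lin a).IsHomogeneous 1 :=
  IsHomogeneous.sum _ _ _ fun k _ => (isHomogeneous_X ℂ k).C_mul _

lemma lin_ne_zero {n : ℕ} {a : Fin n → ℂ} (ha : a ≠ 0) : lin a ≠ 0 := by
  obtain ⟨w, hw⟩ := exists_dotProduct_ne_zero ha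
  intro h
  rw [← eval_lin, h, map_zero] at hw
  exact hw rfl

lemma not_isUnit_lin {n : ℕ} (a : Fin n → ℂ) : ¬ IsUnit (lin a) := by
  intro h
  have := h.map (eval (0 : Fin n → ℂ))
  rw [eval_lin, dotProduct_zero] at this
  exact not_isUnit_zero this

lemma isUnit_of_totalDegree_eq_zero {n : ℕ} {g : MvPolynomial (Fin n) ℂ} (hg : g ≠ 0)
    (h : g.totalDegree = 0) : IsUnit g := by
  have := totalDegree_eq_zero_iff_eq_C.1 h
  rw [this]
  refine (isUnit_iff_ne_zero.2 fun h0 => hg ?_).map C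
  rw [this, h0, C_0]

lemma irreducible_of_degree_one {n : ℕ} {g : MvPolynomial (Fin n) ℂ} (hg : g.IsHomogeneous 1)
    (h0 : g ≠ 0) : Irreducible g := by
  have hd := hg.totalDegree h0
  constructor
  · intro h
    rw [MvPolynomial.isUnit_iff_totalDegree_of_isReduced] at h
    omega
  · intro a b hab
    have ha : a ≠ 0 := by rintro rfl; simp [h0] at hab
    have hb : b ≠ 0 := by rintro rfl; simp [h0] at hab
    rw [hab, totalDegree_mul_of_isDomain ha hb] at hd
    rcases Nat.eq_zero_or_pos a.totalDegree with h | h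
    · exact Or.inl (isUnit_of_totalDegree_eq_zero ha h)
    · exact Or.inr (isUnit_of_totalDegree_eq_zero hb (by omega))

lemma prime_lin {n : ℕ} {a : Fin n → ℂ} (ha : a ≠ 0) : Prime (lin a) :=
  UniqueFactorizationMonoid.irreducible_iff_prime.1
    (irreducible_of_degree_one (isHomogeneous_lin a) (lin_ne_zero ha))

lemma lin_dvd {n : ℕ} {a : Fin n → ℂ} (ha : a ≠ 0) {G : MvPolynomial (Fin n) ℂ}
    (h : ∀ x, a ⬝ᵥ x = 0 → eval x G = 0) : lin a ∣ G :=
  (prime_lin ha).dvd_of_forall_eval fun x hx => h x (by rwa [eval_lin] at hx)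

lemma exists_eq_lin {n : ℕ} {g : MvPolynomial (Fin n) ℂ} (hg : g.IsHomogeneous 1) :
    ∃ a, g = lin a := by
  refine ⟨fun i => coeff 0 (pderiv i g), funext fun x => ?_⟩
  have h1 := euler_eval hg x
  rw [Nat.cast_one, one_mul, eval_dirDeriv] at h1
  rw [← h1, eval_lin, dotProduct]
  refine Finset.sum_congr rfl fun i _ => ?_
  have h2 : (pderiv i g).IsHomogeneous 0 := hg.pderiv
  have h3 := totalDegree_eq_zero_iff_eq_C.1 ((totalDegree_zero_iff_isHomogeneous (Fin n)).2 h2)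
  nth_rw 1 [h3]
  rw [eval_C, mul_comm]

/-- A nonzero quadratic form is either prime or a product of two linear forms. -/
lemma prime_or_eq_lin_mul_lin {n : ℕ} {q : MvPolynomial (Fin n) ℂ} (hq : q.IsHomogeneous 2)
    (h0 : q ≠ 0) : Prime q ∨ ∃ a b, q = lin a * lin b := by
  by_cases hp : Irreducible q
  · exact Or.inl (UniqueFactorizationMonoid.irreducible_iff_prime.1 hp)
  right
  have hd := hq.totalDegree h0
  rw [irreducible_iff] at hp
  push Not at hp
  obtain ⟨a, b, hab, ha, hb⟩ := hp (by
    rw [MvPolynomial.isUnit_iff_totalDegree_of_isReduced]; omega)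
  have ha0 : a ≠ 0 := by rintro rfl; simp [h0] at hab
  have hb0 : b ≠ 0 := by rintro rfl; simp [h0] at hab
  have hda : a.totalDegree ≠ 0 := fun h => ha (isUnit_of_totalDegree_eq_zero ha0 h)
  have hdb : b.totalDegree ≠ 0 := fun h => hb (isUnit_of_totalDegree_eq_zero hb0 h)
  rw [hab, totalDegree_mul_of_isDomain ha0 hb0] at hd
  have hda1 : a.totalDegree = 1 := by omega
  have hdb1 : b.totalDegree = 1 := by omega
  have ea := sum_homogeneousComponent a
  have eb := sum_homogeneousComponent b
  rw [hda1, Finset.sum_range_succ, Finset.sum_range_one] at ea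
  rw [hdb1, Finset.sum_range_succ, Finset.sum_range_one] at eb
  obtain ⟨a', ha'⟩ := exists_eq_lin (homogeneousComponent_isHomogeneous 1 a)
  obtain ⟨b', hb'⟩ := exists_eq_lin (homogeneousComponent_isHomogeneous 1 b)
  refine ⟨a', b', ?_⟩
  rw [ha'] at ea
  rw [hb'] at eb
  have hA := homogeneousComponent_isHomogeneous 0 a
  have hB := homogeneousComponent_isHomogeneous 0 b
  set A := homogeneousComponent 0 a
  set B := homogeneousComponent 0 b
  have e : q = A * B + A * lin b' + lin a' * B + lin a' * lin b' := by
    rw [hab, ← ea, ← eb]; ring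
  have h1 := homogeneousComponent_eq_self hq
  rw [e, map_add, map_add, map_add, homogeneousComponent_of_mem (hA.mul hB),
    homogeneousComponent_of_mem (hA.mul (isHomogeneous_lin b')),
    homogeneousComponent_of_mem ((isHomogeneous_lin a').mul hB),
    homogeneousComponent_of_mem ((isHomogeneous_lin a').mul (isHomogeneous_lin b'))] at h1
  simp only [Nat.reduceAdd] at h1
  norm_num at h1
  rw [e, h1, zero_add]

/-- The substitution of linear forms dual to `U`. -/
lemma exists_planeMap_section {U : Fin 3 → Fin 4 → ℂ} (hU : LinearIndependent ℂ U) :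
    ∃ σ : MvPolynomial (Fin 3) ℂ →ₐ[ℂ] MvPolynomial (Fin 4) ℂ, ∀ g, planeMap U (σ g) = g := by
  classical
  obtain ⟨φ, hφ⟩ := ((Pi.basisFun ℂ (Fin 3)).constr ℂ U).exists_leftInverse_of_injective (by
    rw [LinearMap.ker_eq_bot]
    intro y z hyz
    apply planePt_injective hU
    simpa [Module.Basis.constr_apply_fintype, planePt] using hyz)
  have hφU : ∀ j, φ (U j) = Pi.single j 1 := by
    intro j
    have := LinearMap.congr_fun hφ (Pi.single j 1)
    simpa [Module.Basis.constr_apply_fintype, Pi.single_apply] using this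
  refine ⟨aeval fun k => lin fun i => φ (Pi.single i 1) k, fun g => ?_⟩
  have : (planeMap U).comp (aeval fun k => lin fun i => φ (Pi.single i 1) k) = AlgHom.id ℂ _ := by
    ext k : 1
    refine funext fun y => ?_
    simp only [AlgHom.comp_apply, aeval_X, AlgHom.id_apply, eval_X]
    rw [eval_planeMap, eval_lin]
    have h1 : ∀ v : Fin 4 → ℂ, (fun i => φ (Pi.single i 1) k) ⬝ᵥ v = φ v k := by
      intro v
      conv_rhs => rw [pi_eq_sum_univ' v]
      simp [dotProduct, mul_comm]
    rw [h1, planePt, map_sum]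
    simp [hφU, Pi.single_apply]
  exact AlgHom.congr_fun this g

lemma lin_dvd_of_planeMap_eq_zero {a : Fin 4 → ℂ} {U : Fin 3 → Fin 4 → ℂ} (hU : IsPlaneBasis a U)
    {g : MvPolynomial (Fin 4) ℂ} (hg : planeMap U g = 0) : lin a ∣ g := by
  refine lin_dvd hU.ne_zero fun x hx => ?_
  obtain ⟨y, rfl⟩ := (hU.mem x).1 hx
  rw [← eval_planeMap, hg, map_zero]

lemma planeMap_lin {a : Fin 4 → ℂ} {U : Fin 3 → Fin 4 → ℂ} (hU : IsPlaneBasis a U) :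
    planeMap U (lin a) = 0 := by
  refine funext fun y => ?_
  rw [eval_planeMap, eval_lin, map_zero]
  exact (hU.mem _).2 ⟨y, rfl⟩

/-- A linear form is regular modulo `(Q, G)` as soon as the restrictions of `Q` and `G` to its
kernel are relatively prime. -/
lemma mem_of_lin_mul_mem {a : Fin 4 → ℂ} {U : Fin 3 → Fin 4 → ℂ} (hU : IsPlaneBasis a U)
    {Q G : MvPolynomial (Fin 4) ℂ} (hQ : planeMap U Q ≠ 0)
    (hrel : IsRelPrime (planeMap U Q) (planeMap U G)) {u : MvPolynomial (Fin 4) ℂ}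
    (hu : lin a * u ∈ Ideal.span {Q, G}) : u ∈ Ideal.span {Q, G} := by
  obtain ⟨σ, hσ⟩ := exists_planeMap_section hU.indep
  rw [Ideal.mem_span_pair] at hu ⊢
  obtain ⟨s, t, hst⟩ := hu
  have h1 := congrArg (planeMap U) hst
  rw [map_add, map_mul, map_mul, map_mul, planeMap_lin hU, zero_mul] at h1
  obtain ⟨r, hr⟩ : planeMap U Q ∣ planeMap U t := by
    refine hrel.dvd_of_dvd_mul_left (z := planeMap U t) ⟨-planeMap U s, ?_⟩
    linear_combination h1
  obtain ⟨t₁, ht₁⟩ := lin_dvd_of_planeMap_eq_zero hU (g := t - Q * σ r) (by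
    rw [map_sub, map_mul, hσ, hr, sub_self])
  have h2 : planeMap U s = -(planeMap U G * r) := by
    have : planeMap U Q * (planeMap U s + planeMap U G * r) = 0 := by
      rw [hr] at h1; linear_combination h1
    exact eq_neg_of_add_eq_zero_left ((mul_eq_zero.1 this).resolve_left hQ)
  obtain ⟨s₁, hs₁⟩ := lin_dvd_of_planeMap_eq_zero hU (g := s + G * σ r) (by
    rw [map_add, map_mul, hσ, h2]; ring)
  refine ⟨s₁, t₁, mul_left_cancel₀ (lin_ne_zero hU.ne_zero) ?_⟩
  rw [← hst]
  linear_combination -Q * hs₁ - G * ht₁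

/-- The symmetric matrix of a quadratic form. -/
lemma exists_symm_matrix {n : ℕ} {q : MvPolynomial (Fin n) ℂ} (hq : q.IsHomogeneous 2) :
    ∃ M : Matrix (Fin n) (Fin n) ℂ, M.IsSymm ∧ (∀ x, eval x q = x ⬝ᵥ M.mulVec x) ∧
      ∀ x y, eval x (dirDeriv y q) = 2 * (y ⬝ᵥ M.mulVec x) := by
  have hc : ∀ i, ∃ a, pderiv i q = lin a := fun i => exists_eq_lin hq.pderiv
  choose c hc using hc
  have hsymm : ∀ i j, c i j = c j i := by
    intro i j
    have h1 : ∀ i j, eval 0 (pderiv j (pderiv i q)) = c i j := by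
      intro i j
      rw [hc, lin, map_sum, map_sum, Finset.sum_eq_single j]
      · simp
      · intro b _ hb; simp [pderiv_X_of_ne hb]
      · simp
    rw [← h1, ← h1 j i, pderiv_comm']
  have h2 : ∀ x y, eval x (dirDeriv y q) =
      2 * (y ⬝ᵥ (Matrix.of fun i j => c i j / 2).mulVec x) := by
    intro x y
    rw [eval_dirDeriv, dotProduct, Finset.mul_sum]
    refine Finset.sum_congr rfl fun i _ => ?_
    rw [hc, eval_lin, Matrix.mulVec, dotProduct, dotProduct]
    simp only [Matrix.of_apply, Finset.mul_sum]
    refine Finset.sum_congr rfl fun j _ => ?_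
    ring
  refine ⟨Matrix.of fun i j => c i j / 2, ?_, ?_, h2⟩
  · ext i j
    simp [hsymm i j]
  · intro x
    have h3 := euler_eval hq x
    rw [h2] at h3
    push_cast at h3
    linear_combination -h3 / 2

lemma eval_add_quadratic {n : ℕ} {q : MvPolynomial (Fin n) ℂ} (hq : q.IsHomogeneous 2)
    (x y : Fin n → ℂ) :
    eval (x + y) q = eval x q + eval x (dirDeriv y q) + eval y q := by
  obtain ⟨M, hM, h1, h2⟩ := exists_symm_matrix hq
  rw [h1, h1, h1, h2, Matrix.mulVec_add, dotProduct_add, add_dotProduct, add_dotProduct]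
  have : x ⬝ᵥ M.mulVec y = y ⬝ᵥ M.mulVec x := by
    rw [Matrix.dotProduct_mulVec, ← Matrix.mulVec_transpose, hM, dotProduct_comm]
  rw [this]
  ring

lemma not_dvd_of_degree_lt {n d e : ℕ} {q g : MvPolynomial (Fin n) ℂ} (hq : q.IsHomogeneous d)
    (hg : g.IsHomogeneous e) (hlt : e < d) (hg0 : g ≠ 0) : ¬ q ∣ g := by
  rintro ⟨r, rfl⟩
  have h1 := left_ne_zero_of_mul hg0
  have h2 := right_ne_zero_of_mul hg0
  have h3 := hg.totalDegree hg0
  rw [totalDegree_mul_of_isDomain h1 h2, hq.totalDegree h1] at h3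
  omega

/-- Two general points of a quadric. -/
lemma exists_general_points {Q : MvPolynomial (Fin 4) ℂ} (hQ : Q.IsHomogeneous 2) (hp : Prime Q)
    {G : MvPolynomial (Fin 4) ℂ} (hG : ¬ Q ∣ G) :
    ∃ A B, LinearIndependent ℂ ![A, B] ∧ eval A Q = 0 ∧ eval B Q = 0 ∧ eval A G ≠ 0 ∧
      eval B G ≠ 0 ∧ eval (A + B) Q ≠ 0 := by
  obtain ⟨A, hA, hAG, i, hAi⟩ : ∃ A, eval A Q = 0 ∧ eval A G ≠ 0 ∧
      ∃ i, eval A (pderiv i Q) ≠ 0 := by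
    by_contra! h
    have h1 : ∀ i, pderiv i Q = 0 := by
      intro i
      by_contra hi
      have : Q ∣ G * pderiv i Q := by
        refine hp.dvd_of_forall_eval fun x hx => ?_
        rw [map_mul]
        by_cases hxG : eval x G = 0
        · rw [hxG, zero_mul]
        · rw [h x hx hxG i, mul_zero]
      exact (hp.dvd_or_dvd this).elim hG
        (not_dvd_of_degree_lt hQ hQ.pderiv (by norm_num) hi)
    apply hp.ne_zero
    refine funext fun x => ?_
    have := euler_eval hQ x
    rw [eval_dirDeriv] at this
    simpa [h1] using this
  obtain ⟨B, hB, hBG, hAB⟩ : ∃ B, eval B Q = 0 ∧ eval B G ≠ 0 ∧ eval A (dirDeriv B Q) ≠ 0 := by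
    by_contra! h
    have : Q ∣ G * lin fun i => eval A (pderiv i Q) := by
      refine hp.dvd_of_forall_eval fun x hx => ?_
      rw [map_mul, eval_lin]
      by_cases hxG : eval x G = 0
      · rw [hxG, zero_mul]
      · have := h x hx hxG
        rw [eval_dirDeriv] at this
        rw [dotProduct_comm, dotProduct, this, mul_zero]
    refine (hp.dvd_or_dvd this).elim hG (not_dvd_of_degree_lt hQ (isHomogeneous_lin _)
      (by norm_num) (lin_ne_zero fun h0 => hAi (congrFun h0 i)))
  refine ⟨A, B, ?_, hA, hB, hAG, hBG, ?_⟩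
  · rw [LinearIndependent.pair_iff]
    intro s t hst
    have h1 : s • dirDeriv A Q + t • dirDeriv B Q = 0 := by
      rw [← dirDeriv_smul, ← dirDeriv_smul, ← dirDeriv_add, hst, dirDeriv_apply]
      simp
    have h2 := congrArg (eval A) h1
    rw [map_add, smul_eval, smul_eval, euler_eval hQ, hA, mul_zero, mul_zero, zero_add,
      map_zero] at h2
    have ht : t = 0 := (mul_eq_zero.1 h2).resolve_right hAB
    refine ⟨?_, ht⟩
    rw [ht, zero_smul, add_zero] at hst
    refine (smul_eq_zero.1 hst).resolve_right fun hA0 => hAB ?_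
    rw [hA0, ← zero_smul ℂ (0 : Fin 4 → ℂ), eval_smul_of_isHomogeneous (hQ.dirDeriv B)]
    simp
  · rw [eval_add_quadratic hQ, hA, hB, zero_add, add_zero]
    exact hAB

lemma exists_planeBasis {a A B : Fin 4 → ℂ} (ha : a ≠ 0) (hAB : LinearIndependent ℂ ![A, B])
    (hA : a ⬝ᵥ A = 0) (hB : a ⬝ᵥ B = 0) : ∃ P, IsPlaneBasis a ![P, A, B] := by
  let K := LinearMap.ker (dotProductBilin ℂ ℂ a)
  have hK : 3 ≤ Module.finrank ℂ K := by
    have h1 := LinearMap.finrank_range_add_finrank_ker (dotProductBilin ℂ ℂ a)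
    have h2 := Submodule.finrank_le (LinearMap.range (dotProductBilin ℂ ℂ a))
    simp only [Module.finrank_self, Module.finrank_fin_fun] at h1 h2
    change 3 ≤ Module.finrank ℂ (LinearMap.ker (dotProductBilin ℂ ℂ a))
    omega
  have hK2 : LinearIndependent ℂ (![⟨A, hA⟩, ⟨B, hB⟩] : Fin 2 → K) := by
    refine LinearIndependent.of_comp K.subtype ?_
    convert hAB using 1
    ext i j
    fin_cases i <;> rfl
  obtain ⟨P, hP⟩ := exists_linearIndependent_cons_of_lt_finrank hK2 (by omega)
  refine ⟨P, isPlaneBasis_of_linearIndependent ha ?_ ?_⟩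
  · have h1 := hP.map' K.subtype K.ker_subtype
    have e : K.subtype ∘ (Fin.cons P ![⟨A, hA⟩, ⟨B, hB⟩] : Fin 3 → K) = ![(P : Fin 4 → ℂ), A, B] := by
      ext i j
      fin_cases i <;> rfl
    rw [e] at h1
    exact h1
  · intro k
    fin_cases k
    · exact P.2
    · exact hA
    · exact hB

lemma isRelPrime_planeMap {P A B : Fin 4 → ℂ} {Q G : MvPolynomial (Fin 4) ℂ}
    (hQ : Q.IsHomogeneous 2) (hA : eval A Q = 0) (hB : eval B Q = 0) (hAG : eval A G ≠ 0)
    (hBG : eval B G ≠ 0) (hABQ : eval (A + B) Q ≠ 0) :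
    planeMap ![P, A, B] Q ≠ 0 ∧ IsRelPrime (planeMap ![P, A, B] Q) (planeMap ![P, A, B] G) := by
  have eA : planePt ![P, A, B] ![0, 1, 0] = A := by simp [planePt, Fin.sum_univ_three]
  have eB : planePt ![P, A, B] ![0, 0, 1] = B := by simp [planePt, Fin.sum_univ_three]
  have eAB : planePt ![P, A, B] ![0, 1, 1] = A + B := by simp [planePt, Fin.sum_univ_three]
  have hne : planeMap ![P, A, B] Q ≠ 0 := by
    intro h
    apply hABQ
    rw [← eAB, ← eval_planeMap, h, map_zero]
  rw [← eA, ← eval_planeMap] at hA hAG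
  rw [← eB, ← eval_planeMap] at hB hBG
  rw [← eAB, ← eval_planeMap] at hABQ
  refine ⟨hne, ?_⟩
  have hdvd : ∀ {l g : MvPolynomial (Fin 3) ℂ} {y}, eval y l = 0 → eval y g ≠ 0 → ¬ l ∣ g := by
    rintro l _ y hl hg ⟨r, rfl⟩
    rw [map_mul, hl, zero_mul] at hg
    exact hg rfl
  rcases prime_or_eq_lin_mul_lin (isHomogeneous_planeMap hQ) hne with hp | ⟨m, m', e⟩
  · exact hp.irreducible.isRelPrime_iff_not_dvd.2 (hdvd hA hAG)
  · rw [e] at hA hB hABQ hne ⊢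
    rw [map_mul, eval_lin, eval_lin] at hA hB hABQ
    simp only [dotProduct, Fin.sum_univ_three, Matrix.cons_val_zero, Matrix.cons_val_one,
      Matrix.cons_val, mul_zero, mul_one, add_zero, zero_add] at hA hB hABQ
    have h0 : ∀ {r : Fin 3 → ℂ}, lin r ≠ 0 → r ≠ 0 := by
      rintro _ hr rfl
      exact hr (by simp [lin])
    have key : ∀ r : Fin 3 → ℂ, lin r ≠ 0 → (r 1 = 0 ∨ r 2 = 0) →
        IsRelPrime (lin r) (planeMap ![P, A, B] G) := by
      intro r hr h12
      refine (prime_lin (h0 hr)).irreducible.isRelPrime_iff_not_dvd.2 ?_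
      rcases h12 with h | h
      · exact hdvd (y := ![0, 1, 0]) (by simp [eval_lin, dotProduct, Fin.sum_univ_three, h]) hAG
      · exact hdvd (y := ![0, 0, 1]) (by simp [eval_lin, dotProduct, Fin.sum_univ_three, h]) hBG
    refine IsRelPrime.mul_left (key m (left_ne_zero_of_mul hne) ?_)
      (key m' (right_ne_zero_of_mul hne) ?_)
    · by_contra! hcon
      have h1 := (mul_eq_zero.1 hA).resolve_left hcon.1
      have h2 := (mul_eq_zero.1 hB).resolve_left hcon.2
      apply hABQ; rw [h1, h2]; ring
    · by_contra! hcon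
      have h1 := (mul_eq_zero.1 hA).resolve_right hcon.1
      have h2 := (mul_eq_zero.1 hB).resolve_right hcon.2
      apply hABQ; rw [h1, h2]; ring

lemma exists_lin_three (A B P : Fin 4 → ℂ) :
    ∃ l : Fin 4 → ℂ, l ≠ 0 ∧ l ⬝ᵥ A = 0 ∧ l ⬝ᵥ B = 0 ∧ l ⬝ᵥ P = 0 := by
  obtain ⟨l, hl, h0⟩ := Matrix.exists_mulVec_eq_zero_iff.2
    (show (Matrix.of ![A, B, P, 0]).det = 0 from
      Matrix.det_eq_zero_of_row_eq_zero 3 fun j => by simp)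
  refine ⟨l, hl, ?_, ?_, ?_⟩
  · rw [dotProduct_comm]; exact congrFun h0 0
  · rw [dotProduct_comm]; exact congrFun h0 1
  · rw [dotProduct_comm]; exact congrFun h0 2

/-- Zero loci of primes consisting of zero divisors modulo `(Q, G)` are not contained in finitely
many lines through the origin. -/
lemma exists_zero_notMem_lines {Q : MvPolynomial (Fin 4) ℂ} (hQ : Q.IsHomogeneous 2)
    (hp : Prime Q) {G : MvPolynomial (Fin 4) ℂ} (hG : ¬ Q ∣ G)
    {I : Ideal (MvPolynomial (Fin 4) ℂ)} (hI : I.IsPrime)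
    (hz : ∀ x ∈ I, ∃ u, u ∉ Ideal.span {Q, G} ∧ x * u ∈ Ideal.span {Q, G})
    (S : Set (Fin 4 → ℂ)) (hS : S.Finite) :
    ∃ R, (∀ g ∈ I, eval R g = 0) ∧ R ≠ 0 ∧ ∀ P ∈ S, ∀ c : ℂ, R ≠ c • P := by
  obtain ⟨A, B, hAB, hA, hB, hAG, hBG, hABQ⟩ := exists_general_points hQ hp hG
  choose l hl0 hlA hlB hlP using fun P => exists_lin_three A B P
  by_contra! h
  have hmem : ∏ P ∈ insert 0 hS.toFinset, lin (l P) ∈ I := by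
    refine mem_of_forall_zeroLocus hI fun R hR => ?_
    rw [map_prod]
    have : ∃ P ∈ insert 0 hS.toFinset, ∃ c : ℂ, R = c • P := by
      by_cases hR0 : R = 0
      · exact ⟨0, Finset.mem_insert_self _ _, 0, by rw [hR0, smul_zero]⟩
      · obtain ⟨P, hP, c, hc⟩ := h R hR hR0
        exact ⟨P, Finset.mem_insert_of_mem (by simpa using hP), c, hc⟩
    obtain ⟨P, hP, c, rfl⟩ := this
    refine Finset.prod_eq_zero hP ?_
    rw [eval_lin, dotProduct_smul, hlP, smul_zero]
  obtain ⟨P, -, hP⟩ := (hI.prod_mem_iff).1 hmem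
  obtain ⟨u, hu, hlu⟩ := hz _ hP
  obtain ⟨V, hV⟩ := exists_planeBasis (hl0 P) hAB (hlA P) (hlB P)
  obtain ⟨h1, h2⟩ := isRelPrime_planeMap (P := V) hQ hA hB hAG hBG hABQ
  exact hu (mem_of_lin_mul_mem hV h1 h2 hlu)

/-- The associated primes of an ideal. -/
lemma exists_associated_primes (I : Ideal (MvPolynomial (Fin 4) ℂ)) :
    ∃ A : Set (Ideal (MvPolynomial (Fin 4) ℂ)), A.Finite ∧
      (∀ J ∈ A, J.IsPrime ∧ I ≤ J ∧ ∀ x ∈ J, ∃ u, u ∉ I ∧ x * u ∈ I) ∧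
      ∀ x u, u ∉ I → x * u ∈ I → ∃ J ∈ A, x ∈ J := by
  have hU := biUnion_associatedPrimes_eq_zero_divisors (MvPolynomial (Fin 4) ℂ)
    (MvPolynomial (Fin 4) ℂ ⧸ I)
  refine ⟨associatedPrimes _ (MvPolynomial (Fin 4) ℂ ⧸ I), associatedPrimes.finite _ _, ?_, ?_⟩
  · intro J hJ
    refine ⟨IsAssociatedPrime.isPrime hJ, ?_, fun x hx => ?_⟩
    · have := IsAssociatedPrime.annihilator_le hJ
      rw [Submodule.annihilator_top, Ideal.annihilator_quotient] at this
      exact this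
    · have h1 : x ∈ {r : MvPolynomial (Fin 4) ℂ | ∃ y : MvPolynomial (Fin 4) ℂ ⧸ I, y ≠ 0 ∧ r • y = 0} := by
        rw [← hU]
        exact Set.mem_biUnion hJ hx
      obtain ⟨y, hy, hxy⟩ := h1
      obtain ⟨u, rfl⟩ := Ideal.Quotient.mk_surjective y
      refine ⟨u, fun h => hy (Ideal.Quotient.eq_zero_iff_mem.2 h), ?_⟩
      rw [← Ideal.Quotient.eq_zero_iff_mem, ← hxy, map_mul]
      rfl
  · intro x u hu hxu
    have h1 : x ∈ {r : MvPolynomial (Fin 4) ℂ | ∃ y : MvPolynomial (Fin 4) ℂ ⧸ I, y ≠ 0 ∧ r • y = 0} := by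
      refine ⟨Ideal.Quotient.mk I u, fun h => hu (Ideal.Quotient.eq_zero_iff_mem.1 h), ?_⟩
      rw [← Ideal.Quotient.eq_zero_iff_mem, map_mul] at hxu
      rw [← hxu]
      rfl
    rw [← hU] at h1
    obtain ⟨J, hJ, hx⟩ := Set.mem_iUnion₂.1 h1
    exact ⟨J, hJ, hx⟩

namespace TenPoints
variable {f : MvPolynomial (Fin 4) ℂ} {p : Fin 10 → Fin 4 → ℂ}

/-- A nonsingular point of the sextic on `Q = G = 0`. -/
lemma exists_nonsingular (h : TenPoints f p) {Q : MvPolynomial (Fin 4) ℂ}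
    (hQ : Q.IsHomogeneous 2) (hp : Prime Q) {G : MvPolynomial (Fin 4) ℂ} {d : ℕ} (hd : d ≠ 0)
    (hG : G.IsHomogeneous d) (hQG : ¬ Q ∣ G) :
    ∃ R, R ≠ 0 ∧ eval R Q = 0 ∧ eval R G = 0 ∧ ∃ v, eval R (dirDeriv v f) ≠ 0 := by
  have hz : ∀ {g : MvPolynomial (Fin 4) ℂ} {d : ℕ}, d ≠ 0 → g.IsHomogeneous d → eval 0 g = 0 := by
    intro g d hd hg
    rw [← zero_smul ℂ (0 : Fin 4 → ℂ), eval_smul_of_isHomogeneous hg, zero_pow hd, zero_mul]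
  have hI : (1 : MvPolynomial (Fin 4) ℂ) ∉ Ideal.span {Q, G} := by
    rw [Ideal.mem_span_pair]
    rintro ⟨s, t, hst⟩
    have := congrArg (eval 0) hst
    rw [map_add, map_mul, map_mul, hz two_ne_zero hQ, hz hd hG, mul_zero, mul_zero, add_zero,
      map_one] at this
    exact zero_ne_one this
  obtain ⟨A, -, hA, hA'⟩ := exists_associated_primes (Ideal.span {Q, G})
  obtain ⟨J, hJ, -⟩ := hA' 0 1 hI (by simp)
  obtain ⟨hJp, hJI, hJz⟩ := hA J hJ
  obtain ⟨R, hR, hR0, hRS⟩ := exists_zero_notMem_lines hQ hp hQG hJp hJz (Set.range p)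
    (Set.finite_range p)
  refine ⟨R, hR0, hR Q (hJI (Ideal.subset_span (by simp))),
    hR G (hJI (Ideal.subset_span (by simp))), ?_⟩
  by_contra! hcon
  obtain ⟨i, c, hc⟩ := h.sing R hR0 hcon
  exact hRS (p i) ⟨i, rfl⟩ c hc

end TenPoints

lemma exists_isPlaneBasis {a : Fin 4 → ℂ} (ha : a ≠ 0) : ∃ U, IsPlaneBasis a U := by
  obtain ⟨D, hD, haD, -⟩ := exists_lin_three a 0 0
  obtain ⟨w, hw⟩ := exists_dotProduct_ne_zero hD
  obtain ⟨E, hE, haE, hwE, -⟩ := exists_lin_three a w 0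
  rw [dotProduct_comm] at haD haE hwE
  obtain ⟨P, hP⟩ := exists_planeBasis ha (A := D) (B := E) (by
    rw [LinearIndependent.pair_iff]
    intro s t hst
    have := congrArg (fun v => w ⬝ᵥ v) hst
    rw [dotProduct_comm] at hw
    have hs : s = 0 := by simpa [dotProduct_add, hwE, hw] using this
    exact ⟨hs, by simpa [hs, hE] using hst⟩) haD haE
  exact ⟨_, hP⟩

namespace TenPoints
variable {f : MvPolynomial (Fin 4) ℂ} {p : Fin 10 → Fin 4 → ℂ}

lemma conic_coeff_ne_zero (h : TenPoints f p) {i j k l m : Fin 10} (hij : i ≠ j)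
    (hjk : j ≠ k) (hkl : k ≠ l) (hkm : k ≠ m) (hlm : l ≠ m) (hli : l ≠ i) (hlj : l ≠ j)
    (hmi : m ≠ i) (hmj : m ≠ j)
    {y z : Fin 3 → ℂ} (hl : p l = y 0 • p i + y 1 • p j + y 2 • p k)
    (hm : p m = z 0 • p i + z 1 • p j + z 2 • p k) {α β δ : ℂ} (h0 : ¬(α = 0 ∧ β = 0 ∧ δ = 0))
    (hy : α * (y 0 * y 1) + β * (y 1 * y 2) + δ * (y 2 * y 0) = 0)
    (hz : α * (z 0 * z 1) + β * (z 1 * z 2) + δ * (z 2 * z 0) = 0) : α ≠ 0 := by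
  rintro rfl
  have hy2 : y 2 ≠ 0 := fun h0 => h.not_collinear hli hlj hij (y 0) (y 1) (by simp [hl, h0])
  have hz2 : z 2 ≠ 0 := fun h0 => h.not_collinear hmi hmj hij (z 0) (z 1) (by simp [hm, h0])
  have hy0 : y 0 ≠ 0 := fun h0 => h.not_collinear hlj hkl.symm hjk (y 1) (y 2) (by simp [hl, h0])
  have hy' : β * y 1 + δ * y 0 = 0 := by
    have : y 2 * (β * y 1 + δ * y 0) = 0 := by linear_combination hy
    exact (mul_eq_zero.1 this).resolve_left hy2
  have hz' : β * z 1 + δ * z 0 = 0 := by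
    have : z 2 * (β * z 1 + δ * z 0) = 0 := by linear_combination hz
    exact (mul_eq_zero.1 this).resolve_left hz2
  have hβ : β ≠ 0 := by
    rintro rfl
    exact h0 ⟨rfl, rfl, by simpa [hy0] using hy'⟩
  have hyz : y 1 * z 0 = y 0 * z 1 := by
    have : β * (y 1 * z 0 - y 0 * z 1) = 0 := by linear_combination z 0 * hy' - y 0 * hz'
    exact sub_eq_zero.1 ((mul_eq_zero.1 this).resolve_left hβ)
  refine h.not_collinear hlm.symm hkm.symm hkl.symm (z 0 / y 0) (z 2 - z 0 / y 0 * y 2) ?_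
  ext r
  have hlr := congrFun hl r
  have hmr := congrFun hm r
  simp only [Pi.add_apply, Pi.smul_apply, smul_eq_mul] at hlr hmr ⊢
  rw [hmr, hlr]
  field_simp
  linear_combination -p j r * hyz

lemma linearIndependent_three (h : TenPoints f p) {i j k : Fin 10} (hij : i ≠ j)
    (hik : i ≠ k) (hjk : j ≠ k) : LinearIndependent ℂ ![p i, p j, p k] := by
  have key : ∀ {i j k : Fin 10}, i ≠ j → i ≠ k → j ≠ k → ∀ {a b c : ℂ},
      a • p i + b • p j + c • p k = 0 → a = 0 := by
    intro i j k hij hik hjk a b c habc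
    by_contra ha
    refine h.not_collinear hij hik hjk (-(b / a)) (-(c / a)) ?_
    ext r
    have := congrFun habc r
    simp only [Pi.add_apply, Pi.smul_apply, smul_eq_mul, Pi.zero_apply] at this ⊢
    field_simp
    linear_combination this
  rw [Fintype.linearIndependent_iff]
  intro g hg
  simp only [Fin.sum_univ_three, Matrix.cons_val_zero, Matrix.cons_val_one, Matrix.cons_val] at hg
  intro r
  fin_cases r
  · exact key hij hik hjk hg
  · exact key hjk hij.symm hik.symm (b := g 2) (c := g 0)
      (by rw [add_comm, ← add_assoc]; exact hg)
  · exact key hik.symm hjk.symm hij (b := g 0) (c := g 1)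
      (by rw [add_assoc, add_comm]; exact hg)

/-- A plane containing at least five of the ten points. -/
lemma five_points_plane (h : TenPoints f p) {a : Fin 4 → ℂ} (ha : a ≠ 0) {T : Finset (Fin 10)}
    (hT : 5 ≤ T.card) (haT : ∀ i ∈ T, a ⬝ᵥ p i = 0) :
    ∃ U α β δ c, IsPlaneBasis a U ∧ c ≠ 0 ∧ planeMap U f = C c * conic α β δ ^ 3 ∧
      ∀ T' : Finset (Fin 10), (∀ i ∈ T', a ⬝ᵥ p i = 0) → T'.card ≤ 5 := by
  obtain ⟨T₀, hT₀, hcard⟩ := Finset.exists_subset_card_eq hT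
  have e := T₀.equivFinOfCardEq hcard
  obtain ⟨s, hs, hsT⟩ : ∃ s : Fin 5 → Fin 10, Function.Injective s ∧ ∀ k, s k ∈ T :=
    ⟨fun k => e.symm k, fun k l hkl => e.symm.injective (Subtype.ext hkl),
      fun k => hT₀ (e.symm k).2⟩
  have hne : ∀ {k l}, k ≠ l → s k ≠ s l := fun hkl h => hkl (hs h)
  have hind : LinearIndependent ℂ ![p (s 0), p (s 1), p (s 2)] :=
    h.linearIndependent_three (hne (by decide)) (hne (by decide)) (hne (by decide))
  have hU := isPlaneBasis_of_linearIndependent ha hind (by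
    intro k; fin_cases k <;> exact haT _ (hsT _))
  obtain ⟨y, hy⟩ := (hU.mem _).1 (haT _ (hsT 3))
  obtain ⟨z, hz⟩ := (hU.mem _).1 (haT _ (hsT 4))
  obtain ⟨r, hr, hr0⟩ := Matrix.exists_mulVec_eq_zero_iff.2
    (show (Matrix.of ![![y 0 * y 1, y 1 * y 2, y 2 * y 0], ![z 0 * z 1, z 1 * z 2, z 2 * z 0],
      0]).det = 0 from Matrix.det_eq_zero_of_row_eq_zero 2 fun j => by simp)
  have hr1 := congrFun hr0 0
  have hr2 := congrFun hr0 1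
  simp [Matrix.mulVec, dotProduct, Fin.sum_univ_three] at hr1 hr2
  simp [planePt, Fin.sum_univ_three] at hy hz
  have hn : ¬(r 0 = 0 ∧ r 1 = 0 ∧ r 2 = 0) := by
    rintro ⟨h0, h1, h2⟩
    apply hr
    ext k
    fin_cases k <;> assumption
  have hα : r 0 ≠ 0 := h.conic_coeff_ne_zero (hne (show 0 ≠ 1 by decide))
    (hne (show 1 ≠ 2 by decide)) (hne (show 2 ≠ 3 by decide)) (hne (show 2 ≠ 4 by decide))
    (hne (show 3 ≠ 4 by decide)) (hne (show 3 ≠ 0 by decide)) (hne (show 3 ≠ 1 by decide))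
    (hne (show 4 ≠ 0 by decide)) (hne (show 4 ≠ 1 by decide)) hy hz hn
    (by linear_combination hr1) (by linear_combination hr2)
  have hβ : r 1 ≠ 0 := h.conic_coeff_ne_zero (hne (show 1 ≠ 2 by decide))
    (hne (show 2 ≠ 0 by decide)) (hne (show 0 ≠ 3 by decide)) (hne (show 0 ≠ 4 by decide))
    (hne (show 3 ≠ 4 by decide)) (hne (show 3 ≠ 1 by decide)) (hne (show 3 ≠ 2 by decide))
    (hne (show 4 ≠ 1 by decide)) (hne (show 4 ≠ 2 by decide))
    (y := ![y 1, y 2, y 0]) (z := ![z 1, z 2, z 0])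
    (by rw [hy]; simp; abel) (by rw [hz]; simp; abel) (α := r 1) (β := r 2) (δ := r 0) (by tauto)
    (by simp; linear_combination hr1) (by simp; linear_combination hr2)
  have hδ : r 2 ≠ 0 := h.conic_coeff_ne_zero (hne (show 2 ≠ 0 by decide))
    (hne (show 0 ≠ 1 by decide)) (hne (show 1 ≠ 3 by decide)) (hne (show 1 ≠ 4 by decide))
    (hne (show 3 ≠ 4 by decide)) (hne (show 3 ≠ 2 by decide)) (hne (show 3 ≠ 0 by decide))
    (hne (show 4 ≠ 2 by decide)) (hne (show 4 ≠ 0 by decide))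
    (y := ![y 2, y 0, y 1]) (z := ![z 2, z 0, z 1])
    (by rw [hy]; simp; abel) (by rw [hz]; simp; abel) (α := r 2) (β := r 0) (δ := r 1) (by tauto)
    (by simp; linear_combination hr1) (by simp; linear_combination hr2)
  obtain ⟨⟨c, hc, hfc⟩, h5⟩ := h.conic_plane hU hα hβ hδ (Finset.univ.image s)
    (by rw [Finset.card_image_of_injective _ hs]; simp) (by
      intro i hi
      obtain ⟨k, -, rfl⟩ := Finset.mem_image.1 hi
      fin_cases k
      · exact ⟨![1, 0, 0], by simp [planePt, Fin.sum_univ_three], by simp [eval_conic]⟩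
      · exact ⟨![0, 1, 0], by simp [planePt, Fin.sum_univ_three], by simp [eval_conic]⟩
      · exact ⟨![0, 0, 1], by simp [planePt, Fin.sum_univ_three], by simp [eval_conic]⟩
      · exact ⟨y, by simp [planePt, Fin.sum_univ_three, hy],
          by rw [eval_conic]; linear_combination hr1⟩
      · exact ⟨z, by simp [planePt, Fin.sum_univ_three, hz],
          by rw [eval_conic]; linear_combination hr2⟩)
  exact ⟨_, _, _, _, c, hU, hc, hfc, h5⟩

/-- Points of the sextic on a plane where the sextic is a triple conic are critical in the plane. -/
lemma dirDeriv_eq_zero_of_cube (_h : TenPoints f p) {a : Fin 4 → ℂ} {U : Fin 3 → Fin 4 → ℂ}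
    (hU : IsPlaneBasis a U) {c : ℂ} (hc : c ≠ 0) {E : MvPolynomial (Fin 3) ℂ}
    (hf : planeMap U f = C c * E ^ 3) {S : Fin 4 → ℂ} (hS : eval S f = 0) (haS : a ⬝ᵥ S = 0)
    {v : Fin 4 → ℂ} (hv : a ⬝ᵥ v = 0) : eval S (dirDeriv v f) = 0 := by
  obtain ⟨y, rfl⟩ := (hU.mem S).1 haS
  obtain ⟨z, rfl⟩ := (hU.mem v).1 hv
  have hE : eval y E = 0 := by
    rw [← eval_planeMap, hf, map_mul, eval_C, map_pow] at hS
    exact pow_eq_zero_iff (by norm_num) |>.1 ((mul_eq_zero.1 hS).resolve_left hc)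
  have hk : ∀ k, eval (planePt U y) (dirDeriv (U k) f) = 0 := by
    intro k
    rw [← eval_planeMap, ← pderiv_planeMap, hf]
    simp [hE]
  have hy : dirDeriv (planePt U z) f = z 0 • dirDeriv (U 0) f + z 1 • dirDeriv (U 1) f +
      z 2 • dirDeriv (U 2) f := by
    rw [planePt, Fin.sum_univ_three, dirDeriv_add, dirDeriv_add, dirDeriv_smul, dirDeriv_smul,
      dirDeriv_smul]
  rw [hy]
  simp [hk, smul_eval]

lemma exists_zero_on_line {g : MvPolynomial (Fin 4) ℂ} {d : ℕ} (hg : g.IsHomogeneous d)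
    (hd : d ≠ 0) (a b : Fin 4 → ℂ) : ∃ S, S ≠ 0 ∧ a ⬝ᵥ S = 0 ∧ b ⬝ᵥ S = 0 ∧ eval S g = 0 := by
  obtain ⟨D, hD, haD, hbD, -⟩ := exists_lin_three a b 0
  obtain ⟨w, hw⟩ := exists_dotProduct_ne_zero hD
  obtain ⟨E, hE, haE, hbE, hwE⟩ := exists_lin_three a b w
  rw [dotProduct_comm] at haD hbD haE hbE
  have hγ : ∀ k, (lineCurve D E k).natDegree ≤ 1 := fun k => by
    rw [lineCurve]; compute_degree
  obtain ⟨-, hco⟩ := natDegree_coeff_aeval hg hγ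
  have htop : (fun k => (lineCurve D E k).coeff 1) = E := by
    ext k; simp [lineCurve, Polynomial.coeff_C]
  rw [htop, mul_one] at hco
  by_cases hg0 : eval E g = 0
  · exact ⟨E, hE, haE, hbE, hg0⟩
  · have hdeg : (aeval (lineCurve D E) g).degree ≠ 0 := by
      intro h0
      rw [Polynomial.eq_C_of_degree_eq_zero h0, Polynomial.coeff_C, if_neg hd] at hco
      exact hg0 hco.symm
    obtain ⟨t, ht⟩ := IsAlgClosed.exists_root _ hdeg
    rw [Polynomial.IsRoot, eval_aeval_curve, eval_lineCurve] at ht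
    refine ⟨D + t • E, ?_, ?_, ?_, ht⟩
    · intro h0
      have := congrArg (fun v => w ⬝ᵥ v) h0
      simp only [dotProduct_add, dotProduct_smul, dotProduct_zero, dotProduct_comm w E, hwE,
        smul_zero, add_zero] at this
      exact hw (by rw [dotProduct_comm]; exact this)
    · rw [dotProduct_add, dotProduct_smul, haD, haE, smul_zero, add_zero]
    · rw [dotProduct_add, dotProduct_smul, hbD, hbE, smul_zero, add_zero]

/-- The ten points do not lie on a pair of planes. -/
lemma false_of_two_planes (h : TenPoints f p) {a b : Fin 4 → ℂ} (ha : a ≠ 0) (hb : b ≠ 0)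
    (hab : ∀ i, a ⬝ᵥ p i = 0 ∨ b ⬝ᵥ p i = 0) : False := by
  classical
  wlog hle : (Finset.univ.filter fun i => b ⬝ᵥ p i = 0).card ≤
    (Finset.univ.filter fun i => a ⬝ᵥ p i = 0).card generalizing a b
  · exact this hb ha (fun i => (hab i).symm) (le_of_not_ge hle)
  set Ta := Finset.univ.filter fun i => a ⬝ᵥ p i = 0 with hTa
  set Tb := Finset.univ.filter fun i => b ⬝ᵥ p i = 0 with hTb
  have hmemA : ∀ i, i ∈ Ta ↔ a ⬝ᵥ p i = 0 := fun i => by simp [hTa]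
  have hmemB : ∀ i, i ∈ Tb ↔ b ⬝ᵥ p i = 0 := fun i => by simp [hTb]
  have hun : (Ta ∪ Tb).card = 10 := by
    have : Ta ∪ Tb = Finset.univ := by
      ext i
      simp only [Finset.mem_union, hmemA, hmemB, Finset.mem_univ, iff_true]
      exact hab i
    rw [this]; simp
  have hcard := Finset.card_union_add_card_inter Ta Tb
  obtain ⟨U, α, β, δ, c, hU, hc, hfU, h5⟩ := h.five_points_plane ha (T := Ta) (by omega)
    fun i hi => (hmemA i).1 hi
  have h5a := h5 Ta fun i hi => (hmemA i).1 hi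
  obtain ⟨V, α', β', δ', c', hV, hc', hfV, -⟩ := h.five_points_plane hb (T := Tb) (by omega)
    fun i hi => (hmemB i).1 hi
  have hdisj : Ta ∩ Tb = ∅ := Finset.card_eq_zero.1 (by omega)
  have hnot : ∀ i, ¬(a ⬝ᵥ p i = 0 ∧ b ⬝ᵥ p i = 0) := by
    intro i hi
    have : i ∈ Ta ∩ Tb := Finset.mem_inter.2 ⟨(hmemA i).2 hi.1, (hmemB i).2 hi.2⟩
    rw [hdisj] at this
    simp at this
  obtain ⟨i, hi⟩ : Ta.Nonempty := Finset.card_pos.1 (by omega)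
  have hai := (hmemA i).1 hi
  have hbi : b ⬝ᵥ p i ≠ 0 := fun hbi => hnot i ⟨hai, hbi⟩
  obtain ⟨S, hS0, haS, hbS, hfS⟩ := exists_zero_on_line h.hom (by norm_num) a b
  obtain ⟨j, e, rfl⟩ := h.sing S hS0 fun w => by
    have hw : w = (w - (b ⬝ᵥ w / b ⬝ᵥ p i) • p i) + (b ⬝ᵥ w / b ⬝ᵥ p i) • p i := by abel
    rw [hw, dirDeriv_add, map_add,
      h.dirDeriv_eq_zero_of_cube hV hc' hfV hfS hbS (by
        rw [dotProduct_sub, dotProduct_smul, smul_eq_mul, div_mul_cancel₀ _ hbi, sub_self]),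
      h.dirDeriv_eq_zero_of_cube hU hc hfU hfS haS (by
        rw [dotProduct_smul, hai, smul_zero]), add_zero]
  have he : e ≠ 0 := fun he => hS0 (by rw [he, zero_smul])
  rw [dotProduct_smul, smul_eq_mul] at haS hbS
  exact hnot j ⟨(mul_eq_zero.1 haS).resolve_left he, (mul_eq_zero.1 hbS).resolve_left he⟩

end TenPoints

/-- `J` is the prime ideal of a component of the curve `Q = f = 0` along which the hyperplane
`a ⬝ᵥ x = 0` is tangent to the surface `f = 0`. -/
structure ContactIdeal (f Q : MvPolynomial (Fin 4) ℂ) (a : Fin 4 → ℂ)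
    (J : Ideal (MvPolynomial (Fin 4) ℂ)) : Prop where
  ne_zero : a ≠ 0
  prime : J.IsPrime
  mem : Q ∈ J
  exists_mul_mem : ∀ x ∈ J, ∃ u, u ∉ Ideal.span {Q, f} ∧ x * u ∈ Ideal.span {Q, f}
  dirDeriv_mem : ∀ v, a ⬝ᵥ v = 0 → dirDeriv v f ∈ J
  lin_mem : lin a ∈ J

lemma TenPoints.exists_contactIdeal {f : MvPolynomial (Fin 4) ℂ} {p : Fin 10 → Fin 4 → ℂ}
    (h : TenPoints f p) {Q : MvPolynomial (Fin 4) ℂ} (hQ : Q.IsHomogeneous 2) (hp : Prime Q)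
    (hQf : ¬ Q ∣ f) {a : Fin 4 → ℂ} (ha : a ≠ 0)
    (key : ∀ v, a ⬝ᵥ v = 0 →
      ∃ u, u ∉ Ideal.span {Q, f} ∧ dirDeriv v f * u ∈ Ideal.span {Q, f}) :
    ∃ J, ContactIdeal f Q a J := by
  classical
  obtain ⟨A, hfin, hA, hcov⟩ := exists_associated_primes (Ideal.span {Q, f})
  let K := LinearMap.ker (dotProductBilin ℂ ℂ a)
  let W : Ideal (MvPolynomial (Fin 4) ℂ) → Subspace ℂ K := fun J =>
    { carrier := {v | dirDeriv (v : Fin 4 → ℂ) f ∈ J}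
      add_mem' := fun {v w} hv hw => by
        change dirDeriv ((v : Fin 4 → ℂ) + (w : Fin 4 → ℂ)) f ∈ J
        rw [dirDeriv_add]
        exact J.add_mem hv hw
      zero_mem' := by
        change dirDeriv (0 : Fin 4 → ℂ) f ∈ J
        rw [← zero_smul ℂ (0 : Fin 4 → ℂ), dirDeriv_smul, zero_smul]
        exact J.zero_mem
      smul_mem' := fun c v hv => by
        change dirDeriv (c • (v : Fin 4 → ℂ)) f ∈ J
        rw [dirDeriv_smul]
        exact Submodule.smul_of_tower_mem J c hv }
  obtain ⟨J, hJA, hJ⟩ : ∃ J ∈ A, W J = ⊤ := by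
    by_contra! hcon
    refine Subspace.biUnion_ne_univ_of_top_notMem (s := hfin.toFinset.image W) ?_ ?_
    · intro htop
      obtain ⟨J, hJ, hW⟩ := Finset.mem_image.1 htop
      exact hcon J (hfin.mem_toFinset.1 hJ) hW
    · refine Set.eq_univ_of_forall fun v => ?_
      obtain ⟨u, hu, hvu⟩ := key v v.2
      obtain ⟨J, hJ, hv⟩ := hcov _ u hu hvu
      exact Set.mem_biUnion (Finset.mem_image_of_mem W (hfin.mem_toFinset.2 hJ)) hv
  obtain ⟨hJp, hJle, hJz⟩ := hA J hJA
  have hQJ : Q ∈ J := hJle (Ideal.subset_span (by simp))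
  have hfJ : f ∈ J := hJle (Ideal.subset_span (by simp))
  have hder : ∀ v, a ⬝ᵥ v = 0 → dirDeriv v f ∈ J := by
    intro v hv
    have : (⟨v, hv⟩ : K) ∈ W J := hJ ▸ Submodule.mem_top
    exact this
  obtain ⟨w, hw⟩ := exists_dotProduct_ne_zero ha
  refine ⟨J, ha, hJp, hQJ, hJz, hder, ?_⟩
  have hmem : lin a * dirDeriv w f ∈ J := mem_of_forall_zeroLocus hJp fun x hx => by
    obtain ⟨u, hu, hxu⟩ := dirDeriv_decomp a x w hw f
    have h1 := congrArg (eval x) hxu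
    rw [euler_eval h.hom, hx f hfJ, map_add, hx _ (hder u hu), smul_eval] at h1
    rw [map_mul, eval_lin]
    field_simp at h1
    simpa [eq_comm] using h1
  refine (hJp.mem_or_mem hmem).resolve_right fun hwJ => ?_
  obtain ⟨R, hR, hR0, hRp⟩ := exists_zero_notMem_lines hQ hp hQf hJp hJz (Set.range p)
    (Set.finite_range p)
  obtain ⟨i, c, hi⟩ := h.sing R hR0 fun v => by
    obtain ⟨u, hu, hxu⟩ := dirDeriv_decomp a v w hw f
    rw [hxu, map_add, hR _ (hder u hu), smul_eval, hR _ hwJ, mul_zero, add_zero]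
  exact hRp (p i) ⟨i, rfl⟩ c hi

/-- The vectors killed by two independent linear forms. -/
lemma exists_basis_two_planes {a m v : Fin 4 → ℂ} (ha : a ≠ 0) (hav : a ⬝ᵥ v = 0)
    (hmv : m ⬝ᵥ v ≠ 0) : ∃ D E, LinearIndependent ℂ ![D, E] ∧ a ⬝ᵥ D = 0 ∧ a ⬝ᵥ E = 0 ∧
      ∀ x, a ⬝ᵥ x = 0 → m ⬝ᵥ x = 0 → ∃ s t : ℂ, x = s • D + t • E := by
  obtain ⟨w, hw⟩ := exists_dotProduct_ne_zero ha
  let L := (dotProductBilin ℂ ℂ a).prod (dotProductBilin ℂ ℂ m)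
  have hL : ∀ x, L x = (a ⬝ᵥ x, m ⬝ᵥ x) := fun x => rfl
  have hsurj : LinearMap.range L = ⊤ := by
    rw [LinearMap.range_eq_top]
    rintro ⟨s, t⟩
    refine ⟨(s / (a ⬝ᵥ w)) • w + ((t - s / (a ⬝ᵥ w) * (m ⬝ᵥ w)) / (m ⬝ᵥ v)) • v, ?_⟩
    rw [hL, dotProduct_add, dotProduct_add, dotProduct_smul, dotProduct_smul, dotProduct_smul,
      dotProduct_smul, hav]
    simp only [smul_eq_mul]
    ext
    · field_simp; simp
    · field_simp; simp
  have hfr := LinearMap.finrank_range_add_finrank_ker L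
  rw [hsurj, finrank_top, Module.finrank_prod, Module.finrank_self, Module.finrank_fin_fun] at hfr
  have b := Module.finBasisOfFinrankEq ℂ (LinearMap.ker L) (show _ = 2 by omega)
  have hb : ∀ i, a ⬝ᵥ (b i : Fin 4 → ℂ) = 0 := fun i =>
    congrArg Prod.fst ((hL _).symm.trans (b i).2)
  refine ⟨b 0, b 1, ?_, hb 0, hb 1, fun x hax hmx => ?_⟩
  · have := b.linearIndependent.map' (LinearMap.ker L).subtype (Submodule.ker_subtype _)
    have e : (⇑(LinearMap.ker L).subtype ∘ ⇑b) = ![(b 0 : Fin 4 → ℂ), (b 1 : Fin 4 → ℂ)] := by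
      funext i
      fin_cases i <;> rfl
    exact e ▸ this
  · have hx : x ∈ LinearMap.ker L := by
      rw [LinearMap.mem_ker, hL, hax, hmx]; rfl
    refine ⟨b.repr ⟨x, hx⟩ 0, b.repr ⟨x, hx⟩ 1, ?_⟩
    have := congrArg Subtype.val (b.sum_repr ⟨x, hx⟩)
    rw [Fin.sum_univ_two] at this
    exact this.symm

/-- A linear form on a plane extends to a linear form on `ℂ⁴`. -/
lemma exists_lin_extension {U : Fin 3 → Fin 4 → ℂ} (hU : LinearIndependent ℂ U)
    (m : Fin 3 → ℂ) : ∃ m' : Fin 4 → ℂ, ∀ y, m' ⬝ᵥ planePt U y = m ⬝ᵥ y := by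
  obtain ⟨y, hy⟩ : ∃ m' : Fin 4 → ℂ, ∀ k, m' ⬝ᵥ U k = m k := by
    have hr : (Matrix.of U).mulVecLin.range = ⊤ := by
      refine Submodule.eq_top_of_finrank_eq ?_
      rw [Module.finrank_fin_fun]
      exact (LinearIndependent.rank_matrix (M := Matrix.of U) hU).trans (Fintype.card_fin 3)
    have := LinearMap.range_eq_top.1 hr m
    obtain ⟨x, hx⟩ := this
    exact ⟨x, fun k => by rw [dotProduct_comm]; exact congrFun hx k⟩
  refine ⟨y, fun z => ?_⟩
  rw [planePt, dotProduct_sum, dotProduct]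
  refine Finset.sum_congr rfl fun k _ => ?_
  rw [dotProduct_smul, hy, smul_eq_mul, mul_comm]

namespace ContactIdeal
variable {f Q : MvPolynomial (Fin 4) ℂ} {a : Fin 4 → ℂ} {J : Ideal (MvPolynomial (Fin 4) ℂ)}

/-- A homogeneous form in `J` vanishes on any parametrised curve containing almost all zeros
of `J`. -/
lemma aeval_eq_zero (hJ : ContactIdeal f Q a J) (hQ : Q.IsHomogeneous 2) (hp : Prime Q)
    (hQf : ¬ Q ∣ f) {γ : Fin 4 → Polynomial ℂ} (P : Fin 4 → ℂ)
    (hcov : ∀ R, R ≠ 0 → (∀ g ∈ J, eval R g = 0) →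
      (∃ s, ∃ c : ℂ, R = c • curveAt γ s) ∨ ∃ c : ℂ, R = c • P)
    {g : MvPolynomial (Fin 4) ℂ} {d : ℕ} (hg : g.IsHomogeneous d) (hgJ : g ∈ J) :
    aeval γ g = 0 := by
  classical
  by_contra h0
  obtain ⟨R, hR, hR0, hRS⟩ := exists_zero_notMem_lines hQ hp hQf hJ.prime hJ.exists_mul_mem
    (insert P (curveAt γ '' ((aeval γ g).roots.toFinset : Set ℂ)))
    (((Finset.finite_toSet _).image _).insert _)
  rcases hcov R hR0 hR with ⟨s, c, rfl⟩ | ⟨c, hc⟩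
  · refine hRS _ (Set.mem_insert_of_mem _ ⟨s, ?_, rfl⟩) c rfl
    have hc : c ≠ 0 := by
      rintro rfl
      exact hR0 (zero_smul _ _)
    have h1 := hR g hgJ
    rw [eval_smul_of_isHomogeneous hg, mul_eq_zero, or_iff_right (pow_ne_zero d hc),
      ← eval_aeval_curveAt] at h1
    simpa [h0] using h1
  · exact hRS P (Set.mem_insert _ _) c hc

lemma dotProduct_eq_zero_of_lin_mem {p : Fin 10 → Fin 4 → ℂ} (hJ : ContactIdeal f Q a J)
    (h : TenPoints f p) (hQ : Q.IsHomogeneous 2) (hp : Prime Q) (hQf : ¬ Q ∣ f)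
    {m : Fin 4 → ℂ} (hm : lin m ∈ J) {v : Fin 4 → ℂ} (hv : a ⬝ᵥ v = 0) : m ⬝ᵥ v = 0 := by
  by_contra hmv
  obtain ⟨D, E, hDE, haD, haE, hspan⟩ := exists_basis_two_planes hJ.ne_zero hv hmv
  have hat : ∀ s, curveAt (lineCurve D E) s = D + s • E := fun s => eval_lineCurve _ _ _
  have hγ : ∀ k, (lineCurve D E k).natDegree ≤ 1 := fun k => by
    rw [lineCurve]; compute_degree
  have htop : (fun k => (lineCurve D E k).coeff 1) = E := by
    ext k; simp [lineCurve, Polynomial.coeff_C]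
  refine h.false_of_line hJ.ne_zero hDE fun v hv s t => ?_
  have hz : aeval (lineCurve D E) (dirDeriv v f) = 0 :=
    hJ.aeval_eq_zero hQ hp hQf E (fun R hR0 hR => by
      obtain ⟨s, t, rfl⟩ := hspan R (by rw [← eval_lin]; exact hR _ hJ.lin_mem)
        (by rw [← eval_lin]; exact hR _ hm)
      by_cases hs : s = 0
      · exact Or.inr ⟨t, by rw [hs, zero_smul, zero_add]⟩
      · refine Or.inl ⟨t / s, s, ?_⟩
        rw [hat, smul_add, smul_smul, mul_div_cancel₀ _ hs])
      (h.hom.dirDeriv v) (hJ.dirDeriv_mem v hv)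
  by_cases hs : s = 0
  · have h1 := (natDegree_coeff_aeval (h.hom.dirDeriv v) hγ).2
    rw [hz, Polynomial.coeff_zero, htop] at h1
    rw [hs, zero_smul, zero_add, eval_smul_of_isHomogeneous (h.hom.dirDeriv v), ← h1, mul_zero]
  · have h1 := eval_aeval_curveAt (lineCurve D E) (t / s) (dirDeriv v f)
    rw [hz, Polynomial.eval_zero, hat] at h1
    have : s • D + t • E = s • (D + (t / s) • E) := by
      rw [smul_add, smul_smul, mul_div_cancel₀ _ hs]
    rw [this, eval_smul_of_isHomogeneous (h.hom.dirDeriv v), ← h1, mul_zero]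

lemma prime_planeMap {p : Fin 10 → Fin 4 → ℂ} (hJ : ContactIdeal f Q a J)
    (h : TenPoints f p) (hQ : Q.IsHomogeneous 2) (hp : Prime Q) (hQf : ¬ Q ∣ f)
    {U : Fin 3 → Fin 4 → ℂ} (hU : IsPlaneBasis a U) : Prime (planeMap U Q) := by
  have h0 : planeMap U Q ≠ 0 := by
    intro h0
    obtain ⟨g, hg⟩ := lin_dvd_of_planeMap_eq_zero hU h0
    rcases hp.irreducible.isUnit_or_isUnit hg with hu | hu
    · exact not_isUnit_lin _ hu
    · refine not_dvd_of_degree_lt hQ (isHomogeneous_lin a) (by norm_num) (lin_ne_zero hU.ne_zero) ?_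
      rw [hg]
      exact hu.mul_right_dvd.2 dvd_rfl
  refine (prime_or_eq_lin_mul_lin (isHomogeneous_planeMap hQ) h0).resolve_right ?_
  rintro ⟨m, n, hmn⟩
  obtain ⟨m', hm'⟩ := exists_lin_extension hU.indep m
  obtain ⟨n', hn'⟩ := exists_lin_extension hU.indep n
  have hzero : ∀ {m m' : Fin 3 → ℂ} {m'' : Fin 4 → ℂ}, (∀ y, m'' ⬝ᵥ planePt U y = m ⬝ᵥ y) →
      planeMap U Q = lin m * lin m' → lin m'' ∉ J := by
    intro m m' m'' hm hQm hmem
    refine h0 ?_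
    rw [hQm]
    refine mul_eq_zero_of_left (MvPolynomial.funext fun y => ?_) _
    rw [eval_lin, ← hm, map_zero]
    exact hJ.dotProduct_eq_zero_of_lin_mem h hQ hp hQf hmem ((hU.mem _).2 ⟨y, rfl⟩)
  have hmem : lin m' * lin n' ∈ J := mem_of_forall_zeroLocus hJ.prime fun x hx => by
    obtain ⟨y, rfl⟩ := (hU.mem x).1 (by rw [← eval_lin]; exact hx _ hJ.lin_mem)
    have := hx Q hJ.mem
    rw [← eval_planeMap, hmn, map_mul, eval_lin, eval_lin] at this
    rw [map_mul, eval_lin, eval_lin, hm', hn', this]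
  rcases hJ.prime.mem_or_mem hmem with hm | hn
  · exact hzero hm' hmn hm
  · exact hzero hn' (hmn.trans (mul_comm _ _)) hn

end ContactIdeal

/-- Three independent zeros of an irreducible ternary quadratic form. -/
lemma exists_three_zeros {q : MvPolynomial (Fin 3) ℂ} (hq : q.IsHomogeneous 2) (hp : Prime q) :
    ∃ V : Fin 3 → Fin 3 → ℂ, LinearIndependent ℂ V ∧ ∀ k, eval (V k) q = 0 := by
  have hz : ∀ l : Fin 3 → ℂ, l ≠ 0 → ∃ A, eval A q = 0 ∧ l ⬝ᵥ A ≠ 0 := by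
    intro l hl
    by_contra! hcon
    exact not_dvd_of_degree_lt hq (isHomogeneous_lin l) (by norm_num) (lin_ne_zero hl)
      (hp.dvd_of_forall_eval fun x hx => by rw [eval_lin]; exact hcon x hx)
  have hl : ∀ A B : Fin 3 → ℂ, ∃ l : Fin 3 → ℂ, l ≠ 0 ∧ l ⬝ᵥ A = 0 ∧ l ⬝ᵥ B = 0 := by
    intro A B
    obtain ⟨l, hl, h0⟩ := Matrix.exists_mulVec_eq_zero_iff.2
      (show (Matrix.of ![A, B, 0]).det = 0 from
        Matrix.det_eq_zero_of_row_eq_zero 2 fun j => by simp)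
    refine ⟨l, hl, ?_, ?_⟩
    · rw [dotProduct_comm]; exact congrFun h0 0
    · rw [dotProduct_comm]; exact congrFun h0 1
  obtain ⟨l, hl0, -, -⟩ := hl 0 0
  obtain ⟨A, hA, hlA⟩ := hz l hl0
  obtain ⟨m, hm0, hmA, -⟩ := hl A 0
  obtain ⟨B, hB, hmB⟩ := hz m hm0
  obtain ⟨n, hn0, hnA, hnB⟩ := hl A B
  obtain ⟨D, hD, hnD⟩ := hz n hn0
  refine ⟨![A, B, D], ?_, ?_⟩
  · rw [Fintype.linearIndependent_iff]
    intro g hg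
    simp only [Fin.sum_univ_three, Matrix.cons_val_zero, Matrix.cons_val_one, Matrix.cons_val]
      at hg
    have h2 : g 2 = 0 := by
      have := congrArg (fun v => n ⬝ᵥ v) hg
      simpa [dotProduct_add, hnA, hnB, hnD] using this
    have h1 : g 1 = 0 := by
      have := congrArg (fun v => m ⬝ᵥ v) hg
      simpa [dotProduct_add, hmA, hmB, h2] using this
    have h0 : g 0 = 0 := by
      have := congrArg (fun v => l ⬝ᵥ v) hg
      simpa [dotProduct_add, hlA, h1, h2] using this
    intro i
    fin_cases i <;> assumption
  · intro k
    fin_cases k <;> assumption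

lemma exists_eq_conic {q : MvPolynomial (Fin 3) ℂ} (hq : q.IsHomogeneous 2)
    (h : ∀ k, eval (Pi.single k 1) q = 0) : ∃ α β δ, q = conic α β δ := by
  obtain ⟨M, hM, hq, -⟩ := exists_symm_matrix hq
  refine ⟨2 * M 0 1, 2 * M 1 2, 2 * M 2 0, MvPolynomial.funext fun x => ?_⟩
  have hd : ∀ k, M k k = 0 := by
    intro k
    have := h k
    rw [hq] at this
    simpa using this
  have h01 := hM.apply 0 1
  have h12 := hM.apply 1 2
  have h20 := hM.apply 2 0
  rw [hq, eval_conic]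
  simp only [Matrix.mulVec, dotProduct, Fin.sum_univ_three, hd]
  rw [h01, h12, h20]
  ring

lemma coeff_ne_zero_of_prime_conic {α β δ : ℂ} (h : Prime (conic α β δ)) :
    α ≠ 0 ∧ β ≠ 0 ∧ δ ≠ 0 := by
  have key : ∀ g g' : MvPolynomial (Fin 3) ℂ, eval 0 g = 0 → eval 0 g' = 0 →
      conic α β δ ≠ g * g' := by
    intro g g' hg hg' he
    rcases h.irreducible.isUnit_or_isUnit he with hu | hu
    · exact (hu.map (eval 0)).ne_zero hg
    · exact (hu.map (eval 0)).ne_zero hg'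
  refine ⟨?_, ?_, ?_⟩ <;> rintro rfl
  · exact key (X 2) (C β * X 1 + C δ * X 0) (by simp) (by simp) (by simp [conic]; ring)
  · exact key (X 0) (C α * X 1 + C δ * X 2) (by simp) (by simp) (by simp [conic]; ring)
  · exact key (X 1) (C α * X 0 + C β * X 2) (by simp) (by simp) (by simp [conic]; ring)

/-- The hyperplane `a ⬝ᵥ x = 0` meets the sextic `f` in three times a conic on the quadric `Q`. -/
structure IsTritangentPlane (f Q : MvPolynomial (Fin 4) ℂ) (p : Fin 10 → Fin 4 → ℂ)
    (a : Fin 4 → ℂ) (c : ℂ) : Prop where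
  ne_zero : a ≠ 0
  coeff_ne_zero : c ≠ 0
  eval_eq : ∀ v, a ⬝ᵥ v = 0 → eval v f = c * eval v Q ^ 3
  card_le : ∀ T : Finset (Fin 10), (∀ i ∈ T, a ⬝ᵥ p i = 0) → T.card ≤ 5

lemma ContactIdeal.isTritangentPlane {f Q : MvPolynomial (Fin 4) ℂ} {a : Fin 4 → ℂ}
    {J : Ideal (MvPolynomial (Fin 4) ℂ)} {p : Fin 10 → Fin 4 → ℂ} (hJ : ContactIdeal f Q a J)
    (h : TenPoints f p) (hQ : Q.IsHomogeneous 2) (hp : Prime Q) (hQf : ¬ Q ∣ f)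
    (hQp : ∀ i, eval (p i) Q = 0) : ∃ c, IsTritangentPlane f Q p a c := by
  classical
  obtain ⟨U₀, hU₀⟩ := exists_isPlaneBasis hJ.ne_zero
  obtain ⟨V, hV, hVq⟩ := exists_three_zeros (isHomogeneous_planeMap hQ)
    (hJ.prime_planeMap h hQ hp hQf hU₀)
  have hU : IsPlaneBasis a fun k => planePt U₀ (V k) := by
    refine isPlaneBasis_of_linearIndependent hJ.ne_zero ?_ fun k => (hU₀.mem _).2 ⟨_, rfl⟩
    rw [Fintype.linearIndependent_iff] at hV ⊢
    intro g hg
    refine hV g (planePt_injective hU₀.indep ?_)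
    rw [planePt_zero, ← hg, planePt]
    simp only [planePt, Finset.sum_apply, Pi.smul_apply, smul_eq_mul, Finset.smul_sum,
      Finset.sum_smul, smul_smul]
    exact Finset.sum_comm
  set U := fun k => planePt U₀ (V k) with hUdef
  have hUpr := hJ.prime_planeMap h hQ hp hQf hU
  obtain ⟨α, β, δ, hcon⟩ := exists_eq_conic (isHomogeneous_planeMap (U := U) hQ) (by
    intro k
    rw [eval_planeMap]
    have : planePt U (Pi.single k 1) = planePt U₀ (V k) := by
      simp [planePt, hUdef, Pi.single_apply]
    rw [this, ← eval_planeMap, hVq])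
  rw [hcon] at hUpr
  obtain ⟨hα, hβ, hδ⟩ := coeff_ne_zero_of_prime_conic hUpr
  have hQU : ∀ y, eval (planePt U y) Q = eval y (conic α β δ) := fun y => by
    rw [← eval_planeMap, hcon]
  obtain ⟨γ, hdeg, hne, hinj, himm, htop0, htop, hon, hcov⟩ := exists_conic_param hα hβ hδ
    (planePt U ⁻¹' Set.range p) ((Set.finite_range p).preimage (planePt_injective hU.indep).injOn)
    (by
      rintro x ⟨i, hi⟩ rfl
      exact h.ne_zero i (hi.trans (planePt_zero U)))
  let Γ : Fin 4 → Polynomial ℂ := fun k => ∑ j, Polynomial.C (U j k) * γ j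
  have hat : ∀ s, curveAt Γ s = planePt U (curveAt γ s) := by
    intro s
    ext k
    simp [curveAt, Γ, planePt, Polynomial.eval_finsetSum, mul_comm]
  have hvel : ∀ s, curveVel Γ s = planePt U (curveVel γ s) := by
    intro s
    ext k
    simp [curveVel, Γ, planePt, Polynomial.eval_finsetSum, mul_comm]
  have htopΓ : curveTop Γ 2 = planePt U (curveTop γ 2) := by
    ext k
    simp [curveTop, Γ, planePt, mul_comm]
  have hinjU := planePt_injective hU.indep
  have hne' : ∀ y, y ≠ 0 → planePt U y ≠ 0 := fun y hy h0 =>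
    hy (hinjU (h0.trans (planePt_zero U).symm))
  obtain ⟨S, hS, hSs⟩ := h.card_sing_of_const_tangent hJ.ne_zero (e := 2) (γ := Γ)
    (fun k => Polynomial.natDegree_sum_le_of_forall_le _ _ fun j _ =>
      (Polynomial.natDegree_C_mul_le _ _).trans (hdeg j))
    (fun s => by rw [hat]; exact hne' _ (hne s))
    (fun s c hc => by
      rw [hat, hvel, ← planePt_smul] at hc
      exact himm s c (hinjU hc))
    (fun hs => by
      rw [htopΓ] at hs
      obtain ⟨i, c, hi⟩ := h.sing _ (hne' _ htop0) hs
      have hc : c ≠ 0 := by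
        rintro rfl
        exact hne' _ htop0 (by rw [hi, zero_smul])
      refine htop (c⁻¹ • curveTop γ 2) ⟨i, ?_⟩ c⁻¹ rfl
      rw [planePt_smul, hi, smul_smul, inv_mul_cancel₀ hc, one_smul])
    (fun v hv => hJ.aeval_eq_zero hQ hp hQf (curveTop Γ 2) (fun R hR0 hR => by
      obtain ⟨y, rfl⟩ := (hU.mem R).1 (by rw [← eval_lin]; exact hR _ hJ.lin_mem)
      have hy0 : y ≠ 0 := by
        rintro rfl
        exact hR0 (planePt_zero U)
      have hy := hR Q hJ.mem
      rw [hQU, eval_conic] at hy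
      rcases hcov y hy0 hy with ⟨s, c, rfl⟩ | ⟨c, rfl⟩
      · exact Or.inl ⟨s, c, by rw [hat, planePt_smul]⟩
      · exact Or.inr ⟨c, by rw [htopΓ, planePt_smul]⟩)
      (h.hom.dirDeriv v) (hJ.dirDeriv_mem v hv))
  have hsing : ∀ s : S, ∃ i, ∃ c : ℂ, c ≠ 0 ∧ p i = c • curveAt Γ s := by
    intro s
    have hs0 : curveAt Γ s ≠ 0 := by rw [hat]; exact hne' _ (hne s)
    obtain ⟨i, c, hi⟩ := h.sing _ hs0 (hSs s s.2)
    have hc : c ≠ 0 := by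
      rintro rfl
      exact hs0 (by rw [hi, zero_smul])
    exact ⟨i, c⁻¹, inv_ne_zero hc, by rw [hi, smul_smul, inv_mul_cancel₀ hc, one_smul]⟩
  choose i c hc hi using hsing
  have hii : Function.Injective i := by
    intro s t hst
    have h1 : curveAt Γ s = ((c s)⁻¹ * c t) • curveAt Γ t := by
      rw [mul_smul, ← hi t, ← hst, hi s, smul_smul, inv_mul_cancel₀ (hc s), one_smul]
    rw [hat, hat, ← planePt_smul] at h1
    exact Subtype.ext (hinj _ _ _ (hinjU h1))
  obtain ⟨⟨e, he, hfe⟩, hcard⟩ := h.conic_plane hU hα hβ hδ (Finset.univ.image i)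
    (by rw [Finset.card_image_of_injective _ hii, Finset.card_univ, Fintype.card_coe]; omega)
    (by
      intro j hj
      obtain ⟨s, -, rfl⟩ := Finset.mem_image.1 hj
      have hp' : p (i s) = planePt U (c s • curveAt γ s) := by rw [hi, hat, planePt_smul]
      exact ⟨_, hp', by rw [← hQU, ← hp', hQp]⟩)
  refine ⟨e, hJ.ne_zero, he, fun v hv => ?_, hcard⟩
  obtain ⟨y, rfl⟩ := (hU.mem v).1 hv
  rw [hQU, ← eval_planeMap, hfe, map_mul, map_pow, eval_C]

instance finite_homogeneousSubmodule (n : ℕ) :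
    Module.Finite ℂ (homogeneousSubmodule (Fin 4) ℂ n) :=
  Module.Finite.iff_fg.2 (homogeneousSubmodule_fg (Fin 4) ℂ n)

lemma finrank_homogeneousSubmodule (n : ℕ) :
    6 * Module.finrank ℂ (homogeneousSubmodule (Fin 4) ℂ n) = (n + 1) * (n + 2) * (n + 3) := by
  have h1 : Module.finrank ℂ (homogeneousSubmodule (Fin 4) ℂ n) = (n + 3).choose 3 := by
    rw [homogeneousSubmodule_eq_finsupp_supported]
    have hb := Module.finrank_eq_nat_card_basis
      (basisRestrictSupport ℂ {d : Fin 4 →₀ ℕ | d.degree = n})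
    refine hb.trans ?_
    have hs : {d : Fin 4 →₀ ℕ | d.degree = n} =
        ((Finset.univ : Finset (Fin 4)).finsuppAntidiag n : Set (Fin 4 →₀ ℕ)) := by
      ext d
      simp [Finsupp.degree_eq_sum]
    rw [hs, Nat.card_eq_card_toFinset, Finset.toFinset_coe,
      Finset.card_finsuppAntidiag_nat_eq_choose]
    rw [Finset.card_univ, Fintype.card_fin, show 4 + n - 1 = n + 3 by omega]
    rw [← Nat.choose_symm_add]
  rw [h1]
  have h2 := Nat.add_one_mul_choose_eq (n + 2) 2
  have h3 := Nat.add_one_mul_choose_eq (n + 1) 1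
  rw [Nat.choose_one_right] at h3
  have h2' : (n + 3) * (n + 2).choose 2 = (n + 3).choose 3 * 3 := h2
  have h3' : (n + 2) * (n + 1) = (n + 2).choose 2 * 2 := h3
  calc 6 * (n + 3).choose 3 = 2 * ((n + 3).choose 3 * 3) := by ring
    _ = (n + 3) * ((n + 2).choose 2 * 2) := by rw [← h2']; ring
    _ = _ := by rw [← h3']; ring

/-- The forms of degree `n` in an ideal. -/
def gradedPiece (I : Ideal (MvPolynomial (Fin 4) ℂ)) (n : ℕ) :
    Submodule ℂ (MvPolynomial (Fin 4) ℂ) :=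
  I.restrictScalars ℂ ⊓ homogeneousSubmodule (Fin 4) ℂ n

lemma mem_gradedPiece {I : Ideal (MvPolynomial (Fin 4) ℂ)} {n : ℕ}
    {g : MvPolynomial (Fin 4) ℂ} : g ∈ gradedPiece I n ↔ g ∈ I ∧ g.IsHomogeneous n :=
  Iff.rfl

instance finite_gradedPiece (I : Ideal (MvPolynomial (Fin 4) ℂ)) (n : ℕ) :
    Module.Finite ℂ (gradedPiece I n) :=
  Submodule.finiteDimensional_of_le
    (inf_le_right : gradedPiece I n ≤ homogeneousSubmodule (Fin 4) ℂ n)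

lemma homogeneousComponent_mem_sup {I : Ideal (MvPolynomial (Fin 4) ℂ)}
    (hI : ∀ g ∈ I, ∀ n, homogeneousComponent n g ∈ I) {d : ℕ} {g : MvPolynomial (Fin 4) ℂ}
    (hg : g.IsHomogeneous d) :
    ∀ x ∈ I ⊔ Ideal.span {g}, ∀ n, homogeneousComponent n x ∈ I ⊔ Ideal.span {g} := by
  intro x hx n
  obtain ⟨y, hy, z, hz, rfl⟩ := Submodule.mem_sup.1 hx
  obtain ⟨u, rfl⟩ := Ideal.mem_span_singleton'.1 hz
  rw [map_add]
  refine add_mem (Submodule.mem_sup_left (hI y hy n)) (Submodule.mem_sup_right ?_)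
  rcases le_or_gt d n with h | h
  · obtain ⟨m, rfl⟩ := Nat.exists_eq_add_of_le h
    rw [mul_comm, homogeneousComponent_mul_left hg]
    exact Ideal.mul_mem_right _ _ (Ideal.mem_span_singleton_self g)
  · rw [← sum_homogeneousComponent u, Finset.sum_mul, map_sum]
    refine sum_mem fun i _ => ?_
    rw [homogeneousComponent_of_mem
      ((homogeneousComponent_isHomogeneous i u).mul hg : (_ * g).IsHomogeneous (i + d)),
      if_neg (by omega)]
    exact zero_mem _

lemma finrank_gradedPiece_sup {I : Ideal (MvPolynomial (Fin 4) ℂ)}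
    (hI : ∀ g ∈ I, ∀ n, homogeneousComponent n g ∈ I) {d : ℕ} {g : MvPolynomial (Fin 4) ℂ}
    (hg : g.IsHomogeneous d) (hreg : ∀ u, u * g ∈ I → u ∈ I) (n : ℕ) :
    Module.finrank ℂ (gradedPiece (I ⊔ Ideal.span {g}) (n + d)) +
        Module.finrank ℂ (gradedPiece I n) =
      Module.finrank ℂ (gradedPiece I (n + d)) +
        Module.finrank ℂ (homogeneousSubmodule (Fin 4) ℂ n) := by
  let R := MvPolynomial (Fin 4) ℂ
  let μ : homogeneousSubmodule (Fin 4) ℂ n →ₗ[ℂ] R :=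
    (LinearMap.mulRight ℂ g).comp (homogeneousSubmodule (Fin 4) ℂ n).subtype
  let ψ : gradedPiece I (n + d) × homogeneousSubmodule (Fin 4) ℂ n →ₗ[ℂ] R :=
    (gradedPiece I (n + d)).subtype.coprod μ
  have hψ : ∀ x, ψ x = x.1 + x.2 * g := fun x => rfl
  have hrange : LinearMap.range ψ = gradedPiece (I ⊔ Ideal.span {g}) (n + d) := by
    ext y
    rw [mem_gradedPiece]
    constructor
    · rintro ⟨x, rfl⟩
      rw [hψ]
      refine ⟨add_mem (Submodule.mem_sup_left x.1.2.1)
        (Submodule.mem_sup_right (Ideal.mem_span_singleton'.2 ⟨_, rfl⟩)), ?_⟩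
      exact IsHomogeneous.add x.1.2.2 (IsHomogeneous.mul x.2.2 hg)
    · rintro ⟨hy, hyd⟩
      obtain ⟨z, hz, w, hw, rfl⟩ := Submodule.mem_sup.1 hy
      obtain ⟨u, rfl⟩ := Ideal.mem_span_singleton'.1 hw
      refine ⟨⟨⟨homogeneousComponent (n + d) z, hI z hz _,
        homogeneousComponent_isHomogeneous _ _⟩, ⟨homogeneousComponent n u,
        homogeneousComponent_isHomogeneous _ _⟩⟩, ?_⟩
      have := homogeneousComponent_of_mem (m := n + d) hyd
      rw [if_pos rfl, map_add, mul_comm, add_comm n d, homogeneousComponent_mul_left hg,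
        add_comm d n, mul_comm] at this
      rw [mul_comm u]
      exact this
  let θ : gradedPiece I n →ₗ[ℂ] gradedPiece I (n + d) × homogeneousSubmodule (Fin 4) ℂ n :=
    { toFun := fun u => (⟨-(u * g), neg_mem (I.mul_mem_right _ u.2.1),
          neg_mem (IsHomogeneous.mul u.2.2 hg)⟩, ⟨u, u.2.2⟩)
      map_add' := fun u v => by
        refine Prod.ext (Subtype.ext ?_) (Subtype.ext rfl)
        change -(((u : R) + v) * g) = -(u * g) + -(v * g)
        ring
      map_smul' := fun c u => by
        refine Prod.ext (Subtype.ext ?_) (Subtype.ext rfl)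
        change -((c • (u : R)) * g) = c • -((u : R) * g)
        rw [smul_mul_assoc, smul_neg] }
  have hθ : Function.Injective θ := fun u v huv => by
    have : (θ u).2 = (θ v).2 := by rw [huv]
    exact Subtype.ext (congrArg (fun z : homogeneousSubmodule (Fin 4) ℂ n => (z : R)) this)
  have hker : LinearMap.ker ψ = LinearMap.range θ := by
    ext x
    rw [LinearMap.mem_ker, hψ]
    constructor
    · intro hx
      have hx1 : (x.2 : R) * g = -(x.1 : R) := by linear_combination hx
      have hm : (x.2 : R) * g ∈ I := hx1 ▸ neg_mem x.1.2.1
      refine ⟨⟨x.2, hreg _ hm, x.2.2⟩, Prod.ext (Subtype.ext ?_) (Subtype.ext rfl)⟩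
      change -((x.2 : R) * g) = x.1
      rw [hx1, neg_neg]
    · rintro ⟨u, rfl⟩
      change -((u : R) * g) + u * g = 0
      ring
  have := LinearMap.finrank_range_add_finrank_ker ψ
  rw [hrange, hker, LinearMap.finrank_range_of_inj hθ, Module.finrank_prod] at this
  exact this

lemma finrank_gradedPiece_bot (n : ℕ) : Module.finrank ℂ (gradedPiece ⊥ n) = 0 := by
  have : gradedPiece ⊥ n = ⊥ := by
    refine eq_bot_iff.2 fun x hx => ?_
    exact (mem_gradedPiece.1 hx).1
  rw [this, finrank_bot]

lemma hilbert_count {s F₁ F₂ F₃ : ℕ → ℕ} (hs : ∀ n, 6 * s n = (n + 1) * (n + 2) * (n + 3))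
    (h₁ : ∀ n, F₁ (n + 2) = s n) (h₂ : ∀ n, F₂ (n + 6) + F₁ n = F₁ (n + 6) + s n)
    (h₃ : ∀ n, F₃ (n + 5) + F₂ n = F₂ (n + 5) + s n) {n : ℕ} (hn : 13 ≤ n) :
    F₃ n + 60 = s n := by
  obtain ⟨m, rfl⟩ := Nat.exists_eq_add_of_le' hn
  have a3 := h₃ (m + 8)
  have b1 := h₂ (m + 7)
  have b2 := h₂ (m + 2)
  have c1 := h₁ (m + 11)
  have c2 := h₁ (m + 6)
  have c3 := h₁ (m + 5)
  have c4 := h₁ m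
  have d1 := hs (m + 13)
  have d2 := hs (m + 11)
  have d3 := hs (m + 8)
  have d4 := hs (m + 7)
  have d5 := hs (m + 6)
  have d6 := hs (m + 5)
  have d7 := hs (m + 2)
  have d8 := hs m
  simp only [add_assoc, Nat.reduceAdd] at a3 b1 b2 c1 c2 c3 c4 d1 d2 d3 d4 d5 d6 d7 d8
  ring_nf at d1 d2 d3 d4 d5 d6 d7 d8
  ring_nf at a3 b1 b2 c1 c2 c3 c4 ⊢
  linarith

/-- The Hilbert function of a complete intersection of type `(2, 6, 5)` in large degree. -/
lemma finrank_gradedPiece_completeIntersection {q f g : MvPolynomial (Fin 4) ℂ}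
    (hq : q.IsHomogeneous 2) (hf : f.IsHomogeneous 6) (hg : g.IsHomogeneous 5) (hq0 : q ≠ 0)
    (hqf : ∀ u, u * f ∈ Ideal.span {q} → u ∈ Ideal.span {q})
    (hqfg : ∀ u, u * g ∈ Ideal.span {q, f} → u ∈ Ideal.span {q, f}) {n : ℕ} (hn : 13 ≤ n) :
    Module.finrank ℂ (gradedPiece (Ideal.span {q, f} ⊔ Ideal.span {g}) n) + 60 =
      Module.finrank ℂ (homogeneousSubmodule (Fin 4) ℂ n) := by
  have e1 : (⊥ : Ideal (MvPolynomial (Fin 4) ℂ)) ⊔ Ideal.span {q} = Ideal.span {q} := bot_sup_eq _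
  have e2 : Ideal.span {q} ⊔ Ideal.span {f} = Ideal.span {q, f} := (Ideal.span_insert _ _).symm
  have hb : ∀ g ∈ (⊥ : Ideal (MvPolynomial (Fin 4) ℂ)), ∀ n, homogeneousComponent n g ∈
      (⊥ : Ideal (MvPolynomial (Fin 4) ℂ)) := by
    intro g hg n
    rw [Ideal.mem_bot] at hg
    simp [hg]
  have h1 := homogeneousComponent_mem_sup hb hq
  rw [e1] at h1
  have h2 := homogeneousComponent_mem_sup h1 hf
  rw [e2] at h2
  have r1 := finrank_gradedPiece_sup hb hq fun u hu => by
    rw [Ideal.mem_bot] at hu ⊢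
    exact (mul_eq_zero.1 hu).resolve_right hq0
  have r2 := finrank_gradedPiece_sup h1 hf hqf
  have r3 := finrank_gradedPiece_sup h2 hg hqfg
  simp only [finrank_gradedPiece_bot] at r1
  rw [e2] at r2
  rw [e1] at r1
  exact hilbert_count (F₁ := fun n => Module.finrank ℂ (gradedPiece (Ideal.span {q}) n))
    (F₂ := fun n => Module.finrank ℂ (gradedPiece (Ideal.span {q, f}) n))
    (F₃ := fun n => Module.finrank ℂ (gradedPiece (Ideal.span {q, f} ⊔ Ideal.span {g}) n))
    (s := fun n => Module.finrank ℂ (homogeneousSubmodule (Fin 4) ℂ n))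
    finrank_homogeneousSubmodule (fun n => by simpa using r1 n) r2 r3 hn

/-- The exponents of the monomials of degree less than `k` in three variables. -/
def lowExponents (k : ℕ) : Finset (Fin 3 →₀ ℕ) :=
  (Finset.range k).biUnion fun n => (Finset.univ : Finset (Fin 3)).finsuppAntidiag n

lemma mem_lowExponents {k : ℕ} {d : Fin 3 →₀ ℕ} : d ∈ lowExponents k ↔ d.degree < k := by
  simp [lowExponents, Finset.mem_finsuppAntidiag, Finsupp.degree_eq_sum]

lemma card_lowExponents (k : ℕ) :
    (lowExponents k).card = ∑ n ∈ Finset.range k, (n + 2).choose 2 := by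
  rw [lowExponents, Finset.card_biUnion]
  · refine Finset.sum_congr rfl fun n _ => ?_
    rw [Finset.card_finsuppAntidiag_nat_eq_choose, Finset.card_univ, Fintype.card_fin,
      show 3 + n - 1 = n + 2 by omega, ← Nat.choose_symm_add]
  · intro a _ b _ hab
    refine Finset.disjoint_left.2 fun d hd hd' => hab ?_
    rw [Finset.mem_finsuppAntidiag] at hd hd'
    exact hd.1.symm.trans hd'.1

/-- The Taylor polynomial of order `k` at the origin, as a vector of coefficients. -/
def jet (k : ℕ) : MvPolynomial (Fin 3) ℂ →ₗ[ℂ] (lowExponents k → ℂ) :=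
  LinearMap.pi fun d => lcoeff ℂ (d : Fin 3 →₀ ℕ)

lemma jet_apply (k : ℕ) (g : MvPolynomial (Fin 3) ℂ) (d : lowExponents k) :
    jet k g d = coeff (d : Fin 3 →₀ ℕ) g := rfl

lemma jet_eq_zero_iff {k : ℕ} {g : MvPolynomial (Fin 3) ℂ} :
    jet k g = 0 ↔ g ∈ idealOfVars (Fin 3) ℂ ^ k := by
  rw [mem_pow_idealOfVars_iff']
  constructor
  · intro h d hd
    exact congrFun h ⟨d, mem_lowExponents.2 hd⟩
  · intro h
    ext d
    exact h d (mem_lowExponents.1 d.2)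

/-- The polynomial with prescribed coefficients in degrees less than `k`. -/
def ofJet (k : ℕ) : (lowExponents k → ℂ) →ₗ[ℂ] MvPolynomial (Fin 3) ℂ :=
  ∑ d : lowExponents k, (monomial (d : Fin 3 →₀ ℕ)).comp (LinearMap.proj d)

lemma jet_ofJet (k : ℕ) (c : lowExponents k → ℂ) : jet k (ofJet k c) = c := by
  ext d
  rw [jet_apply, ofJet, LinearMap.sum_apply, coeff_sum, Finset.sum_eq_single d]
  · simp
  · intro b _ hb
    have : (b : Fin 3 →₀ ℕ) ≠ d := fun h => hb (Subtype.ext h)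
    simp [coeff_monomial, this]
  · simp

lemma sub_ofJet_mem (k : ℕ) (g : MvPolynomial (Fin 3) ℂ) :
    g - ofJet k (jet k g) ∈ idealOfVars (Fin 3) ℂ ^ k := by
  rw [← jet_eq_zero_iff, map_sub, jet_ofJet, sub_self]

lemma jet_surjective (k : ℕ) : Function.Surjective (jet k) := fun c => ⟨_, jet_ofJet k c⟩

lemma exists_surjective_of_le_finrank {V : Type*} [AddCommGroup V] [Module ℂ V]
    [Module.Finite ℂ V] {r : ℕ} (hr : r ≤ Module.finrank ℂ V) :
    ∃ Λ : V →ₗ[ℂ] (Fin r → ℂ), Function.Surjective Λ :=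
  ⟨(LinearMap.funLeft ℂ ℂ (Fin.castLE hr)).comp (Module.finBasis ℂ V).equivFun.toLinearMap,
    (LinearMap.funLeft_surjective_of_injective ℂ ℂ _ (Fin.castLE_injective hr)).comp
      (Module.finBasis ℂ V).equivFun.surjective⟩

lemma mul_mem_pow_idealOfVars {a b k : ℕ} (hk : k ≤ a + b) {g h : MvPolynomial (Fin 3) ℂ}
    (hg : g ∈ idealOfVars (Fin 3) ℂ ^ a) (hh : h ∈ idealOfVars (Fin 3) ℂ ^ b) :
    g * h ∈ idealOfVars (Fin 3) ℂ ^ k :=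
  Ideal.pow_le_pow_right hk (pow_add (idealOfVars (Fin 3) ℂ) a b ▸ Ideal.mul_mem_mul hg hh)

lemma exists_local_conditions {q φ γ : MvPolynomial (Fin 3) ℂ}
    (hq : q ∈ idealOfVars (Fin 3) ℂ ^ 1) (hφ : φ ∈ idealOfVars (Fin 3) ℂ ^ 3)
    (hγ : γ ∈ idealOfVars (Fin 3) ℂ ^ 2) :
    ∃ Λ : MvPolynomial (Fin 3) ℂ →ₗ[ℂ] (Fin 6 → ℂ), Function.Surjective Λ ∧
      (∀ x ∈ idealOfVars (Fin 3) ℂ ^ 4, Λ x = 0) ∧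
      ∀ u, Λ (u * q) = 0 ∧ Λ (u * φ) = 0 ∧ Λ (u * γ) = 0 := by
  let Ψ : (lowExponents 3 → ℂ) × (lowExponents 1 → ℂ) × (lowExponents 2 → ℂ) →ₗ[ℂ]
      (lowExponents 4 → ℂ) :=
    (jet 4).comp (((LinearMap.mulRight ℂ q).comp (ofJet 3)).coprod
      (((LinearMap.mulRight ℂ φ).comp (ofJet 1)).coprod
        ((LinearMap.mulRight ℂ γ).comp (ofJet 2))))
  have hΨ : ∀ a b c, Ψ (a, b, c) = jet 4 (ofJet 3 a * q + (ofJet 1 b * φ + ofJet 2 c * γ)) :=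
    fun a b c => rfl
  have h1 : ∀ u, jet 4 (u * q) = Ψ (jet 3 u, 0, 0) := by
    intro u
    rw [hΨ, map_zero, map_zero, zero_mul, zero_mul, add_zero, add_zero, ← sub_eq_zero, ← map_sub,
      ← sub_mul, jet_eq_zero_iff]
    exact mul_mem_pow_idealOfVars le_rfl (sub_ofJet_mem 3 u) hq
  have h2 : ∀ u, jet 4 (u * φ) = Ψ (0, jet 1 u, 0) := by
    intro u
    rw [hΨ, map_zero, map_zero, zero_mul, zero_mul, zero_add, add_zero, ← sub_eq_zero, ← map_sub,
      ← sub_mul, jet_eq_zero_iff]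
    exact mul_mem_pow_idealOfVars le_rfl (sub_ofJet_mem 1 u) hφ
  have h3 : ∀ u, jet 4 (u * γ) = Ψ (0, 0, jet 2 u) := by
    intro u
    rw [hΨ, map_zero, map_zero, zero_mul, zero_mul, zero_add, zero_add, ← sub_eq_zero, ← map_sub,
      ← sub_mul, jet_eq_zero_iff]
    exact mul_mem_pow_idealOfVars le_rfl (sub_ofJet_mem 2 u) hγ
  have hker : 1 ≤ Module.finrank ℂ (LinearMap.ker Ψ) := by
    rw [Nat.one_le_iff_ne_zero, Ne, Submodule.finrank_eq_zero, ← Ne, Submodule.ne_bot_iff]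
    by_cases hq2 : jet 2 q = 0
    · refine ⟨(jet 3 (X 0 ^ 2), 0, 0), ?_, fun h => ?_⟩
      · rw [LinearMap.mem_ker, ← h1, jet_eq_zero_iff]
        refine mul_mem_pow_idealOfVars (a := 2) (b := 2) le_rfl ?_ (jet_eq_zero_iff.1 hq2)
        exact Ideal.pow_mem_pow (Ideal.subset_span (Set.mem_range_self (0 : Fin 3))) 2
      · have h0 : jet 3 (X 0 ^ 2 : MvPolynomial (Fin 3) ℂ) = 0 := congrArg Prod.fst h
        have := congrFun h0 ⟨Finsupp.single 0 2, mem_lowExponents.2 (by simp)⟩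
        rw [jet_apply, X_pow_eq_monomial, coeff_monomial, if_pos rfl] at this
        exact one_ne_zero this
    · refine ⟨(jet 3 γ, 0, -jet 2 q), ?_, fun h => ?_⟩
      · have : Ψ (jet 3 γ, 0, -jet 2 q) = Ψ (jet 3 γ, 0, 0) - Ψ (0, 0, jet 2 q) := by
          rw [← map_sub]
          simp
        rw [LinearMap.mem_ker, this, ← h1, ← h3, mul_comm, sub_self]
      · have h0 : -jet 2 q = 0 := congrArg (fun z => z.2.2) h
        exact hq2 (neg_eq_zero.1 h0)
  have hr := LinearMap.finrank_range_add_finrank_ker Ψ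
  have hQ := Submodule.finrank_quotient_add_finrank (LinearMap.range Ψ)
  simp only [Module.finrank_prod, Module.finrank_fintype_fun_eq_card, Fintype.card_coe,
    card_lowExponents, Finset.sum_range_succ, Finset.sum_range_zero] at hr hQ
  norm_num [Nat.choose] at hr hQ
  obtain ⟨Λ, hΛ⟩ := exists_surjective_of_le_finrank
    (V := (lowExponents 4 → ℂ) ⧸ LinearMap.range Ψ) (r := 6) (by omega)
  have hzero : ∀ y, Λ (Submodule.Quotient.mk (Ψ y)) = 0 := fun y => by
    rw [(Submodule.Quotient.mk_eq_zero (LinearMap.range Ψ) (x := Ψ y)).2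
      (LinearMap.mem_range_self Ψ y), map_zero]
  refine ⟨(Λ.comp (LinearMap.range Ψ).mkQ).comp (jet 4),
    (hΛ.comp (Submodule.mkQ_surjective _)).comp (jet_surjective 4), fun x hx => ?_, fun u => ?_⟩
  · rw [LinearMap.comp_apply, jet_eq_zero_iff.2 hx, map_zero]
  · simp only [LinearMap.comp_apply, h1, h2, h3, Submodule.mkQ_apply, hzero, and_self]

/-- Pullback along the affine map `y ↦ P + planePt U y`. -/
def affineMap (U : Fin 3 → Fin 4 → ℂ) (P : Fin 4 → ℂ) :
    MvPolynomial (Fin 4) ℂ →ₐ[ℂ] MvPolynomial (Fin 3) ℂ :=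
  aeval fun i => C (P i) + ∑ k, C (U k i) * X k

lemma eval_affineMap (U : Fin 3 → Fin 4 → ℂ) (P : Fin 4 → ℂ) (y : Fin 3 → ℂ)
    (g : MvPolynomial (Fin 4) ℂ) :
    eval y (affineMap U P g) = eval (P + planePt U y) g := by
  rw [affineMap]
  change aeval y (aeval _ g) = aeval (P + planePt U y) g
  rw [← AlgHom.comp_apply, comp_aeval]
  congr 2
  ext i
  simp [planePt, mul_comm]

lemma pderiv_affineMap (U : Fin 3 → Fin 4 → ℂ) (P : Fin 4 → ℂ) (k : Fin 3)
    (g : MvPolynomial (Fin 4) ℂ) :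
    pderiv k (affineMap U P g) = affineMap U P (dirDeriv (U k) g) := by
  rw [affineMap, derivation_aeval, dirDeriv_apply, map_sum]
  refine Finset.sum_congr rfl fun i _ => ?_
  have : pderiv k (C (P i) + ∑ j, C (U j i) * X j : MvPolynomial (Fin 3) ℂ) = C (U k i) := by
    rw [map_add, map_sum, Finset.sum_eq_single k]
    · simp
    · intro b _ hb; simp [pderiv_X_of_ne hb]
    · simp
  rw [this, map_smul, smul_eq_C_mul, mul_comm]

lemma MultAtLeast.affineMap_mem {g : MvPolynomial (Fin 4) ℂ} {P : Fin 4 → ℂ} {m : ℕ}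
    (h : MultAtLeast g P m) (U : Fin 3 → Fin 4 → ℂ) :
    affineMap U P g ∈ idealOfVars (Fin 3) ℂ ^ m := by
  induction m generalizing g with
  | zero => simp
  | succ m ih =>
    rw [mem_pow_idealOfVars_iff']
    intro d hd
    by_cases h0 : d = 0
    · rw [h0, ← constantCoeff_eq, ← eval_zero, eval_affineMap, planePt_zero, add_zero]
      exact multAtLeast_one.1 (h.mono (by omega))
    · obtain ⟨k, hk⟩ := Finsupp.ne_iff.1 h0
      have hk' : d k ≠ 0 := hk
      have hle : Finsupp.single k 1 ≤ d := by
        rw [Finsupp.single_le_iff]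
        omega
      have hdk := tsub_add_cancel_of_le hle
      have h1 := ih (h.dirDeriv (U k))
      rw [← pderiv_affineMap, mem_pow_idealOfVars_iff'] at h1
      have hdeg : (d - Finsupp.single k 1).degree + 1 = d.degree := by
        conv_rhs => rw [← hdk]
        rw [map_add, Finsupp.degree_single]
      have h2 := h1 (d - Finsupp.single k 1) (by omega)
      rw [coeff_pderiv, hdk] at h2
      refine (mul_eq_zero.1 h2).resolve_right ?_
      exact Nat.cast_add_one_ne_zero _

lemma affineMap_lin {a : Fin 4 → ℂ} {U : Fin 3 → Fin 4 → ℂ} (hU : IsPlaneBasis a U)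
    (P : Fin 4 → ℂ) : affineMap U P (lin a) = C (a ⬝ᵥ P) := by
  refine MvPolynomial.funext fun y => ?_
  rw [eval_affineMap, eval_lin, dotProduct_add, (hU.mem _).2 ⟨y, rfl⟩, add_zero, eval_C]

lemma affineMap_surjective {U : Fin 3 → Fin 4 → ℂ} (hU : LinearIndependent ℂ U)
    (P : Fin 4 → ℂ) : Function.Surjective (affineMap U P) := by
  rw [← AlgHom.range_eq_top, eq_top_iff, ← adjoin_range_X, Algebra.adjoin_le_iff]
  rintro _ ⟨k, rfl⟩
  obtain ⟨m, hm⟩ := exists_lin_extension hU (Pi.single k 1)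
  refine ⟨lin m - C (m ⬝ᵥ P), MvPolynomial.funext fun y => ?_⟩
  change eval y (affineMap U P _) = _
  rw [eval_affineMap, map_sub, eval_lin, eval_C, dotProduct_add, hm, add_sub_cancel_left]
  simp

/-- Points of the affine chart `a ⬝ᵥ x = 1` impose independent conditions, in each case of order
at most four, on forms of large degree. -/
lemma finrank_gradedPiece_add_le {ι : Type} [Fintype ι] {a : Fin 4 → ℂ}
    {U : Fin 3 → Fin 4 → ℂ} (hU : IsPlaneBasis a U) {z : ι → Fin 4 → ℂ} (hz : ∀ i, a ⬝ᵥ z i = 1)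
    (hinj : Function.Injective z) {r : ι → ℕ}
    {Λ : ∀ i, MvPolynomial (Fin 3) ℂ →ₗ[ℂ] (Fin (r i) → ℂ)}
    (hΛ : ∀ i, Function.Surjective (Λ i)) (hΛ4 : ∀ i, ∀ x ∈ idealOfVars (Fin 3) ℂ ^ 4, Λ i x = 0)
    {I : Ideal (MvPolynomial (Fin 4) ℂ)} (hI : ∀ i, ∀ x ∈ I, Λ i (affineMap U (z i) x) = 0) :
    ∃ n₀, ∀ n, n₀ ≤ n → Module.finrank ℂ (gradedPiece I n) + ∑ i, r i ≤
      Module.finrank ℂ (homogeneousSubmodule (Fin 4) ℂ n) := by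
  classical
  let R := MvPolynomial (Fin 4) ℂ
  let m : ι → Ideal R := fun i => (idealOfVars (Fin 3) ℂ).comap (affineMap U (z i))
  have hmem : ∀ i g, eval (z i) g = 0 → g ∈ m i := fun i g hg => by
    have := (multAtLeast_one.2 hg).affineMap_mem U
    rwa [pow_one] at this
  have hcop : Pairwise (Function.onFun IsCoprime fun i => m i ^ 4) := by
    intro i j hij
    refine IsCoprime.pow ((Ideal.isCoprime_iff_exists).2 ?_)
    have hne : z i ≠ z j := fun h => hij (hinj h)
    obtain ⟨w, hw⟩ : ∃ w : Fin 4 → ℂ, w ⬝ᵥ z i ≠ w ⬝ᵥ z j := by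
      obtain ⟨k, hk⟩ := Function.ne_iff.1 hne
      exact ⟨Pi.single k 1, by simpa using hk⟩
    have hw' : w ⬝ᵥ z j - w ⬝ᵥ z i ≠ 0 := sub_ne_zero.2 (Ne.symm hw)
    refine ⟨C (w ⬝ᵥ z j - w ⬝ᵥ z i)⁻¹ * (lin w - C (w ⬝ᵥ z i)), hmem i _ ?_,
      C (w ⬝ᵥ z j - w ⬝ᵥ z i)⁻¹ * (C (w ⬝ᵥ z j) - lin w), hmem j _ ?_, ?_⟩
    · simp [eval_lin]
    · simp [eval_lin]
    · rw [← mul_add, show lin w - C (w ⬝ᵥ z i) + (C (w ⬝ᵥ z j) - lin w) =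
        C (w ⬝ᵥ z j - w ⬝ᵥ z i) by rw [C_sub]; ring, ← C_mul, inv_mul_cancel₀ hw', C_1]
  let Φ : R →ₗ[ℂ] (∀ i, Fin (r i) → ℂ) :=
    LinearMap.pi fun i => (Λ i).comp (affineMap U (z i)).toLinearMap
  have hΦ : ∀ g i, Φ g i = Λ i (affineMap U (z i) g) := fun _ _ => rfl
  have hsurj : Function.Surjective Φ := by
    intro w
    choose t ht using fun i => hΛ i (w i)
    choose s hs using fun i => affineMap_surjective hU.indep (z i) (t i)
    obtain ⟨g, hg⟩ := Ideal.exists_forall_sub_mem_ideal hcop s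
    refine ⟨g, _root_.funext fun i => ?_⟩
    have h1 := hΛ4 i _ (Ideal.le_comap_pow (affineMap U (z i)) 4 (hg i))
    rw [map_sub, map_sub, hs, ht, sub_eq_zero] at h1
    exact h1
  have hlin : ∀ k g, Φ (lin a ^ k * g) = Φ g := by
    intro k g
    refine _root_.funext fun i => ?_
    rw [hΦ, hΦ, map_mul, map_pow, affineMap_lin hU, hz, C_1, one_pow, one_mul]
  let b := Module.finBasis ℂ (∀ i, Fin (r i) → ℂ)
  choose G hG using fun j => hsurj (b j)
  refine ⟨Finset.univ.sup fun j => (G j).totalDegree, fun n hn => ?_⟩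
  let Φn := Φ.comp (homogeneousSubmodule (Fin 4) ℂ n).subtype
  have htop : LinearMap.range Φn = ⊤ := by
    rw [eq_top_iff, ← b.span_eq, Submodule.span_le]
    rintro _ ⟨j, rfl⟩
    have hj : (G j).totalDegree ≤ n :=
      (Finset.le_sup (f := fun j => (G j).totalDegree) (Finset.mem_univ j)).trans hn
    refine ⟨⟨∑ d ∈ Finset.range ((G j).totalDegree + 1),
      lin a ^ (n - d) * homogeneousComponent d (G j), sum_mem fun d hd => ?_⟩, ?_⟩
    · have hd' : d ≤ n := by
        rw [Finset.mem_range] at hd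
        omega
      have := ((isHomogeneous_lin a).pow (n - d)).mul (homogeneousComponent_isHomogeneous d (G j))
      rwa [one_mul, Nat.sub_add_cancel hd'] at this
    · change Φ (∑ d ∈ Finset.range ((G j).totalDegree + 1),
        lin a ^ (n - d) * homogeneousComponent d (G j)) = b j
      rw [map_sum, Finset.sum_congr rfl fun d _ => hlin _ _, ← map_sum, sum_homogeneousComponent,
        hG]
  have hle : Module.finrank ℂ (gradedPiece I n) ≤ Module.finrank ℂ (LinearMap.ker Φn) := by
    let j : gradedPiece I n →ₗ[ℂ] LinearMap.ker Φn :=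
      LinearMap.codRestrict _ (Submodule.inclusion inf_le_right) fun x => by
        rw [LinearMap.mem_ker]
        exact _root_.funext fun i => hI i x x.2.1
    refine LinearMap.finrank_le_finrank_of_injective (f := j) fun x y hxy => ?_
    have : ((j x : homogeneousSubmodule (Fin 4) ℂ n) : R) =
        ((j y : homogeneousSubmodule (Fin 4) ℂ n) : R) := by
      rw [hxy]
    exact Subtype.ext this
  have := LinearMap.finrank_range_add_finrank_ker Φn
  rw [htop, finrank_top, Module.finrank_pi_fintype] at this
  simp only [Module.finrank_fintype_fun_eq_card, Fintype.card_fin] at this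
  omega

/-- Bézout's theorem: the derivative of `f` along a direction tangent at a nonsingular point of
the curve `Q = f = 0` is a zero divisor modulo `(Q, f)`. -/
lemma TenPoints.exists_dirDeriv_mul_mem {f : MvPolynomial (Fin 4) ℂ} {p : Fin 10 → Fin 4 → ℂ}
    (h : TenPoints f p) {Q : MvPolynomial (Fin 4) ℂ} (hQ : Q.IsHomogeneous 2) (hp : Prime Q)
    (hQf : ¬ Q ∣ f) (hQp : ∀ i, eval (p i) Q = 0) {R : Fin 4 → ℂ} (hRQ : eval R Q = 0)
    (hRf : eval R f = 0) (hR : ∃ v, eval R (dirDeriv v f) ≠ 0) {v : Fin 4 → ℂ}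
    (hv : eval R (dirDeriv v f) = 0) :
    ∃ u, u ∉ Ideal.span {Q, f} ∧ dirDeriv v f * u ∈ Ideal.span {Q, f} := by
  classical
  by_contra! hcon
  have hRs : ∀ i (c : ℂ), R ≠ c • p i := by
    rintro i c rfl
    obtain ⟨w, hw⟩ := hR
    rw [eval_smul_of_isHomogeneous (h.hom.dirDeriv w), h.sing_point, mul_zero] at hw
    exact hw rfl
  have hR0 : R ≠ 0 := fun h0 => hRs 0 0 (by rw [h0, zero_smul])
  let P : Option (Fin 10) → Fin 4 → ℂ := fun i => i.elim R p
  have hP0 : ∀ i, P i ≠ 0 := by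
    rintro (_ | i)
    exacts [hR0, h.ne_zero i]
  obtain ⟨a, ha⟩ : ∃ a, ∀ i, a ⬝ᵥ P i ≠ 0 := by
    have hne : ∏ i, lin (P i) ≠ 0 := Finset.prod_ne_zero_iff.2 fun i _ => lin_ne_zero (hP0 i)
    by_contra! hz
    refine hne (MvPolynomial.funext fun a => ?_)
    obtain ⟨i, hi⟩ := hz a
    rw [map_prod, map_zero]
    exact Finset.prod_eq_zero (Finset.mem_univ i) (by rw [eval_lin, dotProduct_comm, hi])
  have ha0 : a ≠ 0 := by
    rintro rfl
    exact ha none (zero_dotProduct _)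
  obtain ⟨U, hU⟩ := exists_isPlaneBasis ha0
  let z : Option (Fin 10) → Fin 4 → ℂ := fun i => (a ⬝ᵥ P i)⁻¹ • P i
  have hz : ∀ i, a ⬝ᵥ z i = 1 := fun i => by
    rw [dotProduct_smul, smul_eq_mul, inv_mul_cancel₀ (ha i)]
  have hPz : ∀ i, P i = (a ⬝ᵥ P i) • z i := fun i => by
    rw [smul_smul, mul_inv_cancel₀ (ha i), one_smul]
  have hinj : Function.Injective z := by
    intro i j hij
    have hPij : P i = ((a ⬝ᵥ P i) * (a ⬝ᵥ P j)⁻¹) • P j := by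
      rw [mul_smul, ← show z j = (a ⬝ᵥ P j)⁻¹ • P j from rfl, ← hij, ← hPz i]
    have hPji : P j = ((a ⬝ᵥ P j) * (a ⬝ᵥ P i)⁻¹) • P i := by
      rw [mul_smul, ← show z i = (a ⬝ᵥ P i)⁻¹ • P i from rfl, hij, ← hPz j]
    rcases i with _ | i <;> rcases j with _ | j
    · rfl
    · exact absurd hPij (hRs j _)
    · exact absurd hPji (hRs i _)
    · by_contra hne
      exact h.ne_smul i j (fun h => hne (congrArg some h)) _ hPij
  have hzm : ∀ (g : MvPolynomial (Fin 4) ℂ) d m i, g.IsHomogeneous d → MultAtLeast g (P i) m →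
      affineMap U (z i) g ∈ idealOfVars (Fin 3) ℂ ^ m := fun g d m i hg hm =>
    (hm.smul hg _).affineMap_mem U
  let r : Option (Fin 10) → ℕ := fun i => i.elim 1 fun _ => 6
  have hg5 : (dirDeriv v f).IsHomogeneous 5 := h.hom.dirDeriv v
  have hloc : ∀ i, ∃ Λ : MvPolynomial (Fin 3) ℂ →ₗ[ℂ] (Fin (r i) → ℂ), Function.Surjective Λ ∧
      (∀ x ∈ idealOfVars (Fin 3) ℂ ^ 4, Λ x = 0) ∧
      ∀ u, Λ (u * affineMap U (z i) Q) = 0 ∧ Λ (u * affineMap U (z i) f) = 0 ∧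
        Λ (u * affineMap U (z i) (dirDeriv v f)) = 0 := by
    rintro (_ | i)
    · refine ⟨LinearMap.pi fun _ => lcoeff ℂ 0, fun c => ⟨C (c (0 : Fin 1)), ?_⟩, fun x hx => ?_,
        fun u => ?_⟩
      · ext (j : Fin 1)
        rw [Subsingleton.elim j 0]
        exact coeff_zero_C _
      · ext j
        exact (mem_pow_idealOfVars_iff' _ _).1 hx 0 (by simp)
      · have key : ∀ (g : MvPolynomial (Fin 4) ℂ) d, g.IsHomogeneous d → eval R g = 0 →
            coeff 0 (u * affineMap U (z none) g) = 0 := fun g d hg hgR => by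
          have h1 := hzm g d 1 none hg (multAtLeast_one.2 hgR)
          have h2 := (mem_pow_idealOfVars_iff' _ _).1 h1 0 (by simp)
          rw [← constantCoeff_eq] at h2 ⊢
          rw [map_mul, h2, mul_zero]
        exact ⟨_root_.funext fun _ => key _ _ hQ hRQ, _root_.funext fun _ => key _ _ h.hom hRf,
          _root_.funext fun _ => key _ _ hg5 hv⟩
    · exact exists_local_conditions (hzm Q 2 1 (some i) hQ (multAtLeast_one.2 (hQp i)))
        (hzm f 6 3 (some i) h.hom (h.mult i)) (hzm _ 5 2 (some i) hg5 ((h.mult i).dirDeriv v))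
  choose Λ hΛ hΛ4 hΛI using hloc
  obtain ⟨n₀, hn₀⟩ := finrank_gradedPiece_add_le hU hz hinj hΛ hΛ4
    (I := Ideal.span {Q, f} ⊔ Ideal.span {dirDeriv v f}) (by
      intro i x hx
      obtain ⟨y, hy, w, hw, rfl⟩ := Submodule.mem_sup.1 hx
      obtain ⟨c, d, rfl⟩ := Ideal.mem_span_pair.1 hy
      obtain ⟨e, rfl⟩ := Ideal.mem_span_singleton'.1 hw
      simp only [map_add, map_mul, (hΛI i _).1, (hΛI i _).2.1, (hΛI i _).2.2, add_zero])
  have hsum : ∑ i, r i = 61 := by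
    rw [Fintype.sum_option]
    simp [r]
  have h1 := hn₀ (n₀ + 13) (by omega)
  have h2 := finrank_gradedPiece_completeIntersection hQ h.hom hg5 hp.ne_zero
    (fun u hu => by
      rw [Ideal.mem_span_singleton] at hu ⊢
      exact (hp.dvd_or_dvd hu).resolve_right hQf)
    (fun u hu => by
      by_contra hu'
      exact hcon u hu' (by rwa [mul_comm])) (show 13 ≤ n₀ + 13 by omega)
  omega

lemma exists_line_in_two_planes (a b : Fin 4 → ℂ) : ∃ D E, LinearIndependent ℂ ![D, E] ∧
    a ⬝ᵥ D = 0 ∧ b ⬝ᵥ D = 0 ∧ a ⬝ᵥ E = 0 ∧ b ⬝ᵥ E = 0 := by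
  obtain ⟨D, hD, haD, hbD, -⟩ := exists_lin_three a b 0
  obtain ⟨w, hw⟩ := exists_dotProduct_ne_zero hD
  obtain ⟨E, hE, haE, hbE, hwE⟩ := exists_lin_three a b w
  rw [dotProduct_comm] at haD hbD haE hbE hwE hw
  refine ⟨D, E, ?_, haD, hbD, haE, hbE⟩
  rw [LinearIndependent.pair_iff]
  intro s t hst
  have := congrArg (fun v => w ⬝ᵥ v) hst
  have hs : s = 0 := by simpa [dotProduct_add, hwE, hw] using this
  exact ⟨hs, by simpa [hs, hE] using hst⟩

namespace IsTritangentPlane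

variable {f Q : MvPolynomial (Fin 4) ℂ} {p : Fin 10 → Fin 4 → ℂ} {a b : Fin 4 → ℂ} {c c' : ℂ}

lemma dirDeriv_eq_zero (H : IsTritangentPlane f Q p a c) (h : TenPoints f p) {x v : Fin 4 → ℂ}
    (hx : a ⬝ᵥ x = 0) (hQx : eval x Q = 0) (hv : a ⬝ᵥ v = 0) : eval x (dirDeriv v f) = 0 := by
  obtain ⟨U, hU⟩ := exists_isPlaneBasis H.ne_zero
  refine h.dirDeriv_eq_zero_of_cube hU H.coeff_ne_zero (E := planeMap U Q) ?_ ?_ hx hv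
  · refine MvPolynomial.funext fun y => ?_
    rw [map_mul, map_pow, eval_C, eval_planeMap, eval_planeMap,
      H.eval_eq _ ((hU.mem _).2 ⟨y, rfl⟩)]
  · rw [H.eval_eq x hx, hQx]
    ring

lemma coeff_eq (H : IsTritangentPlane f Q p a c) (H' : IsTritangentPlane f Q p b c')
    (h : TenPoints f p) : c = c' := by
  obtain ⟨D, E, hDE, haD, hbD, haE, hbE⟩ := exists_line_in_two_planes a b
  by_contra hc
  refine h.false_of_line H.ne_zero hDE fun v hv s t => ?_
  have ha : a ⬝ᵥ (s • D + t • E) = 0 := by simp [dotProduct_add, haD, haE]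
  have hb : b ⬝ᵥ (s • D + t • E) = 0 := by simp [dotProduct_add, hbD, hbE]
  refine H.dirDeriv_eq_zero h ha ?_ hv
  have h1 := (H.eval_eq _ ha).symm.trans (H'.eval_eq _ hb)
  have h2 : (c - c') * eval (s • D + t • E) Q ^ 3 = 0 := by linear_combination h1
  exact pow_eq_zero_iff (by norm_num) |>.1 ((mul_eq_zero.1 h2).resolve_left (sub_ne_zero.2 hc))

end IsTritangentPlane

namespace TenPoints

variable {f Q : MvPolynomial (Fin 4) ℂ} {p : Fin 10 → Fin 4 → ℂ}

lemma not_dvd (h : TenPoints f p) (hQ : Q.IsHomogeneous 2) (hp : Prime Q) : ¬ Q ∣ f := by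
  intro hdvd
  obtain ⟨g, hg, hfg⟩ := exists_homogeneous_quotient (d := 4) hQ h.hom hdvd
  by_cases hQg : Q ∣ g
  · obtain ⟨g', rfl⟩ := hQg
    obtain ⟨R, -, hRQ, -, v, hv⟩ := h.exists_nonsingular hQ hp one_ne_zero (isHomogeneous_X ℂ 0)
      (not_dvd_of_degree_lt hQ (isHomogeneous_X ℂ 0) one_lt_two (X_ne_zero 0))
    refine hv ?_
    rw [hfg, Derivation.leibniz, Derivation.leibniz]
    simp [hRQ]
  · obtain ⟨R, -, hRQ, hRg, v, hv⟩ := h.exists_nonsingular hQ hp four_ne_zero hg hQg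
    refine hv ?_
    rw [hfg, Derivation.leibniz]
    simp [hRQ, hRg]

/-- The tangent plane at a nonsingular point of the curve `Q = f = 0` is a tritangent plane. -/
lemma exists_isTritangentPlane (h : TenPoints f p) (hQ : Q.IsHomogeneous 2) (hp : Prime Q)
    (hQp : ∀ i, eval (p i) Q = 0) {R : Fin 4 → ℂ} (hRQ : eval R Q = 0) (hRf : eval R f = 0)
    (hR : ∃ v, eval R (dirDeriv v f) ≠ 0) :
    ∃ a c, a ⬝ᵥ R = 0 ∧ IsTritangentPlane f Q p a c := by
  let a : Fin 4 → ℂ := fun i => eval R (pderiv i f)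
  have ha : ∀ v, a ⬝ᵥ v = eval R (dirDeriv v f) := fun v => by
    rw [eval_dirDeriv]
    exact Finset.sum_congr rfl fun i _ => mul_comm _ _
  have ha0 : a ≠ 0 := by
    intro h0
    obtain ⟨v, hv⟩ := hR
    rw [← ha, h0, zero_dotProduct] at hv
    exact hv rfl
  have hQf := h.not_dvd hQ hp
  obtain ⟨J, hJ⟩ := h.exists_contactIdeal hQ hp hQf ha0 fun v hv =>
    h.exists_dirDeriv_mul_mem hQ hp hQf hQp hRQ hRf hR (ha v ▸ hv)
  obtain ⟨c, hc⟩ := hJ.isTritangentPlane h hQ hp hQf hQp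
  exact ⟨a, c, by rw [ha, euler_eval h.hom, hRf, mul_zero], hc⟩

lemma exists_eq_add_prod_mul (h : TenPoints f p) (hQ : Q.IsHomogeneous 2) (hp : Prime Q)
    (hQp : ∀ i, eval (p i) Q = 0) : ∃ c, ∀ k ≤ 6, ∃ (l : Fin k → Fin 4 → ℂ)
      (G : MvPolynomial (Fin 4) ℂ), G.IsHomogeneous (6 - k) ∧
      (∀ i, IsTritangentPlane f Q p (l i) c) ∧ (∀ i j, i ≠ j → ∀ s : ℂ, l i ≠ s • l j) ∧
      f = C c * Q ^ 3 + (∏ i, lin (l i)) * G := by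
  have hQf := h.not_dvd hQ hp
  obtain ⟨R, -, hRQ, hRf, hR⟩ := h.exists_nonsingular hQ hp (by norm_num) h.hom hQf
  obtain ⟨a₀, c, -, ha₀⟩ := h.exists_isTritangentPlane hQ hp hQp hRQ hRf hR
  refine ⟨c, fun k => ?_⟩
  induction k with
  | zero =>
    intro _
    refine ⟨![], f - C c * Q ^ 3, ?_, fun i => i.elim0, fun i => i.elim0, by simp⟩
    have := (isHomogeneous_C (Fin 4) c).mul (hQ.pow 3)
    exact h.hom.sub this
  | succ k ih =>
    intro hk
    obtain ⟨l, G, hG, hl, hne, hf⟩ := ih (by omega)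
    have hQG : ¬ Q ∣ G := fun hdvd => hQf <| by
      rw [hf]
      exact dvd_add (Dvd.intro_left (C c * Q ^ 2) (by ring)) (dvd_mul_of_dvd_right hdvd _)
    obtain ⟨R, -, hRQ, hRG, hR⟩ := h.exists_nonsingular hQ hp (by omega) hG hQG
    have hRf : eval R f = 0 := by
      rw [hf]
      simp [hRQ, hRG]
    obtain ⟨a, c', haR, ha⟩ := h.exists_isTritangentPlane hQ hp hQp hRQ hRf hR
    obtain rfl := ha₀.coeff_eq ha h
    have hlR : ∀ i, l i ⬝ᵥ R ≠ 0 := by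
      intro i hi
      obtain ⟨v, hv⟩ := hR
      have hprod : eval R (∏ i, lin (l i)) = 0 := by
        rw [map_prod]
        exact Finset.prod_eq_zero (Finset.mem_univ i) (by rw [eval_lin, hi])
      refine hv ?_
      rw [hf, map_add, Derivation.leibniz, Derivation.leibniz, Derivation.leibniz_pow]
      simp [hRQ, hRG, hprod]
    have hdvd : lin a ∣ (∏ i, lin (l i)) * G := by
      refine lin_dvd ha.ne_zero fun x hx => ?_
      have h1 := ha.eval_eq x hx
      rw [hf] at h1
      simpa using h1
    have hpa := prime_lin ha.ne_zero
    have hdG : lin a ∣ G := by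
      refine (hpa.dvd_or_dvd hdvd).resolve_left fun hd => ?_
      obtain ⟨i, -, hi⟩ := hpa.exists_mem_finset_dvd hd
      obtain ⟨u, hu⟩ := hi
      refine hlR i ?_
      rw [← eval_lin, hu, map_mul, eval_lin, haR, zero_mul]
    obtain ⟨G', hG', rfl⟩ := exists_homogeneous_quotient (d := 6 - (k + 1)) (isHomogeneous_lin a)
      (by rwa [show 1 + (6 - (k + 1)) = 6 - k by omega]) hdG
    refine ⟨Fin.cons a l, G', hG', ?_, ?_, ?_⟩
    · intro i
      refine Fin.cases ha hl i
    · intro i j hij s hs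
      have has : ∀ i (s : ℂ), l i ≠ s • a := fun i s hs =>
        hlR i (by rw [hs, smul_dotProduct, haR, smul_zero])
      induction i using Fin.cases with
      | zero =>
        induction j using Fin.cases with
        | zero => exact hij rfl
        | succ j =>
          rw [Fin.cons_zero, Fin.cons_succ] at hs
          have hs0 : s ≠ 0 := fun h0 => ha.ne_zero (by rw [hs, h0, zero_smul])
          exact has j s⁻¹ (by rw [hs, smul_smul, inv_mul_cancel₀ hs0, one_smul])
      | succ i =>
        induction j using Fin.cases with
        | zero => exact has i s hs
        | succ j => exact hne i j (fun h => hij (congrArg Fin.succ h)) s hs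
    · rw [Fin.prod_univ_succ]
      simp only [Fin.cons_zero, Fin.cons_succ]
      rw [hf]
      ring

/-- A sextic whose ten triple points lie on an irreducible quadric `Q` is a combination of `Q ^ 3`
and a product of six linear forms. -/
lemma exists_eq_add_prod (h : TenPoints f p) (hQ : Q.IsHomogeneous 2) (hp : Prime Q)
    (hQp : ∀ i, eval (p i) Q = 0) : ∃ (c κ : ℂ) (l : Fin 6 → Fin 4 → ℂ), κ ≠ 0 ∧
      (∀ i, IsTritangentPlane f Q p (l i) c) ∧ (∀ i j, i ≠ j → ∀ s : ℂ, l i ≠ s • l j) ∧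
      f = C c * Q ^ 3 + C κ * ∏ i, lin (l i) := by
  obtain ⟨c, hc⟩ := h.exists_eq_add_prod_mul hQ hp hQp
  obtain ⟨l, G, hG, hl, hne, hf⟩ := hc 6 le_rfl
  obtain ⟨κ, rfl⟩ : ∃ κ, G = C κ := ⟨coeff 0 G, totalDegree_eq_zero_iff_eq_C.1
    (Nat.le_zero.1 hG.totalDegree_le)⟩
  refine ⟨c, κ, l, ?_, hl, hne, by rw [hf, mul_comm (C κ)]⟩
  rintro rfl
  refine h.not_dvd hQ hp ?_
  rw [hf, C_0, mul_zero, add_zero]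
  exact Dvd.intro_left (C c * Q ^ 2) (by ring)

end TenPoints

/-- The three-element subsets of `Fin 6`, in lexicographic order. -/
def triple : Fin 20 → Finset (Fin 6) :=
  ![{0, 1, 2}, {0, 1, 3}, {0, 1, 4}, {0, 1, 5}, {0, 2, 3}, {0, 2, 4}, {0, 2, 5}, {0, 3, 4},
    {0, 3, 5}, {0, 4, 5}, {1, 2, 3}, {1, 2, 4}, {1, 2, 5}, {1, 3, 4}, {1, 3, 5}, {1, 4, 5},
    {2, 3, 4}, {2, 3, 5}, {2, 4, 5}, {3, 4, 5}]

/-- The blocks of a `2`-`(6, 3, 2)` design. -/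
def designBlocks : Finset (Finset (Fin 6)) :=
  {{0, 1, 3}, {0, 1, 5}, {0, 2, 3}, {0, 2, 4}, {0, 4, 5}, {1, 2, 4}, {1, 2, 5}, {1, 3, 4},
    {2, 3, 5}, {3, 4, 5}}

/-- Ten blocks of size three on six points, any two points lying on two blocks. -/
structure IsDesign (B : Fin 10 → Finset (Fin 6)) : Prop where
  card_block : ∀ i, (B i).card = 3
  card_pair : ∀ a b, a ≠ b → (Finset.univ.filter fun i => a ∈ B i ∧ b ∈ B i).card = 2

namespace IsDesign

variable {B : Fin 10 → Finset (Fin 6)}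

lemma exists_triple_count (hB : IsDesign B) : ∃ N : Fin 20 → ℕ,
    (∀ k, 1 ≤ N k → ∃ i, B i = triple k) ∧ (∀ i k, B i = triple k → 1 ≤ N k) ∧
    ∀ a b, a ≠ b → ∑ k ∈ Finset.univ.filter (fun k => a ∈ triple k ∧ b ∈ triple k), N k = 2 := by
  have ht : ∀ T : Finset (Fin 6), T.card = 3 → ∃ k, T = triple k := by decide
  refine ⟨fun k => (Finset.univ.filter fun i => B i = triple k).card, fun k hk => ?_,
    fun i k hi => ?_, fun a b hab => ?_⟩
  · obtain ⟨i, hi⟩ := Finset.card_pos.1 hk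
    exact ⟨i, (Finset.mem_filter.1 hi).2⟩
  · exact Finset.card_pos.2 ⟨i, Finset.mem_filter.2 ⟨Finset.mem_univ i, hi⟩⟩
  · choose t ht using fun i => ht (B i) (hB.card_block i)
    have hinj : Function.Injective triple := by decide
    rw [← hB.card_pair a b hab, Finset.card_eq_sum_card_fiberwise (f := t)
      (t := Finset.univ.filter fun k => a ∈ triple k ∧ b ∈ triple k)]
    · refine Finset.sum_congr rfl fun k hk => congrArg Finset.card ?_
      ext i
      simp only [Finset.mem_filter, Finset.mem_univ, true_and] at hk ⊢
      constructor
      · intro h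
        exact ⟨h ▸ hk, hinj ((ht i).symm.trans h)⟩
      · rintro ⟨-, rfl⟩
        exact ht i
    · intro i hi
      simp only [Finset.coe_filter, Set.mem_ofPred_eq, Finset.mem_univ, true_and] at hi ⊢
      rwa [ht i] at hi

lemma exists_triple_count_equations (hB : IsDesign B) : ∃ N : Fin 20 → ℕ,
    (∀ k, 1 ≤ N k → ∃ i, B i = triple k) ∧ (∀ i k, B i = triple k → 1 ≤ N k) ∧
    N 0 + N 1 + N 2 + N 3 = 2 ∧ N 0 + N 4 + N 5 + N 6 = 2 ∧ N 1 + N 4 + N 7 + N 8 = 2 ∧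
    N 2 + N 5 + N 7 + N 9 = 2 ∧ N 3 + N 6 + N 8 + N 9 = 2 ∧ N 0 + N 10 + N 11 + N 12 = 2 ∧
    N 1 + N 10 + N 13 + N 14 = 2 ∧ N 2 + N 11 + N 13 + N 15 = 2 ∧
    N 3 + N 12 + N 14 + N 15 = 2 ∧ N 4 + N 10 + N 16 + N 17 = 2 ∧
    N 5 + N 11 + N 16 + N 18 = 2 ∧ N 6 + N 12 + N 17 + N 18 = 2 ∧
    N 7 + N 13 + N 16 + N 19 = 2 ∧ N 8 + N 14 + N 17 + N 19 = 2 ∧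
    N 9 + N 15 + N 18 + N 19 = 2 := by
  obtain ⟨N, h₁, h₂, h⟩ := hB.exists_triple_count
  have key : ∀ (a b : Fin 6) (w x y z : Fin 20), a ≠ b →
      (Finset.univ.filter fun k => a ∈ triple k ∧ b ∈ triple k) = {w, x, y, z} →
      w ∉ ({x, y, z} : Finset (Fin 20)) → x ∉ ({y, z} : Finset (Fin 20)) →
      y ∉ ({z} : Finset (Fin 20)) → N w + N x + N y + N z = 2 := by
    intro a b w x y z hab hS hw hx hy
    rw [← h a b hab, hS, Finset.sum_insert hw, Finset.sum_insert hx, Finset.sum_insert hy,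
      Finset.sum_singleton]
    ring
  refine ⟨N, h₁, h₂, ?_, ?_, ?_, ?_, ?_, ?_, ?_, ?_, ?_, ?_, ?_, ?_, ?_, ?_, ?_⟩
  · apply key 0 1 <;> decide
  · apply key 0 2 <;> decide
  · apply key 0 3 <;> decide
  · apply key 0 4 <;> decide
  · apply key 0 5 <;> decide
  · apply key 1 2 <;> decide
  · apply key 1 3 <;> decide
  · apply key 1 4 <;> decide
  · apply key 1 5 <;> decide
  · apply key 2 3 <;> decide
  · apply key 2 4 <;> decide
  · apply key 2 5 <;> decide
  · apply key 3 4 <;> decide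
  · apply key 3 5 <;> decide
  · apply key 4 5 <;> decide

/-- The equations satisfied by the multiplicities of the triples in a `2`-`(6, 3, 2)` design;
complementary triples (`k` and `19 - k`) have multiplicities adding up to one. -/
lemma exists_triple_count_complement (hB : IsDesign B) : ∃ N : Fin 20 → ℕ,
    (∀ k, 1 ≤ N k → ∃ i, B i = triple k) ∧ (∀ i k, B i = triple k → 1 ≤ N k) ∧
    (N 0 + N 19 = 1 ∧ N 1 + N 18 = 1 ∧ N 2 + N 17 = 1 ∧ N 3 + N 16 = 1 ∧ N 4 + N 15 = 1 ∧
    N 5 + N 14 = 1 ∧ N 6 + N 13 = 1 ∧ N 7 + N 12 = 1 ∧ N 8 + N 11 = 1 ∧ N 9 + N 10 = 1) ∧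
    N 0 + N 1 + N 2 + N 3 = 2 ∧ N 0 + N 4 + N 5 + N 6 = 2 ∧ N 1 + N 4 + N 7 + N 8 = 2 ∧
    N 2 + N 5 + N 7 + N 9 = 2 ∧ N 3 + N 6 + N 8 + N 9 = 2 := by
  obtain ⟨N, h₁, h₂, e⟩ := hB.exists_triple_count_equations
  refine ⟨N, h₁, h₂, ?_, ?_⟩
  · clear h₁ h₂
    obtain ⟨e1, e2, e3, e4, e5, e6, e7, e8, e9, e10, e11, e12, e13, e14, e15⟩ := e
    refine ⟨?_, ?_, ?_, ?_, ?_, ?_, ?_, ?_, ?_, ?_⟩ <;> linarith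
  · exact ⟨e.1, e.2.1, e.2.2.1, e.2.2.2.1, e.2.2.2.2.1⟩

lemma exists_eq_of_mem_designBlocks (hB : IsDesign B) (h₁ : ∃ i, B i = {0, 1, 5})
    (h₂ : ∃ i, B i = {0, 4, 5}) (h₃ : ∃ i, B i = {1, 2, 5}) :
    ∀ T ∈ designBlocks, ∃ i, B i = T := by
  obtain ⟨N, hN, hN', c, e⟩ := hB.exists_triple_count_complement
  obtain ⟨i₁, h₁⟩ := h₁
  obtain ⟨i₂, h₂⟩ := h₂
  obtain ⟨i₃, h₃⟩ := h₃
  have g₁ := hN' i₁ 3 h₁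
  have g₂ := hN' i₂ 9 h₂
  have g₃ := hN' i₃ 12 h₃
  intro T hT
  simp only [designBlocks, Finset.mem_insert, Finset.mem_singleton] at hT
  rcases hT with rfl | rfl | rfl | rfl | rfl | rfl | rfl | rfl | rfl | rfl
  · exact hN 1 (by omega)
  · exact hN 3 (by omega)
  · exact hN 4 (by omega)
  · exact hN 5 (by omega)
  · exact hN 9 (by omega)
  · exact hN 11 (by omega)
  · exact hN 12 (by omega)
  · exact hN 13 (by omega)
  · exact hN 17 (by omega)
  · exact hN 19 (by omega)

lemma exists_labelling (hB : IsDesign B) : ∃ σ : Fin 6 → Fin 6, Function.Injective σ ∧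
    (∃ i, B i = {σ 0, σ 1, σ 5}) ∧ (∃ i, B i = {σ 0, σ 4, σ 5}) ∧
    (∃ i, B i = {σ 1, σ 2, σ 5}) := by
  obtain ⟨N, hN, -, c, e⟩ := hB.exists_triple_count_complement
  have key : ∀ (σ : Fin 6 → Fin 6) (x y z : Fin 20), Function.Injective σ →
      triple x = {σ 0, σ 1, σ 5} → triple y = {σ 0, σ 4, σ 5} → triple z = {σ 1, σ 2, σ 5} →
      1 ≤ N x → 1 ≤ N y → ¬ 1 ≤ N z ∨ ∃ σ : Fin 6 → Fin 6, Function.Injective σ ∧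
      (∃ i, B i = {σ 0, σ 1, σ 5}) ∧ (∃ i, B i = {σ 0, σ 4, σ 5}) ∧
      (∃ i, B i = {σ 1, σ 2, σ 5}) := by
    intro σ x y z hσ hx hy hz hNx hNy
    by_cases hNz : 1 ≤ N z
    · exact Or.inr ⟨σ, hσ, hx ▸ hN x hNx, hy ▸ hN y hNy, hz ▸ hN z hNz⟩
    · exact Or.inl hNz
  by_contra hcon
  have k : ∀ (σ : Fin 6 → Fin 6) (x y z : Fin 20), Function.Injective σ →
      triple x = {σ 0, σ 1, σ 5} → triple y = {σ 0, σ 4, σ 5} → triple z = {σ 1, σ 2, σ 5} →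
      1 ≤ N x → 1 ≤ N y → ¬ 1 ≤ N z := fun σ x y z hσ hx hy hz hNx hNy =>
    (key σ x y z hσ hx hy hz hNx hNy).resolve_right hcon
  have k1 := k ![0, 1, 3, 4, 2, 5] 3 6 14 (by decide) (by decide) (by decide) (by decide)
  have k2 := k ![0, 1, 4, 3, 2, 5] 3 6 15 (by decide) (by decide) (by decide) (by decide)
  have k3 := k ![0, 1, 2, 4, 3, 5] 3 8 12 (by decide) (by decide) (by decide) (by decide)
  have k4 := k ![0, 1, 4, 2, 3, 5] 3 8 15 (by decide) (by decide) (by decide) (by decide)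
  have k5 := k ![0, 1, 2, 3, 4, 5] 3 9 12 (by decide) (by decide) (by decide) (by decide)
  have k6 := k ![0, 1, 3, 2, 4, 5] 3 9 14 (by decide) (by decide) (by decide) (by decide)
  have k7 := k ![0, 2, 1, 4, 3, 5] 6 8 12 (by decide) (by decide) (by decide) (by decide)
  have k8 := k ![0, 2, 4, 1, 3, 5] 6 8 18 (by decide) (by decide) (by decide) (by decide)
  have k9 := k ![0, 2, 1, 3, 4, 5] 6 9 12 (by decide) (by decide) (by decide) (by decide)
  have k10 := k ![0, 2, 3, 1, 4, 5] 6 9 17 (by decide) (by decide) (by decide) (by decide)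
  have k11 := k ![0, 3, 1, 2, 4, 5] 8 9 14 (by decide) (by decide) (by decide) (by decide)
  have k12 := k ![0, 3, 2, 1, 4, 5] 8 9 17 (by decide) (by decide) (by decide) (by decide)
  clear k key hcon hN
  have s3 : N 3 = 0 ∨ 1 ≤ N 3 := by omega
  have s6 : N 6 = 0 ∨ 1 ≤ N 6 := by omega
  have s8 : N 8 = 0 ∨ 1 ≤ N 8 := by omega
  have s9 : N 9 = 0 ∨ 1 ≤ N 9 := by omega
  rcases s3 with s3 | s3 <;> rcases s6 with s6 | s6 <;> rcases s8 with s8 | s8 <;>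
    rcases s9 with s9 | s9 <;>
    simp only [s3, s6, s8, s9, forall_true_left] at k1 k2 k3 k4 k5 k6 k7 k8 k9 k10 k11 k12 <;>
    omega

lemma comp_injective (hB : IsDesign B) {σ : Fin 6 → Fin 6} (hσ : Function.Injective σ) :
    IsDesign fun i => Finset.univ.filter fun a => σ a ∈ B i := by
  have hsurj := Finite.surjective_of_injective hσ
  refine ⟨fun i => ?_, fun a b hab => ?_⟩
  · rw [← hB.card_block i, ← Finset.card_image_of_injective _ hσ]
    congr 1
    ext b
    obtain ⟨a, rfl⟩ := hsurj b
    simp only [Finset.mem_image, Finset.mem_filter, Finset.mem_univ, true_and]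
    exact ⟨fun ⟨a', h, h'⟩ => h' ▸ h, fun h => ⟨a, h, rfl⟩⟩
  · rw [← hB.card_pair (σ a) (σ b) (hσ.ne hab)]
    simp

/-- Uniqueness of the `2`-`(6, 3, 2)` design. -/
lemma exists_injective_mem_iff (hB : IsDesign B) : ∃ σ : Fin 6 → Fin 6, Function.Injective σ ∧
    ∀ T ∈ designBlocks, ∃ i, ∀ a, σ a ∈ B i ↔ a ∈ T := by
  obtain ⟨σ, hσ, ⟨i, hi⟩, ⟨j, hj⟩, ⟨k, hk⟩⟩ := hB.exists_labelling
  refine ⟨σ, hσ, fun T hT => ?_⟩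
  obtain ⟨i, hi⟩ := (hB.comp_injective hσ).exists_eq_of_mem_designBlocks
    ⟨i, by ext a; simp [hi, hσ.eq_iff]⟩ ⟨j, by ext a; simp [hj, hσ.eq_iff]⟩
    ⟨k, by ext a; simp [hk, hσ.eq_iff]⟩ T hT
  refine ⟨i, fun a => ?_⟩
  rw [← hi]
  simp

end IsDesign

/-- A numerical criterion for being a `2`-`(6, 3, 2)` design. -/
lemma IsDesign.of_le {B : Fin 10 → Finset (Fin 6)} (h₁ : ∀ i, 3 ≤ (B i).card)
    (h₂ : ∀ a, (Finset.univ.filter fun i => a ∈ B i).card ≤ 5)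
    (h₃ : ∀ a b, a ≠ b → (Finset.univ.filter fun i => a ∈ B i ∧ b ∈ B i).card ≤ 2) :
    IsDesign B := by
  have hsum : ∑ i, (B i).card = ∑ a, (Finset.univ.filter fun i => a ∈ B i).card := by
    simp_rw [Finset.card_filter]
    rw [Finset.sum_comm]
    exact Finset.sum_congr rfl fun i _ => by rw [← Finset.card_filter]; simp
  have hle : ∑ i, (B i).card ≤ ∑ _i : Fin 10, 3 := by
    rw [hsum]
    exact (Finset.sum_le_sum fun a _ => h₂ a).trans (by simp)
  have hcard : ∀ i, (B i).card = 3 := fun i =>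
    ((Finset.sum_eq_sum_iff_of_le fun i _ => h₁ i).1
      (le_antisymm (Finset.sum_le_sum fun i _ => h₁ i) hle) i (Finset.mem_univ i)).symm
  refine ⟨hcard, fun a b hab => ?_⟩
  have hpair : ∑ x ∈ Finset.univ.offDiag,
      (Finset.univ.filter fun i => x.1 ∈ B i ∧ x.2 ∈ B i).card =
      ∑ _x ∈ (Finset.univ : Finset (Fin 6)).offDiag, 2 := by
    have : ∑ i, ((B i).offDiag).card = ∑ x ∈ Finset.univ.offDiag,
        (Finset.univ.filter fun i => x.1 ∈ B i ∧ x.2 ∈ B i).card := by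
      simp_rw [Finset.card_filter]
      rw [Finset.sum_comm]
      refine Finset.sum_congr rfl fun i _ => ?_
      rw [← Finset.card_filter]
      congr 1
      ext x
      simp only [Finset.mem_offDiag, Finset.mem_filter, Finset.mem_univ, true_and]
      tauto
    rw [← this]
    simp [Finset.offDiag_card, hcard]
  exact (Finset.sum_eq_sum_iff_of_le fun x hx =>
    h₃ x.1 x.2 (Finset.mem_offDiag.1 hx).2.2).1 hpair (a, b)
      (Finset.mem_offDiag.2 ⟨Finset.mem_univ a, Finset.mem_univ b, hab⟩)

lemma aeval_lineCurve_lin {n : ℕ} (a x y : Fin n → ℂ) : aeval (lineCurve x y) (lin a) =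
    Polynomial.C (a ⬝ᵥ x) + Polynomial.C (a ⬝ᵥ y) * Polynomial.X := by
  simp only [lin, map_sum, map_mul, algHom_C, aeval_X, lineCurve, dotProduct, mul_add,
    Finset.sum_add_distrib, Finset.sum_mul, Polynomial.algebraMap_eq, mul_assoc]

/-- The multiplicity of a product of linear forms at a point is at most the number of its factors
vanishing there. -/
lemma card_filter_of_X_pow_dvd {n k m : ℕ} {l : Fin k → Fin n → ℂ} {x y : Fin n → ℂ}
    (hy : ∀ a, l a ⬝ᵥ y ≠ 0) (h : (Polynomial.X : Polynomial ℂ) ^ m ∣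
      aeval (lineCurve x y) (∏ a, lin (l a))) :
    m ≤ (Finset.univ.filter fun a => l a ⬝ᵥ x = 0).card := by
  rw [map_prod, ← Finset.prod_filter_mul_prod_filter_not _ (fun a => l a ⬝ᵥ x = 0)] at h
  have hx : ¬ Polynomial.X ∣ ∏ a ∈ Finset.univ.filter (fun a => ¬ l a ⬝ᵥ x = 0),
      aeval (lineCurve x y) (lin (l a)) := by
    rw [Polynomial.prime_X.dvd_finsetProd_iff]
    rintro ⟨a, ha, hd⟩
    rw [aeval_lineCurve_lin, Polynomial.X_dvd_iff] at hd
    simp only [Polynomial.coeff_add, Polynomial.coeff_C_zero, Polynomial.mul_coeff_zero,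
      Polynomial.coeff_X_zero, mul_zero, add_zero] at hd
    exact (Finset.mem_filter.1 ha).2 hd
  have hd := Polynomial.prime_X.pow_dvd_of_dvd_mul_right m hx h
  have he : ∏ a ∈ Finset.univ.filter (fun a => l a ⬝ᵥ x = 0), aeval (lineCurve x y) (lin (l a)) =
      Polynomial.C (∏ a ∈ Finset.univ.filter (fun a => l a ⬝ᵥ x = 0), l a ⬝ᵥ y) *
      Polynomial.X ^ (Finset.univ.filter fun a => l a ⬝ᵥ x = 0).card := by
    rw [map_prod, ← Finset.prod_const, ← Finset.prod_mul_distrib]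
    refine Finset.prod_congr rfl fun a ha => ?_
    rw [aeval_lineCurve_lin, (Finset.mem_filter.1 ha).2, Polynomial.C_0, zero_add]
  rw [he] at hd
  have hu : IsUnit (Polynomial.C
      (∏ a ∈ Finset.univ.filter (fun a => l a ⬝ᵥ x = 0), l a ⬝ᵥ y)) :=
    Polynomial.isUnit_C.2 (isUnit_iff_ne_zero.2 (Finset.prod_ne_zero_iff.2 fun a _ => hy a))
  rw [hu.dvd_mul_left] at hd
  exact (pow_dvd_pow_iff Polynomial.X_ne_zero Polynomial.not_isUnit_X).1 hd

namespace TenPoints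

variable {f Q : MvPolynomial (Fin 4) ℂ} {p : Fin 10 → Fin 4 → ℂ}

lemma eq_smul_of_three_points (h : TenPoints f p) {a b : Fin 4 → ℂ} (ha : a ≠ 0)
    (hab : 2 < (Finset.univ.filter fun i => a ⬝ᵥ p i = 0 ∧ b ⬝ᵥ p i = 0).card) :
    ∃ s : ℂ, b = s • a := by
  obtain ⟨i, j, k, hi, hj, hk, hij, hik, hjk⟩ := Finset.two_lt_card_iff.1 hab
  simp only [Finset.mem_filter, Finset.mem_univ, true_and] at hi hj hk
  have hU := isPlaneBasis_of_linearIndependent ha (h.linearIndependent_three hij hik hjk) (by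
    intro k; fin_cases k
    exacts [hi.1, hj.1, hk.1])
  have hb : ∀ v, a ⬝ᵥ v = 0 → b ⬝ᵥ v = 0 := by
    intro v hv
    obtain ⟨y, rfl⟩ := (hU.mem v).1 hv
    simp [planePt, Fin.sum_univ_three, hi.2, hj.2, hk.2]
  obtain ⟨w, hw⟩ := exists_dotProduct_ne_zero ha
  refine ⟨b ⬝ᵥ w / a ⬝ᵥ w, ?_⟩
  rw [← sub_eq_zero]
  refine dotProduct_eq_zero _ fun v => ?_
  have hv := hb (v - (a ⬝ᵥ v / a ⬝ᵥ w) • w) (by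
    rw [dotProduct_sub, dotProduct_smul, smul_eq_mul, div_mul_cancel₀ _ hw, sub_self])
  rw [dotProduct_sub, dotProduct_smul, smul_eq_mul] at hv
  rw [sub_dotProduct, smul_dotProduct, smul_eq_mul]
  linear_combination hv

/-- The incidences between the ten points and six tritangent planes form a design. -/
lemma isDesign (h : TenPoints f p) (hQp : ∀ i, eval (p i) Q = 0) {c κ : ℂ}
    {l : Fin 6 → Fin 4 → ℂ} (hκ : κ ≠ 0) (hl : ∀ i, IsTritangentPlane f Q p (l i) c)
    (hne : ∀ i j, i ≠ j → ∀ s : ℂ, l i ≠ s • l j)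
    (hf : f = C c * Q ^ 3 + C κ * ∏ i, lin (l i)) :
    IsDesign fun i => Finset.univ.filter fun a => l a ⬝ᵥ p i = 0 := by
  refine IsDesign.of_le (fun i => ?_) (fun a => ?_) (fun a b hab => ?_)
  · obtain ⟨y, hy⟩ : ∃ y, eval y (∏ a, lin (l a)) ≠ 0 := by
      by_contra! hcon
      exact Finset.prod_ne_zero_iff.2 (fun a _ => lin_ne_zero (hl a).ne_zero)
        (MvPolynomial.funext fun y => by rw [hcon y, map_zero])
    rw [map_prod, Finset.prod_ne_zero_iff] at hy
    refine card_filter_of_X_pow_dvd (y := y) (fun a => ?_) ?_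
    · rw [← eval_lin]
      exact hy a (Finset.mem_univ a)
    · have h1 := (h.mult i).dvd_line y
      have h2 := pow_dvd_pow_of_dvd ((multAtLeast_one.2 (hQp i)).dvd_line y) 3
      rw [pow_one] at h2
      rw [hf, map_add, map_mul, map_mul, map_pow, algHom_C, algHom_C,
        Polynomial.algebraMap_eq] at h1
      have h3 := (dvd_add_right (h2.mul_left (Polynomial.C c))).1 h1
      rwa [(Polynomial.isUnit_C.2 (isUnit_iff_ne_zero.2 hκ)).dvd_mul_left] at h3
  · simp only [Finset.mem_filter, Finset.mem_univ, true_and]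
    exact (hl a).card_le _ fun i hi => (Finset.mem_filter.1 hi).2
  · simp only [Finset.mem_filter, Finset.mem_univ, true_and]
    by_contra! hcon
    obtain ⟨s, hs⟩ := h.eq_smul_of_three_points (hl a).ne_zero hcon
    exact hne b a hab.symm s hs

end TenPoints

/-- The quadratic form in four variables whose coefficients are listed by `s`. -/
def quadForm (s : Fin 10 → ℂ) (x : Fin 4 → ℂ) : ℂ :=
  s 0 * x 0 ^ 2 + s 1 * x 1 ^ 2 + s 2 * x 2 ^ 2 + s 3 * x 3 ^ 2 + s 4 * (x 0 * x 1) +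
    s 5 * (x 0 * x 2) + s 6 * (x 0 * x 3) + s 7 * (x 1 * x 2) + s 8 * (x 1 * x 3) +
    s 9 * (x 2 * x 3)

/-- A quadratic form vanishing at ten points whose incidences with the coordinate planes and the
planes `a`, `b` are those of the `2`-`(6, 3, 2)` design is zero. -/
lemma quadForm_coeff_eq_zero {a b : Fin 4 → ℂ} {s : Fin 10 → ℂ}
    (h : ∀ T ∈ designBlocks, ∃ x : Fin 4 → ℂ, (x 0 = 0 ↔ 0 ∈ T) ∧ (x 1 = 0 ↔ 1 ∈ T) ∧
      (x 2 = 0 ↔ 2 ∈ T) ∧ (x 3 = 0 ↔ 3 ∈ T) ∧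
      (a 0 * x 0 + a 1 * x 1 + a 2 * x 2 + a 3 * x 3 = 0 ↔ 4 ∈ T) ∧
      (b 0 * x 0 + b 1 * x 1 + b 2 * x 2 + b 3 * x 3 = 0 ↔ 5 ∈ T) ∧ quadForm s x = 0) :
    ∀ k, s k = 0 := by
  obtain ⟨ha1, hb1, s1⟩ : a 1 ≠ 0 ∧ b 1 ≠ 0 ∧ s 1 = 0 := by
    obtain ⟨x, h0, h1, h2, h3, h4, h5, hq⟩ := h {0, 2, 3} (by decide)
    simp at h0 h1 h2 h3
    simp [h0, h1, h2, h3, quadForm] at h4 h5 hq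
    exact ⟨h4, h5, hq⟩
  obtain ⟨ha2, hb2, s2⟩ : a 2 ≠ 0 ∧ b 2 ≠ 0 ∧ s 2 = 0 := by
    obtain ⟨x, h0, h1, h2, h3, h4, h5, hq⟩ := h {0, 1, 3} (by decide)
    simp at h0 h1 h2 h3
    simp [h0, h1, h2, h3, quadForm] at h4 h5 hq
    exact ⟨h4, h5, hq⟩
  obtain ⟨hb3, s9⟩ : b 3 ≠ 0 ∧ s 9 * b 3 = s 3 * b 2 := by
    obtain ⟨x, h0, h1, h2, h3, h4, h5, hq⟩ := h {0, 1, 5} (by decide)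
    simp at h0 h1 h2 h3 h5
    simp only [h0, h1, s2, quadForm] at h5 hq
    refine ⟨fun hb => mul_ne_zero hb2 h2 (by linear_combination h5 - x 3 * hb), ?_⟩
    refine mul_right_cancel₀ (mul_ne_zero h2 h3) ?_
    linear_combination b 3 * hq - s 3 * x 3 * h5
  obtain ⟨ha3, s8⟩ : a 3 ≠ 0 ∧ s 8 * a 3 = s 3 * a 1 := by
    obtain ⟨x, h0, h1, h2, h3, h4, h5, hq⟩ := h {0, 2, 4} (by decide)
    simp at h0 h1 h2 h3 h4
    simp only [h0, h2, s1, quadForm] at h4 hq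
    refine ⟨fun hb => mul_ne_zero ha1 h1 (by linear_combination h4 - x 3 * hb), ?_⟩
    refine mul_right_cancel₀ (mul_ne_zero h1 h3) ?_
    linear_combination a 3 * hq - s 3 * x 3 * h4
  obtain ⟨hb0, s4⟩ : b 0 ≠ 0 ∧ s 4 * b 0 = s 0 * b 1 := by
    obtain ⟨x, h0, h1, h2, h3, h4, h5, hq⟩ := h {2, 3, 5} (by decide)
    simp at h0 h1 h2 h3 h5
    simp only [h2, h3, s1, quadForm] at h5 hq
    refine ⟨fun hb => mul_ne_zero hb1 h1 (by linear_combination h5 - x 0 * hb), ?_⟩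
    refine mul_right_cancel₀ (mul_ne_zero h0 h1) ?_
    linear_combination b 0 * hq - s 0 * x 0 * h5
  obtain ⟨ha0, hn, s5⟩ : a 0 ≠ 0 ∧ a 2 * b 0 - a 0 * b 2 ≠ 0 ∧ s 5 * a 0 = s 0 * a 2 := by
    obtain ⟨x, h0, h1, h2, h3, h4, h5, hq⟩ := h {1, 3, 4} (by decide)
    simp at h0 h1 h2 h3 h4 h5
    simp only [h1, h3, s2, quadForm] at h4 h5 hq
    refine ⟨fun hb => mul_ne_zero ha2 h2 (by linear_combination h4 - x 0 * hb),
      fun hn => h5 (mul_right_cancel₀ ha2 ?_), ?_⟩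
    · linear_combination b 2 * h4 + x 0 * hn
    refine mul_right_cancel₀ (mul_ne_zero h0 h2) ?_
    linear_combination a 0 * hq - s 0 * x 0 * h4
  obtain ⟨hab, s6⟩ : a 3 * b 0 - a 0 * b 3 ≠ 0 ∧
      s 0 * a 3 ^ 2 - s 6 * a 0 * a 3 + s 3 * a 0 ^ 2 = 0 := by
    obtain ⟨x, h0, h1, h2, h3, h4, h5, hq⟩ := h {1, 2, 4} (by decide)
    simp at h0 h1 h2 h3 h4 h5
    simp only [h1, h2, quadForm] at h4 h5 hq
    have hx : x 3 * a 3 = - (a 0 * x 0) := by linear_combination h4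
    refine ⟨fun hab => h5 (mul_right_cancel₀ ha3 ?_), mul_right_cancel₀ (pow_ne_zero 2 h0) ?_⟩
    · linear_combination b 3 * hx + x 0 * hab
    · linear_combination a 3 ^ 2 * hq - (s 6 * x 0 * a 3 + s 3 * (x 3 * a 3 - a 0 * x 0)) * hx
  have s6' : s 0 * b 3 ^ 2 - s 6 * b 0 * b 3 + s 3 * b 0 ^ 2 = 0 := by
    obtain ⟨x, h0, h1, h2, h3, h4, h5, hq⟩ := h {1, 2, 5} (by decide)
    simp at h0 h1 h2 h3 h5
    simp only [h1, h2, quadForm] at h5 hq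
    have hx : x 3 * b 3 = - (b 0 * x 0) := by linear_combination h5
    refine mul_right_cancel₀ (pow_ne_zero 2 h0) ?_
    linear_combination b 3 ^ 2 * hq - (s 6 * x 0 * b 3 + s 3 * (x 3 * b 3 - b 0 * x 0)) * hx
  obtain ⟨ε, s0⟩ : ∃ ε, s 0 = ε * (a 0 * b 0) :=
    ⟨s 0 / (a 0 * b 0), (div_mul_cancel₀ _ (mul_ne_zero ha0 hb0)).symm⟩
  rw [s0] at s4 s5 s6 s6'
  replace s4 : s 4 = ε * (a 0 * b 1) := mul_right_cancel₀ hb0 (by linear_combination s4)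
  replace s5 : s 5 = ε * (a 2 * b 0) := mul_right_cancel₀ ha0 (by linear_combination s5)
  have s3 : s 3 = ε * (a 3 * b 3) := by
    refine mul_right_cancel₀ (mul_ne_zero hab (mul_ne_zero ha0 hb0)) ?_
    linear_combination a 0 * a 3 * s6' - b 0 * b 3 * s6
  replace s6 : s 6 = ε * (a 0 * b 3 + a 3 * b 0) := by
    rw [s3] at s6
    exact mul_right_cancel₀ (mul_ne_zero ha0 ha3) (by linear_combination -s6)
  rw [s3] at s8 s9
  replace s8 : s 8 = ε * (a 1 * b 3) := mul_right_cancel₀ ha3 (by linear_combination s8)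
  replace s9 : s 9 = ε * (a 3 * b 2) := mul_right_cancel₀ hb3 (by linear_combination s9)
  obtain ⟨hm, s7⟩ : a 1 * b 2 - a 2 * b 1 ≠ 0 ∧ s 7 = - ε * (a 1 * b 2 - a 2 * b 1) := by
    obtain ⟨x, h0, h1, h2, h3, h4, h5, hq⟩ := h {3, 4, 5} (by decide)
    simp at h0 h1 h2 h3 h4 h5
    simp only [h3, s1, s2, s0, s4, s5, quadForm] at h4 h5 hq
    have hx : (a 1 * b 2 - a 2 * b 1) * x 1 = (a 2 * b 0 - a 0 * b 2) * x 0 := by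
      linear_combination b 2 * h4 - a 2 * h5
    refine ⟨fun hm => mul_ne_zero hn h0 (by rw [← hx, hm, zero_mul]), ?_⟩
    refine mul_right_cancel₀ (mul_ne_zero h1 h2) ?_
    linear_combination hq - ε * a 0 * x 0 * h5 + ε * x 2 * hx
  have s7' : s 7 = ε * (a 1 * b 2 - a 2 * b 1) := by
    obtain ⟨x, h0, h1, h2, h3, h4, h5, hq⟩ := h {0, 4, 5} (by decide)
    simp at h0 h1 h2 h3 h4 h5
    simp only [h0, s1, s2, s3, s8, s9, quadForm] at h4 h5 hq
    refine mul_right_cancel₀ (mul_ne_zero h1 h2) ?_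
    linear_combination hq - ε * a 3 * x 3 * h5 + ε * x 1 * (b 1 * h4 - a 1 * h5)
  have hε : ε = 0 := by
    refine (mul_eq_zero.1 ?_).resolve_right hm
    linear_combination (s7 - s7') / 2
  subst hε
  intro k
  fin_cases k <;> simp_all

lemma quadForm_eq_dotProduct (S : Matrix (Fin 4) (Fin 4) ℂ) (x : Fin 4 → ℂ) :
    quadForm ![S 0 0, S 1 1, S 2 2, S 3 3, S 0 1 + S 1 0, S 0 2 + S 2 0, S 0 3 + S 3 0,
      S 1 2 + S 2 1, S 1 3 + S 3 1, S 2 3 + S 3 2] x = x ⬝ᵥ S.mulVec x := by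
  simp only [quadForm, dotProduct, Matrix.mulVec, Fin.sum_univ_four, Matrix.cons_val]
  ring

/-- Four of six planes whose incidences with ten points form a `2`-`(6, 3, 2)` design are linearly
independent. -/
lemma det_ne_zero_of_design {l : Fin 6 → Fin 4 → ℂ}
    (h : ∀ T ∈ designBlocks, ∃ v, ∀ c, l c ⬝ᵥ v = 0 ↔ c ∈ T) :
    (Matrix.of ![l 0, l 1, l 2, l 3]).det ≠ 0 := by
  intro hdet
  obtain ⟨r, hr, hr0⟩ := Matrix.exists_vecMul_eq_zero_iff.2 hdet
  have key : ∀ v, r 0 * l 0 ⬝ᵥ v + r 1 * l 1 ⬝ᵥ v + r 2 * l 2 ⬝ᵥ v + r 3 * l 3 ⬝ᵥ v = 0 := by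
    intro v
    have : r ⬝ᵥ (Matrix.of ![l 0, l 1, l 2, l 3]).mulVec v = 0 := by
      rw [Matrix.dotProduct_mulVec, hr0, zero_dotProduct]
    rw [dotProduct, Fin.sum_univ_four] at this
    exact this
  have h2 : r 2 = 0 := by
    obtain ⟨v, hv⟩ := h {0, 1, 3} (by decide)
    have := key v
    rw [(hv 0).2 (by decide), (hv 1).2 (by decide), (hv 3).2 (by decide)] at this
    exact (mul_eq_zero.1 (by linear_combination this)).resolve_right (mt (hv 2).1 (by decide))
  have h1 : r 1 = 0 := by
    obtain ⟨v, hv⟩ := h {0, 2, 3} (by decide)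
    have := key v
    rw [(hv 0).2 (by decide), (hv 2).2 (by decide), (hv 3).2 (by decide)] at this
    exact (mul_eq_zero.1 (by linear_combination this)).resolve_right (mt (hv 1).1 (by decide))
  have h3 : r 3 = 0 := by
    obtain ⟨v, hv⟩ := h {0, 1, 5} (by decide)
    have := key v
    rw [(hv 0).2 (by decide), h1, h2] at this
    exact (mul_eq_zero.1 (by linear_combination this)).resolve_right (mt (hv 3).1 (by decide))
  have h0 : r 0 = 0 := by
    obtain ⟨v, hv⟩ := h {1, 2, 5} (by decide)
    have := key v
    rw [h1, h2, h3] at this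
    exact (mul_eq_zero.1 (by linear_combination this)).resolve_right (mt (hv 0).1 (by decide))
  refine hr ?_
  ext k
  fin_cases k
  exacts [h0, h1, h2, h3]

/-- No nonzero quadratic form vanishes at ten points whose incidences with six planes form a
`2`-`(6, 3, 2)` design. -/
lemma eq_zero_of_design {Q : MvPolynomial (Fin 4) ℂ} (hQ : Q.IsHomogeneous 2)
    {l : Fin 6 → Fin 4 → ℂ}
    (h : ∀ T ∈ designBlocks, ∃ v, (∀ c, l c ⬝ᵥ v = 0 ↔ c ∈ T) ∧ eval v Q = 0) : Q = 0 := by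
  have hdet := det_ne_zero_of_design fun T hT => (h T hT).imp fun _ hv => hv.1
  set M := Matrix.of ![l 0, l 1, l 2, l 3] with hM
  have hinv : M⁻¹ * M = 1 := Matrix.nonsing_inv_mul M (isUnit_iff_ne_zero.2 hdet)
  have hcancel : ∀ v, M⁻¹.mulVec (M.mulVec v) = v := fun v => by
    rw [Matrix.mulVec_mulVec, hinv, Matrix.one_mulVec]
  obtain ⟨A, -, hA, -⟩ := exists_symm_matrix hQ
  set S := M⁻¹.transpose * A * M⁻¹ with hS
  have hQS : ∀ v, eval v Q = M.mulVec v ⬝ᵥ S.mulVec (M.mulVec v) := fun v => by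
    rw [hA, hS, ← Matrix.mulVec_mulVec, hcancel, ← Matrix.mulVec_mulVec,
      Matrix.dotProduct_mulVec (M.mulVec v), Matrix.vecMul_transpose, hcancel]
  have hl : ∀ k v, l k ⬝ᵥ v = Matrix.vecMul (l k) M⁻¹ ⬝ᵥ M.mulVec v := fun k v => by
    rw [← Matrix.dotProduct_mulVec, hcancel]
  have hs := quadForm_coeff_eq_zero (a := Matrix.vecMul (l 4) M⁻¹) (b := Matrix.vecMul (l 5) M⁻¹)
    (s := ![S 0 0, S 1 1, S 2 2, S 3 3, S 0 1 + S 1 0, S 0 2 + S 2 0, S 0 3 + S 3 0,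
      S 1 2 + S 2 1, S 1 3 + S 3 1, S 2 3 + S 3 2]) fun T hT => by
    obtain ⟨v, hv, hvQ⟩ := h T hT
    have h4 := hv 4
    have h5 := hv 5
    rw [hl, dotProduct, Fin.sum_univ_four] at h4 h5
    exact ⟨M.mulVec v, hv 0, hv 1, hv 2, hv 3, h4, h5, by rw [quadForm_eq_dotProduct, ← hQS, hvQ]⟩
  refine MvPolynomial.funext fun v => ?_
  rw [hQS, ← quadForm_eq_dotProduct, map_zero]
  simp only [quadForm, hs, zero_mul, add_zero]

namespace TenPoints

variable {f Q : MvPolynomial (Fin 4) ℂ} {p : Fin 10 → Fin 4 → ℂ}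

lemma false_of_prime_quadric (h : TenPoints f p) (hQ : Q.IsHomogeneous 2) (hprime : Prime Q)
    (hQp : ∀ i, eval (p i) Q = 0) : False := by
  obtain ⟨c, κ, l, hκ, hl, hne, hf⟩ := h.exists_eq_add_prod hQ hprime hQp
  obtain ⟨σ, -, hσ⟩ := (h.isDesign hQp hκ hl hne hf).exists_injective_mem_iff
  refine hprime.ne_zero (eq_zero_of_design hQ (l := fun a => l (σ a)) fun T hT => ?_)
  obtain ⟨i, hi⟩ := hσ T hT
  exact ⟨p i, fun a => by rw [← hi a]; simp, hQp i⟩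

lemma eq_zero_of_quadric (h : TenPoints f p) (hQ : Q.IsHomogeneous 2)
    (hQp : ∀ i, eval (p i) Q = 0) : Q = 0 := by
  by_contra h0
  obtain hprime | ⟨a, b, rfl⟩ := prime_or_eq_lin_mul_lin hQ h0
  · exact h.false_of_prime_quadric hQ hprime hQp
  · refine h.false_of_two_planes (a := a) (b := b) ?_ ?_ fun i => ?_
    · rintro rfl
      exact h0 (by simp [lin])
    · rintro rfl
      exact h0 (by simp [lin])
    · have := hQp i
      rwa [map_mul, eval_lin, eval_lin, mul_eq_zero] at this

end TenPoints

/-- For a sextic whose only singularities are exactly ten ordinary triple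
points, no nonzero quadratic form vanishes at all ten triple points: the ten points do
not lie on a quadric surface. -/
theorem sextic_ten_triple_points_no_quadric
    (f : MvPolynomial (Fin 4) ℂ) (hf : f ≠ 0) (hhom : f.IsHomogeneous 6)
    (hX : OnlyTriplePoints 6 10 f) :
    ∀ q : MvPolynomial (Fin 4) ℂ, q.IsHomogeneous 2 →
      (∀ P ∈ SingSet f, MvPolynomial.eval P.rep q = 0) → q = 0 := by
  intro q hq hqp
  obtain ⟨p, hp, hrep⟩ := exists_tenPoints hhom hX
  refine hp.eq_zero_of_quadric hq fun i => ?_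
  obtain ⟨P, hP, hPi⟩ := hrep i
  rw [← hPi]
  exact hqp P hP
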